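/- arXiv:1306.3770 — 2 statements merged into one kernel-verified Lean document; each statement's English description precedes it below -/
import Mathlib

section
/- Let α, β ∈ (0,1) and assume min_{ν ≥ 0} √( β(ν² + 1 + 2√(2/π)·ν) + (1−β)·( erfc(ν/√2)·(1+ν²) − 2ν·e^{−ν²/2}/√(2π) ) ) < √α. Then there exists ε > 0 such that for all sufficiently large n, with m = ⌈αn⌉, k = ⌈βn⌉, and A an m×n random matrix with i.i.d. standard normal entries, the probability is at least 1 − e^{−εn} that every x ∈ ℝ^n supported on the last k coordinates (x_i = 0 for i ≤ n−k) is the unique solution of the optimization problem: minimize ‖z‖₁ subject to Az = Ax. -/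
open MeasureTheory ProbabilityTheory

/-- The standard error function `erf x = (2/√π) ∫₀ˣ e^{−t²} dt`. -/
noncomputable def erf (x : ℝ) : ℝ :=
  (2 / Real.sqrt Real.pi) * ∫ t in (0 : ℝ)..x, Real.exp (-t ^ 2)

/-- The complementary error function. -/
noncomputable def erfc (x : ℝ) : ℝ := 1 - erf x

/-- `x` is the unique minimizer of `‖z‖₁` subject to `Az = Ax`. -/
def UniqueL1Min {m n : ℕ} (A : Fin m → Fin n → ℝ) (x : Fin n → ℝ) : Prop :=
  ∀ z : Fin n → ℝ, (∀ i, ∑ j, A i j * z j = ∑ j, A i j * x j) → z ≠ x →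
    ∑ i, |x i| < ∑ i, |z i|

/-- The law of an `m × n` matrix with i.i.d. standard normal entries. -/
noncomputable def matrixGaussian (m n : ℕ) : Measure (Fin m → Fin n → ℝ) :=
  Measure.pi fun _ => Measure.pi fun _ => gaussianReal 0 1

lemma isGaussian_pi' {ι : Type*} [Fintype ι] {E : Type*} [NormedAddCommGroup E] [NormedSpace ℝ E] [MeasurableSpace E] [BorelSpace E] [SecondCountableTopology E] [CompleteSpace E] (μ : Measure E) [IsGaussian μ] : IsGaussian (Measure.pi fun _ : ι => μ) := by
  have h : iIndepFun (fun (i : ι) (x : ι → E) => x i) (Measure.pi fun _ : ι => μ) := by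
    have := iIndepFun_pi (μ := fun _ : ι => μ) (X := fun _ x => x) (fun i => aemeasurable_id)
    exact this
  have h2 : HasGaussianLaw (fun (x : ι → E) (i:ι) => x i) (Measure.pi fun _ : ι => μ) := by
    refine iIndepFun.hasGaussianLaw (fun i => ⟨?_⟩) h
    have := (measurePreserving_eval (fun _ : ι => μ) i).map_eq
    erw [this]; infer_instance
  have := h2.isGaussian_map
  simpa using this

lemma stable_gauss {X : Type*} [NormedAddCommGroup X] [NormedSpace ℝ X] [MeasurableSpace X]
    [BorelSpace X] [SecondCountableTopology X] [CompleteSpace X] (μ : Measure X) [IsGaussian μ]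
    (hμ : ∀ L : StrongDual ℝ X, ∫ x, L x ∂μ = 0) (f : X → ℝ) (hf : Continuous f) (a s : ℝ) :
    ∫ p : X × X, f (a • p.1 + s • p.2) ∂(μ.prod μ) = ∫ x, f (√(a ^ 2 + s ^ 2) • x) ∂μ := by
  set r := √(a ^ 2 + s ^ 2) with hr
  set θ := Complex.arg ⟨a, s⟩
  have hn : ‖(⟨a, s⟩ : ℂ)‖ = r := by
    rw [Complex.norm_def, Complex.normSq_mk, hr]; ring_nf
  have hc : r * Real.cos θ = a := by rw [← hn]; exact Complex.norm_mul_cos_arg _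
  have hs : r * Real.sin θ = s := by rw [← hn]; exact Complex.norm_mul_sin_arg _
  have hrot := IsGaussian.map_rotation_eq_self_of_forall_strongDual_eq_zero hμ θ
  calc ∫ p : X × X, f (a • p.1 + s • p.2) ∂(μ.prod μ)
      = ∫ p : X × X, f (r • (ContinuousLinearMap.rotation θ p).1) ∂(μ.prod μ) := by
        simp only [ContinuousLinearMap.rotation_apply, smul_add, smul_smul, hc, hs]
    _ = ∫ p : X × X, f (r • p.1) ∂((μ.prod μ).map (ContinuousLinearMap.rotation θ)) := by
        rw [integral_map (by fun_prop) (by fun_prop)]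
    _ = ∫ p : X × X, f (r • p.1) ∂(μ.prod μ) := by rw [hrot]
    _ = ∫ x, f (r • x) ∂μ := by
        rw [integral_fun_fst (μ := μ) (ν := μ) (fun x => f (r • x))]; simp

section side

variable {X : Type*} [NormedAddCommGroup X] [NormedSpace ℝ X] [MeasurableSpace X]
    [BorelSpace X] [SecondCountableTopology X] [CompleteSpace X]
  {E : Type*} [NormedAddCommGroup E] [NormedSpace ℝ E] {I : Type*} [Fintype I]

lemma side_three (μ : Measure X) [IsGaussian μ] (P : I → X →L[ℝ] E) (φ : E → ℝ)
    (hφ0 : ∀ z, 0 ≤ φ z) (hφ1 : ∀ z, φ z ≤ 1) (hφc : Continuous φ) (C B : ℝ) (hC : 0 ≤ C)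
    (hB : 0 ≤ B) (hP : ∀ i x, ‖P i x‖ ≤ B * ‖x‖) (hlip : ∀ z v, |φ (z + v) - φ z| ≤ C * ‖v‖)
    (z : I → E) (s : ℝ) (hs : 0 ≤ s) (S : Finset I) (hS : 3 ≤ S.card) :
    |∫ x, ∏ i ∈ S, (φ (z i + s • P i x) - φ (z i)) ∂μ| ≤ (C * B) ^ 3 * (∫ x, ‖x‖ ^ 3 ∂μ) * s ^ 3 := by
  have hint : Integrable (fun x => ‖x‖ ^ 3) μ := (IsGaussian.memLp_id μ 3 (by simp)).integrable_norm_pow (by simp)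
  have hb : ∀ x, |∏ i ∈ S, (φ (z i + s • P i x) - φ (z i))| ≤ (C * B) ^ 3 * ‖x‖ ^ 3 * s ^ 3 := by
    intro x
    rw [Finset.abs_prod]
    set t := min 1 (C * (s * (B * ‖x‖))) with ht
    have ht0 : 0 ≤ t := le_min zero_le_one (by positivity)
    have h1 : ∀ i ∈ S, |φ (z i + s • P i x) - φ (z i)| ≤ t := by
      intro i _
      refine le_min ?_ ?_
      · have := hφ0 (z i + s • P i x); have := hφ0 (z i)
        have := hφ1 (z i + s • P i x); have := hφ1 (z i)
        rw [abs_le]; constructor <;> linarith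
      · refine (hlip _ _).trans ?_
        rw [norm_smul, Real.norm_eq_abs, abs_of_nonneg hs]
        gcongr
        exact hP i x
    calc ∏ i ∈ S, |φ (z i + s • P i x) - φ (z i)| ≤ ∏ i ∈ S, t :=
          Finset.prod_le_prod (fun _ _ => abs_nonneg _) h1
      _ = t ^ S.card := by simp
      _ ≤ t ^ 3 := pow_le_pow_of_le_one ht0 (min_le_left _ _) hS
      _ ≤ (C * (s * (B * ‖x‖))) ^ 3 := pow_le_pow_left₀ ht0 (min_le_right _ _) 3
      _ = _ := by ring
  calc _ ≤ ∫ x, |∏ i ∈ S, (φ (z i + s • P i x) - φ (z i))| ∂μ := abs_integral_le_integral_abs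
    _ ≤ ∫ x, (C * B) ^ 3 * ‖x‖ ^ 3 * s ^ 3 ∂μ := by
      refine integral_mono_of_nonneg (Filter.Eventually.of_forall fun x => abs_nonneg _)
        ((hint.const_mul _).mul_const _) (Filter.Eventually.of_forall hb)
    _ = _ := by rw [integral_mul_const, integral_const_mul]

lemma side_two (μ : Measure X) [IsGaussian μ] (P : I → X →L[ℝ] E) (φ : E → ℝ)
    (L : E → E →L[ℝ] ℝ) (hφc : Continuous φ) (C B : ℝ) (hC : 0 ≤ C)
    (hB : 0 ≤ B) (hP : ∀ i x, ‖P i x‖ ≤ B * ‖x‖) (hlip : ∀ z v, |φ (z + v) - φ z| ≤ C * ‖v‖)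
    (hL : ∀ z v, |L z v| ≤ C * ‖v‖) (hrem : ∀ z v, |φ (z + v) - φ z - L z v| ≤ C * ‖v‖ ^ 2)
    (z : I → E) (s : ℝ) (hs : 0 ≤ s) (i j : I) :
    |∫ x, (φ (z i + s • P i x) - φ (z i)) * (φ (z j + s • P j x) - φ (z j)) ∂μ
      - s ^ 2 * ∫ x, L (z i) (P i x) * L (z j) (P j x) ∂μ|
      ≤ 2 * C ^ 2 * B ^ 3 * (∫ x, ‖x‖ ^ 3 ∂μ) * s ^ 3 := by
  have hint : Integrable (fun x => ‖x‖ ^ 3) μ := (IsGaussian.memLp_id μ 3 (by simp)).integrable_norm_pow (by simp)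
  have hint2 : Integrable (fun x => ‖x‖ ^ 2) μ := (IsGaussian.memLp_id μ 2 (by simp)).integrable_norm_pow (by simp)
  have hn : ∀ i x, ‖s • P i x‖ ≤ s * (B * ‖x‖) := by
    intro i x
    rw [norm_smul, Real.norm_eq_abs, abs_of_nonneg hs]; gcongr; exact hP i x
  have hd : ∀ i x, |φ (z i + s • P i x) - φ (z i)| ≤ C * (s * (B * ‖x‖)) := fun i x =>
    (hlip _ _).trans (by gcongr; exact hn i x)
  have hl : ∀ i x, |L (z i) (s • P i x)| ≤ C * (s * (B * ‖x‖)) := fun i x =>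
    (hL _ _).trans (by gcongr; exact hn i x)
  have hl1 : ∀ i x, |L (z i) (P i x)| ≤ C * (B * ‖x‖) := fun i x =>
    (hL _ _).trans (by gcongr; exact hP i x)
  have hr : ∀ i x, |φ (z i + s • P i x) - φ (z i) - L (z i) (s • P i x)| ≤ C * (s * (B * ‖x‖)) ^ 2 := fun i x =>
    (hrem _ _).trans (by gcongr; exact hn i x)
  have hi1 : Integrable (fun x => (φ (z i + s • P i x) - φ (z i)) * (φ (z j + s • P j x) - φ (z j))) μ := by
    refine (hint2.const_mul (C ^ 2 * s ^ 2 * B ^ 2)).mono' (by fun_prop) (Filter.Eventually.of_forall fun x => ?_)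
    rw [Real.norm_eq_abs, abs_mul]
    calc _ ≤ (C * (s * (B * ‖x‖))) * (C * (s * (B * ‖x‖))) := by
          gcongr
          · exact hd i x
          · exact hd j x
      _ = _ := by ring
  have hi2 : Integrable (fun x => L (z i) (P i x) * L (z j) (P j x)) μ := by
    refine (hint2.const_mul (C ^ 2 * B ^ 2)).mono' (by fun_prop) (Filter.Eventually.of_forall fun x => ?_)
    rw [Real.norm_eq_abs, abs_mul]
    calc _ ≤ (C * (B * ‖x‖)) * (C * (B * ‖x‖)) := by
          gcongr
          · exact hl1 i x
          · exact hl1 j x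
      _ = _ := by ring
  rw [← integral_const_mul, ← integral_sub hi1 (hi2.const_mul _)]
  calc _ ≤ ∫ x, |(φ (z i + s • P i x) - φ (z i)) * (φ (z j + s • P j x) - φ (z j)) - s ^ 2 * (L (z i) (P i x) * L (z j) (P j x))| ∂μ := abs_integral_le_integral_abs
    _ ≤ ∫ x, 2 * C ^ 2 * B ^ 3 * ‖x‖ ^ 3 * s ^ 3 ∂μ := by
      refine integral_mono_of_nonneg (Filter.Eventually.of_forall fun x => abs_nonneg _)
        ((hint.const_mul _).mul_const _) (Filter.Eventually.of_forall fun x => ?_)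
      dsimp only
      have e : (φ (z i + s • P i x) - φ (z i)) * (φ (z j + s • P j x) - φ (z j)) - s ^ 2 * (L (z i) (P i x) * L (z j) (P j x))
        = (φ (z i + s • P i x) - φ (z i)) * (φ (z j + s • P j x) - φ (z j) - L (z j) (s • P j x))
          + (φ (z i + s • P i x) - φ (z i) - L (z i) (s • P i x)) * L (z j) (s • P j x) := by
        simp only [map_smul, smul_eq_mul]; ring
      rw [e]
      refine (abs_add_le _ _).trans ?_
      rw [abs_mul, abs_mul]
      calc _ ≤ (C * (s * (B * ‖x‖))) * (C * (s * (B * ‖x‖)) ^ 2) + (C * (s * (B * ‖x‖)) ^ 2) * (C * (s * (B * ‖x‖))) := by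
            gcongr
            · exact hd i x
            · exact hr j x
            · exact hr i x
            · exact hl j x
        _ = _ := by ring
    _ = _ := by rw [integral_mul_const, integral_const_mul]

end side

section compare

variable {X : Type*} [NormedAddCommGroup X] [NormedSpace ℝ X] [MeasurableSpace X]
    [BorelSpace X] [SecondCountableTopology X] [CompleteSpace X]
  {Y : Type*} [NormedAddCommGroup Y] [NormedSpace ℝ Y] [MeasurableSpace Y]
    [BorelSpace Y] [SecondCountableTopology Y] [CompleteSpace Y]
  {E : Type*} [NormedAddCommGroup E] [NormedSpace ℝ E] [MeasurableSpace E] [BorelSpace E]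
    [SecondCountableTopology E] [CompleteSpace E] {I : Type*} [Fintype I]

lemma map_eq_of_second (μ : Measure X) [IsGaussian μ] (ν : Measure Y) [IsGaussian ν]
    (hμ : ∀ L : StrongDual ℝ X, ∫ x, L x ∂μ = 0) (hν : ∀ L : StrongDual ℝ Y, ∫ x, L x ∂ν = 0)
    (P : X →L[ℝ] E) (Q : Y →L[ℝ] E)
    (H : ∀ L : E →L[ℝ] ℝ, ∫ x, L (P x) * L (P x) ∂μ = ∫ y, L (Q y) * L (Q y) ∂ν) :
    μ.map P = ν.map Q := by
  refine Measure.ext_of_charFunDual ?_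
  ext L
  have h1 : ∀ L : StrongDual ℝ E, ∫ x, L x ∂(μ.map P) = 0 := by
    intro L
    rw [integral_map (by fun_prop) (by fun_prop)]
    exact hμ (L ∘L P)
  have h2 : ∀ L : StrongDual ℝ E, ∫ x, L x ∂(ν.map Q) = 0 := by
    intro L
    rw [integral_map (by fun_prop) (by fun_prop)]
    exact hν (L ∘L Q)
  rw [IsGaussian.charFunDual_eq_of_forall_strongDual_eq_zero h1,
    IsGaussian.charFunDual_eq_of_forall_strongDual_eq_zero h2]
  have : Var[L; μ.map P] = Var[L; ν.map Q] := by
    rw [variance_of_integral_eq_zero (by fun_prop) (h1 L), variance_of_integral_eq_zero (by fun_prop) (h2 L),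
      integral_map (by fun_prop) (by fun_prop), integral_map (by fun_prop) (by fun_prop)]
    simp only [pow_two]
    exact H L
  rw [this]

lemma compare_step (μ : Measure X) [IsGaussian μ] (ν : Measure Y) [IsGaussian ν]
    (hμ : ∀ L : StrongDual ℝ X, ∫ x, L x ∂μ = 0) (hν : ∀ L : StrongDual ℝ Y, ∫ x, L x ∂ν = 0)
    (P : I → X →L[ℝ] E) (Q : I → Y →L[ℝ] E) (φ : E → ℝ) (L : E → E →L[ℝ] ℝ)
    (hφ0 : ∀ z, 0 ≤ φ z) (hφ1 : ∀ z, φ z ≤ 1) (hφc : Continuous φ) (C : ℝ) (hC : 0 ≤ C)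
    (hlip : ∀ z v, |φ (z + v) - φ z| ≤ C * ‖v‖)
    (hL : ∀ z v, |L z v| ≤ C * ‖v‖) (hrem : ∀ z v, |φ (z + v) - φ z - L z v| ≤ C * ‖v‖ ^ 2)
    (H1 : ∀ i, ∀ L : E →L[ℝ] ℝ, ∫ x, L (P i x) * L (P i x) ∂μ = ∫ y, L (Q i y) * L (Q i y) ∂ν)
    (H2 : ∀ i j z z', ∫ y, L z (Q i y) * L z' (Q j y) ∂ν ≤ ∫ x, L z (P i x) * L z' (P j x) ∂μ) :
    ∃ K : ℝ, ∀ (z : I → E) (s : ℝ), 0 ≤ s →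
      ∫ y, ∏ i, φ (z i + s • Q i y) ∂ν ≤ ∫ x, ∏ i, φ (z i + s • P i x) ∂μ + K * s ^ 3 := by
  classical
  set B : ℝ := ∑ i, (‖P i‖ + ‖Q i‖) with hBdef
  have hB : 0 ≤ B := Finset.sum_nonneg fun i _ => by positivity
  have hBi : ∀ i, ‖P i‖ + ‖Q i‖ ≤ B := fun i =>
    Finset.single_le_sum (f := fun i => ‖P i‖ + ‖Q i‖) (fun i _ => by positivity) (Finset.mem_univ i)
  have hP : ∀ i x, ‖P i x‖ ≤ B * ‖x‖ := fun i x => ((P i).le_opNorm x).trans (by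
    gcongr; linarith [hBi i, norm_nonneg (Q i)])
  have hQ : ∀ i x, ‖Q i x‖ ≤ B * ‖x‖ := fun i x => ((Q i).le_opNorm x).trans (by
    gcongr; linarith [hBi i, norm_nonneg (P i)])
  set Mμ := ∫ x, ‖x‖ ^ 3 ∂μ
  set Mν := ∫ x, ‖x‖ ^ 3 ∂ν
  have hMμ : 0 ≤ Mμ := integral_nonneg fun x => by positivity
  have hMν : 0 ≤ Mν := integral_nonneg fun x => by positivity
  set K0 := ((C * B) ^ 3 + 2 * C ^ 2 * B ^ 3) * (Mμ + Mν) with hK0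
  have hK0n : 0 ≤ K0 := by positivity
  refine ⟨∑ S : Finset I, K0, fun z s hs => ?_⟩
  have key : ∀ S : Finset I, ∫ y, ∏ i ∈ S, (φ (z i + s • Q i y) - φ (z i)) ∂ν
      ≤ ∫ x, ∏ i ∈ S, (φ (z i + s • P i x) - φ (z i)) ∂μ + K0 * s ^ 3 := by
    intro S
    have hs3 : 0 ≤ s ^ 3 := by positivity
    rcases lt_or_ge S.card 3 with h | h
    · have : S.card = 0 ∨ S.card = 1 ∨ S.card = 2 := by omega
      rcases this with h | h | h
      · rw [Finset.card_eq_zero] at h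
        subst h
        simp only [Finset.prod_empty, integral_const, probReal_univ, smul_eq_mul, mul_one]
        nlinarith [mul_nonneg hK0n hs3]
      · obtain ⟨i, rfl⟩ := Finset.card_eq_one.mp h
        simp only [Finset.prod_singleton]
        have hm := map_eq_of_second μ ν hμ hν (P i) (Q i) (H1 i)
        have e1 : ∫ x, (φ (z i + s • P i x) - φ (z i)) ∂μ = ∫ v, (φ (z i + s • v) - φ (z i)) ∂(μ.map (P i)) := by
          rw [integral_map (by fun_prop) (by fun_prop)]
        have e2 : ∫ x, (φ (z i + s • Q i x) - φ (z i)) ∂ν = ∫ v, (φ (z i + s • v) - φ (z i)) ∂(ν.map (Q i)) := by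
          rw [integral_map (by fun_prop) (by fun_prop)]
        rw [e1, e2, hm]
        nlinarith [mul_nonneg hK0n hs3]
      · obtain ⟨i, j, hij, rfl⟩ := Finset.card_eq_two.mp h
        simp only [Finset.prod_pair hij]
        have a1 := abs_le.mp (side_two μ P φ L hφc C B hC hB hP hlip hL hrem z s hs i j)
        have a2 := abs_le.mp (side_two ν Q φ L hφc C B hC hB hQ hlip hL hrem z s hs i j)
        have a3 := mul_le_mul_of_nonneg_left (H2 i j (z i) (z j)) (sq_nonneg s)
        have a4 : 0 ≤ (C * B) ^ 3 * (Mμ + Mν) * s ^ 3 := by positivity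
        rw [hK0]
        linarith [a1.1, a2.2]
    · have a1 := abs_le.mp (side_three μ P φ hφ0 hφ1 hφc C B hC hB hP hlip z s hs S h)
      have a2 := abs_le.mp (side_three ν Q φ hφ0 hφ1 hφc C B hC hB hQ hlip z s hs S h)
      have a4 : 0 ≤ 2 * C ^ 2 * B ^ 3 * (Mμ + Mν) * s ^ 3 := by positivity
      rw [hK0]
      linarith [a1.1, a2.2]
  have bd : ∀ (z v : E), |φ (z + v) - φ z| ≤ 1 := by
    intro z v
    have := hφ0 (z + v); have := hφ0 z
    have := hφ1 (z + v); have := hφ1 z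
    rw [abs_le]; constructor <;> linarith
  have ex1 : ∫ x, ∏ i, φ (z i + s • P i x) ∂μ = ∑ S : Finset I, (∫ x, ∏ i ∈ S, (φ (z i + s • P i x) - φ (z i)) ∂μ) * ∏ i ∈ Finset.univ \ S, φ (z i) := by
    simp_rw [← integral_mul_const]
    rw [← integral_finset_sum]
    · congr 1; ext x
      have := Finset.prod_add (fun i => φ (z i + s • P i x) - φ (z i)) (fun i => φ (z i)) Finset.univ
      simpa using this
    · intro S _
      refine Integrable.mul_const ?_ _
      refine Integrable.of_bound (by fun_prop) 1 (Filter.Eventually.of_forall fun x => ?_)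
      rw [Real.norm_eq_abs, Finset.abs_prod]
      exact Finset.prod_le_one (fun _ _ => abs_nonneg _) fun i _ => bd _ _
  have ex2 : ∫ x, ∏ i, φ (z i + s • Q i x) ∂ν = ∑ S : Finset I, (∫ x, ∏ i ∈ S, (φ (z i + s • Q i x) - φ (z i)) ∂ν) * ∏ i ∈ Finset.univ \ S, φ (z i) := by
    simp_rw [← integral_mul_const]
    rw [← integral_finset_sum]
    · congr 1; ext x
      have := Finset.prod_add (fun i => φ (z i + s • Q i x) - φ (z i)) (fun i => φ (z i)) Finset.univ
      simpa using this
    · intro S _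
      refine Integrable.mul_const ?_ _
      refine Integrable.of_bound (by fun_prop) 1 (Filter.Eventually.of_forall fun x => ?_)
      rw [Real.norm_eq_abs, Finset.abs_prod]
      exact Finset.prod_le_one (fun _ _ => abs_nonneg _) fun i _ => bd _ _
  rw [ex1, ex2, Finset.sum_mul, ← Finset.sum_add_distrib]
  refine Finset.sum_le_sum fun S _ => ?_
  have p0 : 0 ≤ ∏ i ∈ Finset.univ \ S, φ (z i) := Finset.prod_nonneg fun i _ => hφ0 _
  have p1 : ∏ i ∈ Finset.univ \ S, φ (z i) ≤ 1 := Finset.prod_le_one (fun i _ => hφ0 _) fun i _ => hφ1 _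
  have hk : 0 ≤ K0 * s ^ 3 := by positivity
  calc _ ≤ (∫ x, ∏ i ∈ S, (φ (z i + s • P i x) - φ (z i)) ∂μ + K0 * s ^ 3) * ∏ i ∈ Finset.univ \ S, φ (z i) :=
        mul_le_mul_of_nonneg_right (key S) p0
    _ ≤ _ := by rw [add_mul]; exact add_le_add_right (mul_le_of_le_one_right hk p1) _

lemma gordon_abstract (μ : Measure X) [IsGaussian μ] (ν : Measure Y) [IsGaussian ν]
    (hμ : ∀ L : StrongDual ℝ X, ∫ x, L x ∂μ = 0) (hν : ∀ L : StrongDual ℝ Y, ∫ x, L x ∂ν = 0)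
    (P : I → X →L[ℝ] E) (Q : I → Y →L[ℝ] E) (φ : E → ℝ) (L : E → E →L[ℝ] ℝ)
    (hφ0 : ∀ z, 0 ≤ φ z) (hφ1 : ∀ z, φ z ≤ 1) (hφc : Continuous φ) (C : ℝ) (hC : 0 ≤ C)
    (hlip : ∀ z v, |φ (z + v) - φ z| ≤ C * ‖v‖)
    (hL : ∀ z v, |L z v| ≤ C * ‖v‖) (hrem : ∀ z v, |φ (z + v) - φ z - L z v| ≤ C * ‖v‖ ^ 2)
    (H1 : ∀ i, ∀ L : E →L[ℝ] ℝ, ∫ x, L (P i x) * L (P i x) ∂μ = ∫ y, L (Q i y) * L (Q i y) ∂ν)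
    (H2 : ∀ i j z z', ∫ y, L z (Q i y) * L z' (Q j y) ∂ν ≤ ∫ x, L z (P i x) * L z' (P j x) ∂μ) :
    ∫ y, ∏ i, φ (Q i y) ∂ν ≤ ∫ x, ∏ i, φ (P i x) ∂μ := by
  obtain ⟨K, hK⟩ := compare_step μ ν hμ hν P Q φ L hφ0 hφ1 hφc C hC hlip hL hrem H1 H2
  let F : (I → E) → ℝ := fun z => ∏ i, φ (z i)
  have hFc : Continuous F := by fun_prop
  have hFb : ∀ z, ‖F z‖ ≤ 1 := fun z => by
    rw [Real.norm_eq_abs, abs_of_nonneg (Finset.prod_nonneg fun i _ => hφ0 _)]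
    exact Finset.prod_le_one (fun i _ => hφ0 _) fun i _ => hφ1 _
  let J : ℝ → ℝ → ℝ := fun a b => ∫ x, ∫ y, F (fun i => a • P i x + b • Q i y) ∂ν ∂μ
  -- absorbing lemma
  have JP : ∀ a b s, J (√(a ^ 2 + s ^ 2)) b = ∫ x, ∫ y, ∫ x', F (fun i => (a • P i x + b • Q i y) + s • P i x') ∂μ ∂ν ∂μ := by
    intro a b s
    have h := fun y => stable_gauss μ hμ (fun x => F (fun i => P i x + b • Q i y)) (by fun_prop) a s
    have i1 : Integrable (Function.uncurry fun x y => F (fun i => √(a ^ 2 + s ^ 2) • P i x + b • Q i y)) (μ.prod ν) :=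
      Integrable.of_bound (Continuous.aestronglyMeasurable (by unfold Function.uncurry; fun_prop)) 1 (Filter.Eventually.of_forall fun x => hFb _)
    have e1 : J (√(a ^ 2 + s ^ 2)) b = ∫ y, ∫ x, F (fun i => √(a ^ 2 + s ^ 2) • P i x + b • Q i y) ∂μ ∂ν :=
      integral_integral_swap i1
    have cont : Continuous fun p : (X × Y) × X => F (fun i => (a • P i p.1.1 + b • Q i p.1.2) + s • P i p.2) := by fun_prop
    have i2 : Integrable (Function.uncurry fun x y => ∫ x', F (fun i => (a • P i x + b • Q i y) + s • P i x') ∂μ) (μ.prod ν) := by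
      refine Integrable.of_bound ?_ 1 (Filter.Eventually.of_forall fun x => ?_)
      · exact (cont.stronglyMeasurable.integral_prod_right' (ν := μ)).aestronglyMeasurable
      · refine (norm_integral_le_of_norm_le_const (Filter.Eventually.of_forall fun x => hFb _)).trans ?_
        simp
    have e2 := integral_integral_swap i2
    rw [e1, e2]
    congr 1; ext y
    have hy := h y
    simp only [map_smul, map_add] at hy
    rw [← hy, integral_prod]
    · simp only [add_right_comm]
    · exact Integrable.of_bound (Continuous.aestronglyMeasurable (by fun_prop)) 1 (Filter.Eventually.of_forall fun x => hFb _)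
  have JQ : ∀ a b s, J a (√(b ^ 2 + s ^ 2)) = ∫ x, ∫ y, ∫ y', F (fun i => (a • P i x + b • Q i y) + s • Q i y') ∂ν ∂ν ∂μ := by
    intro a b s
    refine integral_congr_ae (Filter.Eventually.of_forall fun x => ?_)
    dsimp only
    have h := stable_gauss ν hν (fun y => F (fun i => a • P i x + Q i y)) (by fun_prop) b s
    simp only [map_smul, map_add] at h
    rw [← h, integral_prod]
    · simp only [add_assoc]
    · exact Integrable.of_bound (Continuous.aestronglyMeasurable (by fun_prop)) 1 (Filter.Eventually.of_forall fun x => hFb _)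
  have step : ∀ a b s, 0 ≤ s → J a (√(b ^ 2 + s ^ 2)) ≤ J (√(a ^ 2 + s ^ 2)) b + K * s ^ 3 := by
    intro a b s hs
    rw [JP, JQ]
    have c1 : Continuous fun p : (X × Y) × X => F (fun i => (a • P i p.1.1 + b • Q i p.1.2) + s • P i p.2) := by fun_prop
    have c2 : Continuous fun p : (X × Y) × Y => F (fun i => (a • P i p.1.1 + b • Q i p.1.2) + s • Q i p.2) := by fun_prop
    have i1 : Integrable (fun p : X × Y => ∫ x', F (fun i => (a • P i p.1 + b • Q i p.2) + s • P i x') ∂μ) (μ.prod ν) := by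
      refine Integrable.of_bound ?_ 1 (Filter.Eventually.of_forall fun x => ?_)
      · exact (c1.stronglyMeasurable.integral_prod_right' (ν := μ)).aestronglyMeasurable
      · refine (norm_integral_le_of_norm_le_const (Filter.Eventually.of_forall fun x => hFb _)).trans ?_
        simp
    have i2 : Integrable (fun p : X × Y => ∫ x', F (fun i => (a • P i p.1 + b • Q i p.2) + s • Q i x') ∂ν) (μ.prod ν) := by
      refine Integrable.of_bound ?_ 1 (Filter.Eventually.of_forall fun x => ?_)
      · exact (c2.stronglyMeasurable.integral_prod_right' (ν := ν)).aestronglyMeasurable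
      · refine (norm_integral_le_of_norm_le_const (Filter.Eventually.of_forall fun x => hFb _)).trans ?_
        simp
    rw [← integral_prod (f := fun p : X × Y => ∫ x', F (fun i => (a • P i p.1 + b • Q i p.2) + s • P i x') ∂μ) i1,
      ← integral_prod (f := fun p : X × Y => ∫ x', F (fun i => (a • P i p.1 + b • Q i p.2) + s • Q i x') ∂ν) i2]
    have : K * s ^ 3 = ∫ p : X × Y, K * s ^ 3 ∂(μ.prod ν) := by simp
    rw [this, ← integral_add i1 (integrable_const _)]
    refine integral_mono i2 (i1.add (integrable_const _)) fun p => ?_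
    exact hK _ s hs
  have J0 : J 1 0 = ∫ x, ∏ i, φ (P i x) ∂μ := by simp [J, F]
  have J1 : J 0 1 = ∫ y, ∏ i, φ (Q i y) ∂ν := by simp [J, F]
  rw [← J0, ← J1]
  have main : ∀ M : ℕ, 0 < M → J 0 1 ≤ J 1 0 + K * √(1 / (M : ℝ)) := by
    intro M hM
    have hM' : (0 : ℝ) < M := by exact_mod_cast hM
    have ind : ∀ k : ℕ, k ≤ M → J (√(((M - k : ℕ) : ℝ) / M)) (√((k : ℝ) / M)) ≤ J 1 0 + k * (K * √(1 / (M : ℝ)) ^ 3) := by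
      intro k
      induction k with
      | zero => intro _; simp [hM'.ne']
      | succ k ih =>
        intro hk
        have ih' := ih (by omega)
        have st := step (√(((M - (k + 1) : ℕ) : ℝ) / M)) (√((k : ℝ) / M)) (√(1 / (M : ℝ))) (Real.sqrt_nonneg _)
        rw [Real.sq_sqrt (by positivity), Real.sq_sqrt (by positivity), Real.sq_sqrt (by positivity), ← add_div, ← add_div] at st
        have e : (((M - (k + 1) : ℕ) : ℝ) + 1) = ((M - k : ℕ) : ℝ) := by
          rw [← Nat.cast_add_one]; congr 1; omega
        rw [e] at st
        push_cast
        linarith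
    have := ind M le_rfl
    simp only [Nat.sub_self, Nat.cast_zero, zero_div, Real.sqrt_zero, div_self hM'.ne', Real.sqrt_one] at this
    have e : (M : ℝ) * (K * √(1 / (M : ℝ)) ^ 3) = K * √(1 / (M : ℝ)) := by
      have : √(1 / (M : ℝ)) ^ 2 = 1 / M := Real.sq_sqrt (by positivity)
      rw [pow_succ, this]; field_simp
    rwa [e] at this
  have lim : Filter.Tendsto (fun M : ℕ => J 1 0 + K * √(1 / (M : ℝ))) Filter.atTop (nhds (J 1 0 + K * √0)) := by
    refine Filter.Tendsto.const_add _ (Filter.Tendsto.const_mul _ ?_)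
    exact (Real.continuous_sqrt.tendsto 0).comp tendsto_one_div_atTop_nhds_zero_nat
  simp only [Real.sqrt_zero, mul_zero, add_zero] at lim
  exact ge_of_tendsto lim (Filter.eventually_atTop.mpr ⟨1, fun M hM => main M hM⟩)

end compare

lemma picov {ι Z : Type*} [Fintype ι] [MeasurableSpace Z] (ρ : Measure Z) [IsProbabilityMeasure ρ]
    (f f' : ι → Z → ℝ) (hf : ∀ i, MemLp (f i) 2 ρ) (hf' : ∀ i, MemLp (f' i) 2 ρ)
    (h0 : ∀ i, ∫ x, f i x ∂ρ = 0) :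
    ∫ x : ι → Z, (∑ i, f i (x i)) * (∑ i, f' i (x i)) ∂(Measure.pi fun _ => ρ)
      = ∑ i, ∫ x, f i x * f' i x ∂ρ := by
  classical
  have mp := fun i => measurePreserving_eval (fun _ : ι => ρ) i
  have hF : ∀ i, MemLp (fun x : ι → Z => f i (x i)) 2 (Measure.pi fun _ => ρ) := fun i =>
    (hf i).comp_measurePreserving (mp i)
  have hF' : ∀ i, MemLp (fun x : ι → Z => f' i (x i)) 2 (Measure.pi fun _ => ρ) := fun i =>
    (hf' i).comp_measurePreserving (mp i)
  have hI : ∀ i j, Integrable (fun x : ι → Z => f i (x i) * f' j (x j)) (Measure.pi fun _ => ρ) :=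
    fun i j => (hF i).integrable_mul (hF' j)
  simp_rw [Finset.sum_mul_sum]
  rw [integral_finset_sum _ (fun i _ => integrable_finset_sum _ fun j _ => hI i j)]
  refine Finset.sum_congr rfl fun i _ => ?_
  rw [integral_finset_sum _ (fun j _ => hI i j)]
  rw [Finset.sum_eq_single i]
  · conv_rhs => rw [← (mp i).map_eq]
    rw [integral_map (mp i).measurable.aemeasurable]
    rw [(mp i).map_eq]
    exact (hf i).1.mul (hf' i).1
  · intro j _ hj
    have hind : IndepFun (fun x : ι → Z => f i (x i)) (fun x : ι → Z => f' j (x j)) (Measure.pi fun _ => ρ) := by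
      have h := iIndepFun_pi (μ := fun _ : ι => ρ) (X := fun _ x => x) (fun i => aemeasurable_id)
      have h2 := h.indepFun (Ne.symm hj)
      exact h2.comp₀ (mp i).measurable.aemeasurable (mp j).measurable.aemeasurable
        (by rw [show (fun ω : ι → Z => ω i) = Function.eval i from rfl, (mp i).map_eq]; exact (hf i).1.aemeasurable)
        (by rw [show (fun ω : ι → Z => ω j) = Function.eval j from rfl, (mp j).map_eq]; exact (hf' j).1.aemeasurable)
    have := hind.integral_mul_eq_mul_integral (hF i).1 (hF' j).1
    simp only [Pi.mul_apply] at this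
    rw [this]
    have z : ∫ x : ι → Z, f i (x i) ∂(Measure.pi fun _ => ρ) = 0 := by
      rw [← h0 i]
      conv_rhs => rw [← (mp i).map_eq]
      rw [integral_map (mp i).measurable.aemeasurable]
      rw [(mp i).map_eq]; exact (hf i).1
    rw [z, zero_mul]
  · simp

lemma prodcov {Z W : Type*} [MeasurableSpace Z] [MeasurableSpace W] (ρ : Measure Z) [IsProbabilityMeasure ρ]
    (σ : Measure W) [IsProbabilityMeasure σ]
    (f f' : Z → ℝ) (g g' : W → ℝ) (hf : MemLp f 2 ρ) (hf' : MemLp f' 2 ρ) (hg : MemLp g 2 σ) (hg' : MemLp g' 2 σ)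
    (h0 : ∫ x, f x ∂ρ = 0) (h1 : ∫ x, g x ∂σ = 0) :
    ∫ p : Z × W, (f p.1 + g p.2) * (f' p.1 + g' p.2) ∂(ρ.prod σ)
      = ∫ x, f x * f' x ∂ρ + ∫ x, g x * g' x ∂σ := by
  have If := hf.integrable (by norm_num)
  have If' := hf'.integrable (by norm_num)
  have Ig := hg.integrable (by norm_num)
  have Ig' := hg'.integrable (by norm_num)
  have Iff := (hf.integrable_mul hf').comp_fst σ
  have Igg := (hg.integrable_mul hg').comp_snd ρ
  have Ifg := If.mul_prod Ig'
  have Igf := If'.mul_prod Ig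
  have e : ∀ p : Z × W, (f p.1 + g p.2) * (f' p.1 + g' p.2) =
     ((f * f') p.1 + (g * g') p.2) + (f p.1 * g' p.2 + f' p.1 * g p.2) := by
    intro p; simp only [Pi.mul_apply]; ring
  simp_rw [e]
  have E1 := integral_prod_mul (μ := ρ) (ν := σ) f g'
  have E2 := integral_prod_mul (μ := ρ) (ν := σ) f' g
  have I12 : Integrable (fun p : Z × W => (f * f') p.1 + (g * g') p.2) (ρ.prod σ) := Iff.add Igg
  have I34 : Integrable (fun p : Z × W => f p.1 * g' p.2 + f' p.1 * g p.2) (ρ.prod σ) := Ifg.add Igf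
  rw [integral_add I12 I34, integral_add Iff Igg, integral_add Ifg Igf, E1, E2, h0, h1,
    integral_fun_fst (μ := ρ) (ν := σ) (f * f'), integral_fun_snd (μ := ρ) (ν := σ) (g * g')]
  simp

lemma centered_pi {ι : Type*} [Fintype ι] {E : Type*} [NormedAddCommGroup E] [NormedSpace ℝ E]
    [MeasurableSpace E] [BorelSpace E] [SecondCountableTopology E] [CompleteSpace E]
    (μ : Measure E) [IsGaussian μ] (h : ∀ L : StrongDual ℝ E, ∫ x, L x ∂μ = 0)
    (L : StrongDual ℝ (ι → E)) : ∫ x, L x ∂(Measure.pi fun _ : ι => μ) = 0 := by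
  classical
  have mp := fun i => measurePreserving_eval (fun _ : ι => μ) i
  have e : ∀ x, L x = ∑ i, (L ∘L (ContinuousLinearMap.single ℝ (fun _ => E) i)) (x i) := by
    intro x
    conv_lhs => rw [← Finset.univ_sum_single x]
    rw [map_sum]; rfl
  simp_rw [e]
  rw [integral_finset_sum]
  · refine Finset.sum_eq_zero fun i _ => ?_
    rw [← h (L ∘L (ContinuousLinearMap.single ℝ (fun _ => E) i))]
    conv_rhs => rw [← (mp i).map_eq]
    rw [integral_map (mp i).measurable.aemeasurable (by fun_prop)]
  · intro i _
    exact (mp i).integrable_comp_of_integrable (IsGaussian.integrable_dual μ _)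

lemma centered_prod {E F : Type*} [NormedAddCommGroup E] [NormedSpace ℝ E]
    [MeasurableSpace E] [BorelSpace E] [NormedAddCommGroup F] [NormedSpace ℝ F]
    [MeasurableSpace F] [BorelSpace F]
    (μ : Measure E) [IsGaussian μ] (h : ∀ L : StrongDual ℝ E, ∫ x, L x ∂μ = 0)
    (ν : Measure F) [IsGaussian ν] (h' : ∀ L : StrongDual ℝ F, ∫ x, L x ∂ν = 0)
    (L : StrongDual ℝ (E × F)) : ∫ x, L x ∂(μ.prod ν) = 0 := by
  have e : ∀ x : E × F, L x = (L ∘L ContinuousLinearMap.inl ℝ E F) x.1 + (L ∘L ContinuousLinearMap.inr ℝ E F) x.2 := by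
    intro x
    simp [← map_add]
  simp_rw [e]
  rw [integral_add ((IsGaussian.integrable_dual μ _).comp_fst ν) ((IsGaussian.integrable_dual ν _).comp_snd μ),
    integral_fun_fst (fun x => (L ∘L ContinuousLinearMap.inl ℝ E F) x),
    integral_fun_snd (fun x => (L ∘L ContinuousLinearMap.inr ℝ E F) x), h, h']
  simp

lemma centered_gaussianReal (L : StrongDual ℝ ℝ) : ∫ x, L x ∂(gaussianReal 0 1) = 0 := by
  rw [integral_continuousLinearMap_gaussianReal]; simp

/-- standard Gaussian on ℝ^n -/
noncomputable def gstd (n : ℕ) : Measure (Fin n → ℝ) := Measure.pi fun _ => gaussianReal 0 1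

instance (n : ℕ) : IsGaussian (gstd n) := isGaussian_pi' _
instance (m n : ℕ) : IsGaussian (matrixGaussian m n) := isGaussian_pi' (gstd n)

lemma centered_gstd (n : ℕ) (L : StrongDual ℝ (Fin n → ℝ)) : ∫ x, L x ∂(gstd n) = 0 :=
  centered_pi _ centered_gaussianReal L

lemma centered_matrixGaussian (m n : ℕ) (L : StrongDual ℝ (Fin m → Fin n → ℝ)) : ∫ x, L x ∂(matrixGaussian m n) = 0 :=
  centered_pi (gstd n) (centered_gstd n) L

lemma memLp_lin {n : ℕ} (c : Fin n → ℝ) : MemLp (fun x : Fin n → ℝ => ∑ i, c i * x i) 2 (gstd n) := by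
  refine memLp_finset_sum _ fun i _ => ?_
  exact ((memLp_id_gaussianReal' (μ := 0) (v := 1) 2 (by simp)).const_mul (c i)).comp_measurePreserving
    (measurePreserving_eval (fun _ : Fin n => gaussianReal 0 1) i)

lemma int_lin {n : ℕ} (c : Fin n → ℝ) : ∫ x : Fin n → ℝ, ∑ i, c i * x i ∂(gstd n) = 0 := by
  have := centered_gstd n (∑ i, c i • ContinuousLinearMap.proj i)
  simpa using this

lemma cov_lin {n : ℕ} (c d : Fin n → ℝ) :
    ∫ x : Fin n → ℝ, (∑ i, c i * x i) * (∑ i, d i * x i) ∂(gstd n) = ∑ i, c i * d i := by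
  have hm : ∀ c : ℝ, MemLp (fun x : ℝ => c * x) 2 (gaussianReal 0 1) := fun c =>
    (memLp_id_gaussianReal' (μ := 0) (v := 1) 2 (by simp)).const_mul c
  have := picov (gaussianReal 0 1) (fun i x => c i * x) (fun i x => d i * x) (fun i => hm _) (fun i => hm _)
    (fun i => by rw [integral_const_mul]; simp)
  refine this.trans (Finset.sum_congr rfl fun i _ => ?_)
  have v : ∫ x, x ^ 2 ∂(gaussianReal 0 1) = 1 := by
    have h := variance_fun_id_gaussianReal (μ := 0) (v := 1)
    rw [variance_of_integral_eq_zero (by fun_prop) (by simp)] at h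
    simpa using h
  have e : ∀ x : ℝ, c i * x * (d i * x) = c i * d i * x ^ 2 := fun x => by ring
  simp_rw [e]
  rw [integral_const_mul, v, mul_one]

lemma memLp_mat {m n : ℕ} (c : Fin m → ℝ) (w : Fin n → ℝ) :
    MemLp (fun A : Fin m → Fin n → ℝ => ∑ a, c a * ∑ i, w i * A a i) 2 (matrixGaussian m n) := by
  refine memLp_finset_sum _ fun a _ => ?_
  exact ((memLp_lin w).const_mul (c a)).comp_measurePreserving
    (measurePreserving_eval (fun _ : Fin m => gstd n) a)

lemma cov_mat {m n : ℕ} (c d : Fin m → ℝ) (w w' : Fin n → ℝ) :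
    ∫ A : Fin m → Fin n → ℝ, (∑ a, c a * ∑ i, w i * A a i) * (∑ a, d a * ∑ i, w' i * A a i) ∂(matrixGaussian m n)
      = (∑ a, c a * d a) * ∑ i, w i * w' i := by
  have := picov (gstd n) (fun a x => c a * ∑ i, w i * x i) (fun a x => d a * ∑ i, w' i * x i)
    (fun i => (memLp_lin w).const_mul _) (fun i => (memLp_lin w').const_mul _)
    (fun i => by rw [integral_const_mul, int_lin, mul_zero])
  refine this.trans ?_
  rw [Finset.sum_mul]
  refine Finset.sum_congr rfl fun i _ => ?_
  have e : ∀ x : Fin n → ℝ, c i * (∑ j, w j * x j) * (d i * ∑ j, w' j * x j) =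
    c i * d i * ((∑ j, w j * x j) * ∑ j, w' j * x j) := fun x => by ring
  simp_rw [e]
  rw [integral_const_mul, cov_lin]

lemma int_mat {m n : ℕ} (c : Fin m → ℝ) (w : Fin n → ℝ) :
    ∫ A : Fin m → Fin n → ℝ, (∑ a, c a * ∑ i, w i * A a i) ∂(matrixGaussian m n) = 0 := by
  have := centered_matrixGaussian m n (∑ a, c a • ∑ i, w i •
    ((ContinuousLinearMap.proj i : (Fin n → ℝ) →L[ℝ] ℝ) ∘L (ContinuousLinearMap.proj a : (Fin m → Fin n → ℝ) →L[ℝ] (Fin n → ℝ))))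
  simpa using this

lemma psi_bounds : ∃ C : ℝ, 0 ≤ C ∧ ∃ D : ℝ → ℝ, (∀ p, 0 ≤ D p) ∧ (∀ p, D p ≤ C) ∧
    (∀ p d, |Real.smoothTransition (p + d) - Real.smoothTransition p| ≤ C * |d|) ∧
    (∀ p d, |Real.smoothTransition (p + d) - Real.smoothTransition p - D p * d| ≤ C * |d| ^ 2) := by
  let ψ := Real.smoothTransition
  have hs : ContDiff ℝ 2 ψ := Real.smoothTransition.contDiff
  have hd : Differentiable ℝ ψ := hs.differentiable (by norm_num)
  have hs1 : ContDiff ℝ 1 (deriv ψ) := hs.deriv' (n := 1)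
  have hd1 : Differentiable ℝ (deriv ψ) := hs1.differentiable (by norm_num)
  have hcs : HasCompactSupport (deriv ψ) := by
    refine HasCompactSupport.intro (isCompact_Icc (a := (0 : ℝ)) (b := 1)) ?_
    intro x hx
    rw [Set.mem_Icc, not_and_or, not_le, not_le] at hx
    rcases hx with hx | hx
    · have : ψ =ᶠ[nhds x] fun _ => 0 := by
        filter_upwards [Iio_mem_nhds hx] with y hy
        exact Real.smoothTransition.zero_of_nonpos (le_of_lt hy)
      rw [this.deriv_eq]; simp
    · have : ψ =ᶠ[nhds x] fun _ => 1 := by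
        filter_upwards [Ioi_mem_nhds hx] with y hy
        exact Real.smoothTransition.one_of_one_le (le_of_lt hy)
      rw [this.deriv_eq]; simp
  obtain ⟨C1, hC1⟩ := hcs.exists_bound_of_continuous hs1.continuous
  obtain ⟨C2, hC2⟩ := hcs.deriv.exists_bound_of_continuous (hs1.continuous_deriv le_rfl)
  have h1 : 0 ≤ C1 := (norm_nonneg _).trans (hC1 0)
  have h2 : 0 ≤ C2 := (norm_nonneg _).trans (hC2 0)
  have lipD : ∀ x y, |deriv ψ y - deriv ψ x| ≤ C2 * |y - x| := fun x y => by
    have := Convex.norm_image_sub_le_of_norm_deriv_le (s := Set.univ) (f := deriv ψ) (C := C2) (fun x _ => hd1 x)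
      (fun x _ => hC2 x) convex_univ (Set.mem_univ x) (Set.mem_univ y)
    simpa using this
  refine ⟨C1 + C2, by positivity, deriv ψ, fun p => Real.smoothTransition.monotone.deriv_nonneg, ?_, ?_, ?_⟩
  · intro p; have := hC1 p; rw [Real.norm_eq_abs] at this; linarith [le_abs_self (deriv ψ p)]
  · intro p d
    have := Convex.norm_image_sub_le_of_norm_deriv_le (s := Set.univ) (f := ψ) (C := C1) (fun x _ => hd x)
      (fun x _ => hC1 x) convex_univ (Set.mem_univ p) (Set.mem_univ (p + d))
    simp only [Real.norm_eq_abs, add_sub_cancel_left] at this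
    refine this.trans ?_
    gcongr; linarith
  · intro p d
    have hder : ∀ x, HasDerivAt (fun x => ψ x - deriv ψ p * x) (deriv ψ x - deriv ψ p) x := fun x => by
      have := (hd x).hasDerivAt.sub ((hasDerivAt_id x).const_mul (deriv ψ p))
      simp only [mul_one] at this
      exact this
    have := Convex.norm_image_sub_le_of_norm_deriv_le (s := Set.uIcc p (p + d)) (f := fun x => ψ x - deriv ψ p * x) (C := C2 * |d|)
      (fun x _ => (hder x).differentiableAt)
      (fun x hx => by
        rw [(hder x).deriv, Real.norm_eq_abs]
        refine (lipD p x).trans ?_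
        have := Set.abs_sub_left_of_mem_uIcc hx
        rw [add_sub_cancel_left] at this
        exact mul_le_mul_of_nonneg_left this h2) (convex_uIcc p (p + d)) Set.left_mem_uIcc Set.right_mem_uIcc
    simp only [Real.norm_eq_abs, add_sub_cancel_left] at this
    have e : ψ (p + d) - deriv ψ p * (p + d) - (ψ p - deriv ψ p * p) = ψ (p + d) - ψ p - deriv ψ p * d := by ring
    rw [e] at this
    refine this.trans ?_
    nlinarith [mul_nonneg h1 (sq_nonneg |d|)]

section rho
variable {F : Type*} [NormedAddCommGroup F] [InnerProductSpace ℝ F]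

lemma rho_sq (u : F) : √(1 + ‖u‖ ^ 2) ^ 2 = 1 + ‖u‖ ^ 2 := Real.sq_sqrt (by positivity)
lemma rho_one (u : F) : 1 ≤ √(1 + ‖u‖ ^ 2) := by
  rw [Real.one_le_sqrt]; nlinarith [sq_nonneg ‖u‖]
lemma rho_norm (u : F) : ‖u‖ ≤ √(1 + ‖u‖ ^ 2) := by
  apply Real.le_sqrt_of_sq_le; linarith
lemma rho_add (u v : F) : √(1 + ‖u + v‖ ^ 2) ≤ √(1 + ‖u‖ ^ 2) + ‖v‖ := by
  have h1 := rho_one u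
  apply Real.sqrt_le_iff.2 ⟨by positivity, ?_⟩
  have h := norm_add_le u v
  have h3 := rho_norm u
  have h2 := rho_sq u
  nlinarith [norm_nonneg v, norm_nonneg u, norm_nonneg (u + v)]
lemma rho_lip (u v : F) : |√(1 + ‖u + v‖ ^ 2) - √(1 + ‖u‖ ^ 2)| ≤ ‖v‖ := by
  rw [abs_le]
  have h1 := rho_add u v
  have h2 := rho_add (u + v) (-v)
  simp only [add_neg_cancel_right, norm_neg] at h2
  constructor <;> linarith
lemma rho_rem (u v : F) : |√(1 + ‖u + v‖ ^ 2) - √(1 + ‖u‖ ^ 2) - inner ℝ u v / √(1 + ‖u‖ ^ 2)| ≤ ‖v‖ ^ 2 := by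
  have ha := rho_sq (u + v)
  have hb := rho_sq u
  have h1 := rho_one u
  have hl := rho_lip u v
  have hn := norm_add_sq_real u v
  set a := √(1 + ‖u + v‖ ^ 2)
  set b := √(1 + ‖u‖ ^ 2)
  have e : a - b - inner ℝ u v / b = (‖v‖ ^ 2 - (a - b) ^ 2) / (2 * b) := by
    have hb0 : b ≠ 0 := by positivity
    field_simp
    nlinarith
  have hq : (a - b) ^ 2 ≤ ‖v‖ ^ 2 := sq_le_sq' (by linarith [(abs_le.1 hl).1]) (abs_le.1 hl).2
  rw [e, abs_of_nonneg (div_nonneg (by linarith) (by linarith)), div_le_iff₀ (by linarith)]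
  nlinarith [sq_nonneg (a - b), sq_nonneg ‖v‖]
lemma rho_inner (u v : F) : |inner ℝ u v / √(1 + ‖u‖ ^ 2)| ≤ ‖v‖ := by
  have h1 := rho_one u
  rw [abs_div, abs_of_nonneg (Real.sqrt_nonneg _), div_le_iff₀ (by linarith)]
  refine (abs_real_inner_le_norm u v).trans ?_
  rw [mul_comm]
  gcongr
  exact rho_norm u
end rho

/-- linear functional on E -/
noncomputable def Lfun {m : ℕ} (D : ℝ → ℝ) (z : EuclideanSpace ℝ (Fin m) × ℝ) :
    (EuclideanSpace ℝ (Fin m) × ℝ) →L[ℝ] ℝ :=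
  D (√(1 + ‖z.1‖ ^ 2) + z.2) • ((√(1 + ‖z.1‖ ^ 2))⁻¹ • (innerSL ℝ z.1 ∘L ContinuousLinearMap.fst ℝ _ _)
    + ContinuousLinearMap.snd ℝ _ _)

lemma Lfun_apply {m : ℕ} (D : ℝ → ℝ) (z v : EuclideanSpace ℝ (Fin m) × ℝ) :
    Lfun D z v = D (√(1 + ‖z.1‖ ^ 2) + z.2) * (inner ℝ z.1 v.1 / √(1 + ‖z.1‖ ^ 2) + v.2) := by
  simp only [Lfun, ContinuousLinearMap.smul_apply, ContinuousLinearMap.add_apply, ContinuousLinearMap.comp_apply,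
    innerSL_apply_apply, ContinuousLinearMap.coe_fst', ContinuousLinearMap.coe_snd', smul_eq_mul]
  ring

/-- the cut-off function -/
noncomputable def phi {m : ℕ} (z : EuclideanSpace ℝ (Fin m) × ℝ) : ℝ :=
  Real.smoothTransition (√(1 + ‖z.1‖ ^ 2) + z.2)

lemma phi_bounds (m : ℕ) : ∃ C : ℝ, 0 ≤ C ∧ ∃ D : ℝ → ℝ, (∀ p, 0 ≤ D p) ∧
    (∀ z v : EuclideanSpace ℝ (Fin m) × ℝ, |phi (z + v) - phi z| ≤ C * ‖v‖) ∧
    (∀ z v : EuclideanSpace ℝ (Fin m) × ℝ, |Lfun D z v| ≤ C * ‖v‖) ∧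
    (∀ z v : EuclideanSpace ℝ (Fin m) × ℝ, |phi (z + v) - phi z - Lfun D z v| ≤ C * ‖v‖ ^ 2) := by
  obtain ⟨C, hC, D, hD0, hD1, hlip, hrem⟩ := psi_bounds
  refine ⟨5 * C, by positivity, D, hD0, ?_, ?_, ?_⟩
  all_goals
    intro z v
    have hv1 : ‖v.1‖ ≤ ‖v‖ := norm_fst_le v
    have hv2 : |v.2| ≤ ‖v‖ := norm_snd_le v
    have hN := norm_nonneg v
    have r1 := rho_lip z.1 v.1
    have r2 := rho_rem z.1 v.1
    have r3 := rho_inner z.1 v.1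
    have r0 := norm_nonneg v.1
    set b := √(1 + ‖z.1‖ ^ 2) with hb
    set a := √(1 + ‖z.1 + v.1‖ ^ 2) with ha
    set p := b + z.2 with hp
    have ephi : phi (z + v) = Real.smoothTransition (p + (a - b + v.2)) := by
      simp only [phi, Prod.fst_add, Prod.snd_add]
      rw [← ha, hp]; congr 1; ring
    have ephi0 : phi z = Real.smoothTransition p := rfl
    have hΔ : |a - b + v.2| ≤ 2 * ‖v‖ := (abs_add_le _ _).trans (by linarith)
  · rw [ephi, ephi0]
    refine (hlip _ _).trans ?_
    nlinarith
  · rw [Lfun_apply, ← hb, ← hp, abs_mul, abs_of_nonneg (hD0 p)]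
    have : |inner ℝ z.1 v.1 / b + v.2| ≤ 2 * ‖v‖ := (abs_add_le _ _).trans (by linarith)
    have h3 := mul_le_mul (hD1 p) this (abs_nonneg _) hC
    nlinarith
  · rw [ephi, ephi0, Lfun_apply, ← hb, ← hp]
    have e : Real.smoothTransition (p + (a - b + v.2)) - Real.smoothTransition p - D p * (inner ℝ z.1 v.1 / b + v.2)
      = (Real.smoothTransition (p + (a - b + v.2)) - Real.smoothTransition p - D p * (a - b + v.2))
       + D p * (a - b - inner ℝ z.1 v.1 / b) := by ring
    rw [e]
    refine (abs_add_le _ _).trans ?_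
    have h1 := hrem p (a - b + v.2)
    have h2 : |a - b + v.2| ^ 2 ≤ (2 * ‖v‖) ^ 2 := by gcongr
    have h3 : |D p * (a - b - inner ℝ z.1 v.1 / b)| ≤ C * ‖v.1‖ ^ 2 := by
      rw [abs_mul, abs_of_nonneg (hD0 p)]
      exact mul_le_mul (hD1 p) r2 (abs_nonneg _) hC
    have h4 : ‖v.1‖ ^ 2 ≤ ‖v‖ ^ 2 := by gcongr
    nlinarith [mul_le_mul_of_nonneg_left h2 hC, mul_le_mul_of_nonneg_left h4 hC]

lemma phi_cont (m : ℕ) : Continuous (phi (m := m)) := by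
  have := Real.smoothTransition.continuous
  unfold phi; fun_prop

/-- the matrix process -/
noncomputable def Pm {m n : ℕ} (w : Fin n → ℝ) :
    ((Fin m → Fin n → ℝ) × ℝ) →L[ℝ] (EuclideanSpace ℝ (Fin m) × ℝ) :=
  LinearMap.toContinuousLinearMap
    { toFun := fun p => (WithLp.toLp 2 (fun a => ∑ i, w i * p.1 a i), p.2)
      map_add' := fun p q => by
        ext
        · simp [mul_add, Finset.sum_add_distrib]
        · simp
      map_smul' := fun c p => by
        ext
        · simp only [Prod.smul_fst, Pi.smul_apply, smul_eq_mul, PiLp.smul_apply, RingHom.id_apply, Finset.mul_sum]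
          exact Finset.sum_congr rfl fun i _ => by ring
        · simp }

/-- the vector process -/
noncomputable def Qm {m n : ℕ} (w : Fin n → ℝ) :
    ((Fin m → ℝ) × (Fin n → ℝ)) →L[ℝ] (EuclideanSpace ℝ (Fin m) × ℝ) :=
  LinearMap.toContinuousLinearMap
    { toFun := fun p => (WithLp.toLp 2 p.1, ∑ i, w i * p.2 i)
      map_add' := fun p q => by
        ext
        · simp
        · simp [mul_add, Finset.sum_add_distrib]
      map_smul' := fun c p => by
        ext
        · simp
        · simp only [Prod.smul_snd, Pi.smul_apply, smul_eq_mul, RingHom.id_apply, Finset.mul_sum]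
          exact Finset.sum_congr rfl fun i _ => by ring }

lemma Pm_apply {m n : ℕ} (w : Fin n → ℝ) (p : (Fin m → Fin n → ℝ) × ℝ) :
    Pm w p = (WithLp.toLp 2 (fun a => ∑ i, w i * p.1 a i), p.2) := rfl
lemma Qm_apply {m n : ℕ} (w : Fin n → ℝ) (p : (Fin m → ℝ) × (Fin n → ℝ)) :
    Qm w p = (WithLp.toLp 2 p.1, ∑ i, w i * p.2 i) := rfl

lemma L_form {m : ℕ} (L : (EuclideanSpace ℝ (Fin m) × ℝ) →L[ℝ] ℝ) (z : EuclideanSpace ℝ (Fin m) × ℝ) :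
    L z = ∑ a, L (EuclideanSpace.single a 1, 0) * z.1 a + L (0, 1) * z.2 := by
  have h1 : z = (∑ a, z.1 a • ((EuclideanSpace.single a 1, 0) : EuclideanSpace ℝ (Fin m) × ℝ)) + z.2 • (0, 1) := by
    ext a
    · simp [Prod.fst_sum, EuclideanSpace.single, Pi.single_apply]
    · simp [Prod.snd_sum]
  conv_lhs => rw [h1]
  simp only [map_add, map_sum, map_smul, smul_eq_mul]
  congr 1
  · exact Finset.sum_congr rfl fun i _ => by ring
  · ring

lemma cov_P {m n : ℕ} (c c' : Fin m → ℝ) (b b' : ℝ) (w w' : Fin n → ℝ) :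
    ∫ p : (Fin m → Fin n → ℝ) × ℝ, ((∑ a, c a * ∑ i, w i * p.1 a i) + b * p.2) *
      ((∑ a, c' a * ∑ i, w' i * p.1 a i) + b' * p.2) ∂((matrixGaussian m n).prod (gaussianReal 0 1))
      = (∑ a, c a * c' a) * (∑ i, w i * w' i) + b * b' := by
  have hm : ∀ c : ℝ, MemLp (fun x : ℝ => c * x) 2 (gaussianReal 0 1) := fun c =>
    (memLp_id_gaussianReal' (μ := 0) (v := 1) 2 (by simp)).const_mul c
  rw [prodcov (matrixGaussian m n) (gaussianReal 0 1) (fun A => ∑ a, c a * ∑ i, w i * A a i)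
    (fun A => ∑ a, c' a * ∑ i, w' i * A a i) (fun x => b * x) (fun x => b' * x) (memLp_mat _ _) (memLp_mat _ _)
    (hm _) (hm _) (int_mat _ _) (by rw [integral_const_mul]; simp), cov_mat]
  congr 1
  have v : ∫ x, x ^ 2 ∂(gaussianReal 0 1) = 1 := by
    have h := variance_fun_id_gaussianReal (μ := 0) (v := 1)
    rw [variance_of_integral_eq_zero (by fun_prop) (by simp)] at h
    simpa using h
  have e : ∀ x : ℝ, b * x * (b' * x) = b * b' * x ^ 2 := fun x => by ring
  simp_rw [e]
  rw [integral_const_mul, v, mul_one]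

lemma cov_Q {m n : ℕ} (c c' : Fin m → ℝ) (b b' : ℝ) (w w' : Fin n → ℝ) :
    ∫ p : (Fin m → ℝ) × (Fin n → ℝ), ((∑ a, c a * p.1 a) + b * ∑ i, w i * p.2 i) *
      ((∑ a, c' a * p.1 a) + b' * ∑ i, w' i * p.2 i) ∂((gstd m).prod (gstd n))
      = (∑ a, c a * c' a) + b * b' * (∑ i, w i * w' i) := by
  rw [prodcov (gstd m) (gstd n) (fun x => ∑ a, c a * x a) (fun x => ∑ a, c' a * x a)
    (fun x => b * ∑ i, w i * x i) (fun x => b' * ∑ i, w' i * x i) (memLp_lin _) (memLp_lin _)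
    ((memLp_lin _).const_mul _) ((memLp_lin _).const_mul _) (int_lin _) (by rw [integral_const_mul, int_lin, mul_zero]), cov_lin]
  congr 1
  have e : ∀ x : Fin n → ℝ, b * (∑ i, w i * x i) * (b' * ∑ i, w' i * x i) = b * b' * ((∑ i, w i * x i) * ∑ i, w' i * x i) :=
    fun x => by ring
  simp_rw [e]
  rw [integral_const_mul, cov_lin]

lemma cov_LP {m n : ℕ} (L L' : (EuclideanSpace ℝ (Fin m) × ℝ) →L[ℝ] ℝ) (w w' : Fin n → ℝ) :
    ∫ p, L (Pm w p) * L' (Pm w' p) ∂((matrixGaussian m n).prod (gaussianReal 0 1))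
      = (∑ a, L (EuclideanSpace.single a 1, 0) * L' (EuclideanSpace.single a 1, 0)) * (∑ i, w i * w' i)
        + L (0, 1) * L' (0, 1) := by
  rw [← cov_P]
  refine integral_congr_ae (Filter.Eventually.of_forall fun p => ?_)
  have h1 := L_form L (Pm w p)
  have h2 := L_form L' (Pm w' p)
  simp only [h1, h2]
  rfl

lemma cov_LQ {m n : ℕ} (L L' : (EuclideanSpace ℝ (Fin m) × ℝ) →L[ℝ] ℝ) (w w' : Fin n → ℝ) :
    ∫ p, L (Qm w p) * L' (Qm w' p) ∂((gstd m).prod (gstd n))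
      = (∑ a, L (EuclideanSpace.single a 1, 0) * L' (EuclideanSpace.single a 1, 0))
        + L (0, 1) * L' (0, 1) * (∑ i, w i * w' i) := by
  rw [← cov_Q]
  refine integral_congr_ae (Filter.Eventually.of_forall fun p => ?_)
  have h1 := L_form L (Qm w p)
  have h2 := L_form L' (Qm w' p)
  simp only [h1, h2]
  rfl

lemma gordon_concrete {I : Type} [Fintype I] {m n : ℕ} (w : I → Fin n → ℝ) (hw : ∀ i, ∑ j, w i j * w i j = 1) :
    ∫ y, ∏ i, phi (Qm (m := m) (w i) y) ∂((gstd m).prod (gstd n)) ≤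
      ∫ x, ∏ i, phi (Pm (w i) x) ∂((matrixGaussian m n).prod (gaussianReal 0 1)) := by
  obtain ⟨C, hC, D, hD, hlip, hL, hrem⟩ := phi_bounds m
  refine gordon_abstract ((matrixGaussian m n).prod (gaussianReal 0 1)) ((gstd m).prod (gstd n))
    (centered_prod _ (centered_matrixGaussian m n) _ centered_gaussianReal)
    (centered_prod _ (centered_gstd m) _ (centered_gstd n))
    (fun i => Pm (w i)) (fun i => Qm (w i)) phi (Lfun D)
    (fun z => Real.smoothTransition.nonneg _) (fun z => Real.smoothTransition.le_one _) (phi_cont m) C hC hlip hL hrem ?_ ?_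
  · intro i L
    rw [cov_LP, cov_LQ, hw]; ring
  · intro i j z z'
    rw [cov_LP, cov_LQ]
    have hb : ∀ z : EuclideanSpace ℝ (Fin m) × ℝ, Lfun D z (0, 1) = D (√(1 + ‖z.1‖ ^ 2) + z.2) := fun z => by
      rw [Lfun_apply]; simp
    have hc : ∀ z : EuclideanSpace ℝ (Fin m) × ℝ, ∀ a, Lfun D z (EuclideanSpace.single a 1, 0)
      = D (√(1 + ‖z.1‖ ^ 2) + z.2) * (z.1 a / √(1 + ‖z.1‖ ^ 2)) := fun z a => by
      rw [Lfun_apply]; simp [EuclideanSpace.inner_single_right]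
    simp_rw [hb, hc]
    have e : ∑ a, D (√(1 + ‖z.1‖ ^ 2) + z.2) * (z.1 a / √(1 + ‖z.1‖ ^ 2)) * (D (√(1 + ‖z'.1‖ ^ 2) + z'.2) * (z'.1 a / √(1 + ‖z'.1‖ ^ 2)))
      = D (√(1 + ‖z.1‖ ^ 2) + z.2) * D (√(1 + ‖z'.1‖ ^ 2) + z'.2) * (inner ℝ z.1 z'.1 / √(1 + ‖z.1‖ ^ 2) / √(1 + ‖z'.1‖ ^ 2)) := by
      rw [PiLp.inner_apply, Finset.sum_div, Finset.sum_div, Finset.mul_sum]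
      refine Finset.sum_congr rfl fun a _ => ?_
      simp only [RCLike.inner_apply, conj_trivial]
      ring
    rw [e]
    have h1 := hD (√(1 + ‖z.1‖ ^ 2) + z.2)
    have h2 := hD (√(1 + ‖z'.1‖ ^ 2) + z'.2)
    have h3 : inner ℝ z.1 z'.1 / √(1 + ‖z.1‖ ^ 2) / √(1 + ‖z'.1‖ ^ 2) ≤ 1 := by
      have ha := rho_inner z.1 z'.1
      have hb := rho_norm z'.1
      have hc := rho_one z'.1
      rw [div_le_one (by linarith)]
      linarith [le_abs_self (inner ℝ z.1 z'.1 / √(1 + ‖z.1‖ ^ 2))]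
    have h4 : ∑ k, w i k * w j k ≤ 1 := by
      have : ∑ k, w i k * w j k ≤ ∑ k, (w i k * w i k + w j k * w j k) / 2 :=
        Finset.sum_le_sum fun k _ => by nlinarith [sq_nonneg (w i k - w j k)]
      rw [← Finset.sum_div, Finset.sum_add_distrib, hw, hw] at this
      linarith
    have h5 := mul_nonneg (mul_nonneg h1 h2) (mul_nonneg (sub_nonneg.2 h3) (sub_nonneg.2 h4))
    nlinarith [h5]

lemma finite_prob {I : Type} [Fintype I] {m n : ℕ} (w : I → Fin n → ℝ) (hw : ∀ i, ∑ j, w i j * w i j = 1) :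
    ((matrixGaussian m n).prod (gaussianReal 0 1)) {x | ∃ i, ‖(Pm (w i) x).1‖ + (Pm (w i) x).2 ≤ -1} ≤
      ((gstd m).prod (gstd n)) {y | ∃ i, ‖(Qm (w i) y).1‖ + (Qm (w i) y).2 < 1} := by
  set μ := (matrixGaussian m n).prod (gaussianReal 0 1)
  set ν := (gstd m).prod (gstd n)
  set B := {x : (Fin m → Fin n → ℝ) × ℝ | ∃ i, ‖(Pm (w i) x).1‖ + (Pm (w i) x).2 ≤ -1} with hB
  set T := {y : (Fin m → ℝ) × (Fin n → ℝ) | ∃ i, ‖(Qm (w i) y).1‖ + (Qm (w i) y).2 < 1} with hT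
  have hBm : MeasurableSet B := by
    have : B = ⋃ i, {x | ‖(Pm (w i) x).1‖ + (Pm (w i) x).2 ≤ -1} := by ext; simp [hB]
    rw [this]
    refine MeasurableSet.iUnion fun i => ?_
    exact (isClosed_le (by fun_prop) (by fun_prop)).measurableSet
  have hTm : MeasurableSet T := by
    have : T = ⋃ i, {x | ‖(Qm (w i) x).1‖ + (Qm (w i) x).2 < 1} := by ext; simp [hT]
    rw [this]
    refine MeasurableSet.iUnion fun i => ?_
    exact (isOpen_lt (by fun_prop) (by fun_prop)).measurableSet
  have hφc := phi_cont m
  have p0 : ∀ z : EuclideanSpace ℝ (Fin m) × ℝ, 0 ≤ phi z := fun z => Real.smoothTransition.nonneg _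
  have p1 : ∀ z : EuclideanSpace ℝ (Fin m) × ℝ, phi z ≤ 1 := fun z => Real.smoothTransition.le_one _
  have iP : Integrable (fun x => ∏ i, phi (Pm (w i) x)) μ :=
    Integrable.of_bound (Continuous.aestronglyMeasurable (by fun_prop)) 1 (Filter.Eventually.of_forall fun x => by
      rw [Real.norm_eq_abs, abs_of_nonneg (Finset.prod_nonneg fun i _ => p0 _)]
      exact Finset.prod_le_one (fun i _ => p0 _) fun i _ => p1 _)
  have iQ : Integrable (fun x => ∏ i, phi (Qm (m := m) (w i) x)) ν :=
    Integrable.of_bound (Continuous.aestronglyMeasurable (by fun_prop)) 1 (Filter.Eventually.of_forall fun x => by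
      rw [Real.norm_eq_abs, abs_of_nonneg (Finset.prod_nonneg fun i _ => p0 _)]
      exact Finset.prod_le_one (fun i _ => p0 _) fun i _ => p1 _)
  have hG := gordon_concrete (m := m) w hw
  have h1 : ∫ x, ∏ i, phi (Pm (w i) x) ∂μ ≤ μ.real Bᶜ := by
    rw [← integral_indicator_one hBm.compl]
    refine integral_mono iP ((integrable_const (1 : ℝ)).indicator hBm.compl) fun x => ?_
    by_cases hx : x ∈ B
    · obtain ⟨i, hi⟩ := id hx
      have : phi (Pm (w i) x) = 0 := by
        apply Real.smoothTransition.zero_of_nonpos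
        have : √(1 + ‖(Pm (w i) x).1‖ ^ 2) ≤ 1 + ‖(Pm (w i) x).1‖ :=
          Real.sqrt_le_iff.2 ⟨by positivity, by nlinarith [norm_nonneg (Pm (w i) x).1]⟩
        linarith
      simp only
      rw [Finset.prod_eq_zero (Finset.mem_univ i) this]
      exact Set.indicator_nonneg (fun _ _ => zero_le_one) _
    · rw [Set.indicator_of_mem (by exact hx)]
      exact Finset.prod_le_one (fun i _ => p0 _) fun i _ => p1 _
  have h2 : ν.real Tᶜ ≤ ∫ x, ∏ i, phi (Qm (m := m) (w i) x) ∂ν := by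
    rw [← integral_indicator_one hTm.compl]
    refine integral_mono ((integrable_const (1 : ℝ)).indicator hTm.compl) iQ fun x => ?_
    by_cases hx : x ∈ T
    · rw [Set.indicator_of_notMem (by simpa using hx)]
      exact Finset.prod_nonneg fun i _ => p0 _
    · rw [Set.indicator_of_mem (by exact hx)]
      refine le_of_eq (Eq.symm (Finset.prod_eq_one fun i _ => ?_))
      apply Real.smoothTransition.one_of_one_le
      simp only [hT, Set.mem_setOf_eq, not_exists, not_lt] at hx
      linarith [hx i, rho_norm (Qm (w i) x).1]
  rw [probReal_compl_eq_one_sub hBm] at h1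
  rw [probReal_compl_eq_one_sub hTm] at h2
  have : μ.real B ≤ ν.real T := by linarith
  exact (ENNReal.toReal_le_toReal (measure_ne_top _ _) (measure_ne_top _ _)).1 this

lemma bad_prob {m n : ℕ} (S : Set (Fin n → ℝ)) (hS : ∀ w ∈ S, ∑ i, w i * w i = 1)
    (T : Set ((Fin m → ℝ) × (Fin n → ℝ)))
    (hT : ∀ y, ∀ w ∈ S, ‖WithLp.toLp 2 y.1‖ + ∑ i, w i * y.2 i < 1 → y ∈ T) :
    matrixGaussian m n {A | ∃ w ∈ S, ∀ a, ∑ i, w i * A a i = 0} * gaussianReal 0 1 (Set.Iic (-2)) ≤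
      ((gstd m).prod (gstd n)) T := by
  rcases S.eq_empty_or_nonempty with rfl | hne
  · simp
  haveI : Nonempty S := hne.to_subtype
  obtain ⟨u, hu⟩ := TopologicalSpace.exists_dense_seq S
  rw [← Measure.prod_prod]
  let B : ℕ → Set ((Fin m → Fin n → ℝ) × ℝ) := fun N =>
    {x | ∃ i : Fin N, ‖(Pm (u i : Fin n → ℝ) x).1‖ + (Pm (u i : Fin n → ℝ) x).2 ≤ -1}
  have hsub : {A : Fin m → Fin n → ℝ | ∃ w ∈ S, ∀ a, ∑ i, w i * A a i = 0} ×ˢ Set.Iic (-2 : ℝ) ⊆ ⋃ N, B N := by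
    rintro ⟨A, g⟩ ⟨⟨w, hw, hA⟩, hg⟩
    have hc : Continuous fun v : S => ‖(Pm (m := m) (v : Fin n → ℝ) (A, g)).1‖ := by
      simp only [Pm_apply]
      refine Continuous.norm ((PiLp.continuous_toLp 2 _).comp ?_)
      exact continuous_pi fun a => continuous_finset_sum _ fun i _ =>
        ((continuous_apply i).comp continuous_subtype_val).mul continuous_const
    have h0 : ‖(Pm (m := m) w (A, g)).1‖ = 0 := by
      simp only [Pm_apply, hA]
      rw [norm_eq_zero]; rfl
    have ho : IsOpen {v : S | ‖(Pm (m := m) (v : Fin n → ℝ) (A, g)).1‖ < 1} := isOpen_lt hc continuous_const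
    obtain ⟨v, hv, ⟨j, rfl⟩⟩ := hu.inter_open_nonempty _ ho ⟨⟨w, hw⟩, by simp only [Set.mem_setOf_eq, h0]; norm_num⟩
    refine Set.mem_iUnion.2 ⟨j + 1, ⟨⟨j, by omega⟩, ?_⟩⟩
    simp only [Set.mem_setOf_eq] at hv
    have h3 : (Pm (m := m) (u j : Fin n → ℝ) (A, g)).2 = g := rfl
    have hg' : g ≤ -2 := hg
    simp only [h3]
    linarith
  have hmono : Monotone B := by
    intro N M hNM x ⟨i, hi⟩
    exact ⟨⟨i, lt_of_lt_of_le i.2 hNM⟩, hi⟩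
  refine (measure_mono hsub).trans ?_
  rw [hmono.measure_iUnion]
  refine iSup_le fun N => ?_
  refine (finite_prob (fun i : Fin N => (u i : Fin n → ℝ)) (fun i => hS _ (u i).2)).trans (measure_mono ?_)
  rintro y ⟨i, hi⟩
  exact hT y _ (u i).2 hi

/-- the polar weight -/
noncomputable def dW {n : ℕ} (F : Finset (Fin n)) (ν : ℝ) (h : Fin n → ℝ) (i : Fin n) : ℝ :=
  if i ∈ F then max (|h i| - ν) 0 ^ 2 else (|h i| + ν) ^ 2

lemma dW_nonneg {n : ℕ} (F : Finset (Fin n)) (ν : ℝ) (h : Fin n → ℝ) (i : Fin n) : 0 ≤ dW F ν h i := by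
  unfold dW; split_ifs <;> positivity

lemma det_bound {n : ℕ} (F : Finset (Fin n)) (ν : ℝ) (hν : 0 ≤ ν) (h w : Fin n → ℝ) (hw : ∑ i, w i * w i = 1)
    (hF : ∑ i ∈ F, |w i| ≤ ∑ i ∈ Fᶜ, |w i|) : - ∑ i, w i * h i ≤ √(∑ i, dW F ν h i) := by
  let d : Fin n → ℝ := fun i => if i ∈ F then max (|h i| - ν) 0 else |h i| + ν
  have hd : ∀ i, dW F ν h i = d i ^ 2 := fun i => by simp only [dW, d]; split_ifs <;> rfl
  have h1 : - ∑ i, w i * h i ≤ ∑ i, |w i| * |h i| := by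
    rw [← Finset.sum_neg_distrib]
    refine Finset.sum_le_sum fun i _ => ?_
    rw [← abs_mul]; exact neg_le_abs _
  have h2 : ∑ i, |w i| * |h i| ≤ ∑ i, |w i| * d i := by
    rw [← Finset.sum_add_sum_compl F, ← Finset.sum_add_sum_compl F (fun i => |w i| * d i)]
    have a1 : ∑ i ∈ F, |w i| * |h i| ≤ ∑ i ∈ F, |w i| * d i + ν * ∑ i ∈ F, |w i| := by
      rw [Finset.mul_sum, ← Finset.sum_add_distrib]
      refine Finset.sum_le_sum fun i hi => ?_
      have : |h i| - ν ≤ d i := by simp only [d, hi, if_true]; exact le_max_left _ _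
      nlinarith [abs_nonneg (w i)]
    have a2 : ∑ i ∈ Fᶜ, |w i| * |h i| + ν * ∑ i ∈ Fᶜ, |w i| = ∑ i ∈ Fᶜ, |w i| * d i := by
      rw [Finset.mul_sum, ← Finset.sum_add_distrib]
      refine Finset.sum_congr rfl fun i hi => ?_
      have : i ∉ F := by simpa using hi
      simp only [d, this, if_false]; ring
    nlinarith [mul_le_mul_of_nonneg_left hF hν]
  refine h1.trans (h2.trans (Real.le_sqrt_of_sq_le ?_))
  refine (Finset.sum_mul_sq_le_sq_mul_sq _ _ _).trans ?_
  simp only [sq_abs]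
  simp_rw [hd]
  rw [show ∑ i, w i ^ 2 = 1 by rw [← hw]; exact Finset.sum_congr rfl fun i _ => sq (w i), one_mul]

lemma det_event {m n : ℕ} (F : Finset (Fin n)) (ν τ : ℝ) (hν : 0 ≤ ν) (hτ : 0 < τ) (y : (Fin m → ℝ) × (Fin n → ℝ))
    (w : Fin n → ℝ) (hw : ∑ i, w i * w i = 1)
    (hF : ∑ i ∈ F, |w i| ≤ ∑ i ∈ Fᶜ, |w i|) (hy : ‖WithLp.toLp 2 y.1‖ + ∑ i, w i * y.2 i < 1) :
    ∑ a, y.1 a ^ 2 ≤ ∑ i, (1 + τ) * dW F ν y.2 i + (1 + 1 / τ) := by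
  have h := det_bound F ν hν y.2 w hw hF
  have h0 := Real.sq_sqrt (Finset.sum_nonneg fun i (_ : i ∈ Finset.univ) => dW_nonneg F ν y.2 i)
  have h0' := Real.sqrt_nonneg (∑ i, dW F ν y.2 i)
  set s := √(∑ i, dW F ν y.2 i)
  have h2 : ‖WithLp.toLp 2 y.1‖ ^ 2 = ∑ a, y.1 a ^ 2 := by
    rw [EuclideanSpace.norm_sq_eq]; simp
  rw [← h2, ← Finset.mul_sum, ← h0]
  have h3 : ‖WithLp.toLp 2 y.1‖ ≤ 1 + s := by linarith
  have h4 : ‖WithLp.toLp 2 y.1‖ ^ 2 ≤ (1 + s) ^ 2 := by gcongr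
  have h5 : 2 * s ≤ τ * s ^ 2 + 1 / τ := by
    have : τ * s ^ 2 + 1 / τ - 2 * s = (τ * s - 1) ^ 2 / τ := by field_simp; ring
    have h6 : 0 ≤ (τ * s - 1) ^ 2 / τ := by positivity
    linarith
  nlinarith

lemma chernoff {m n : ℕ} (F : Finset (Fin n)) (q1 q2 : ℝ → ℝ) (K l : ℝ) (hl : 0 ≤ l)
    (h1 : Integrable (fun x => Real.exp (l * q1 x)) (gaussianReal 0 1))
    (h2 : Integrable (fun x => Real.exp (l * q2 x)) (gaussianReal 0 1))
    (h3 : Integrable (fun x => Real.exp (l * (-x ^ 2))) (gaussianReal 0 1)) :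
    ((gstd m).prod (gstd n)).real {y | ∑ a, y.1 a ^ 2 ≤ ∑ i, (if i ∈ F then q2 (y.2 i) else q1 (y.2 i)) + K} ≤
      Real.exp (l * K) * ((∫ x, Real.exp (l * (-x ^ 2)) ∂(gaussianReal 0 1)) ^ m *
        ((∫ x, Real.exp (l * q2 x) ∂(gaussianReal 0 1)) ^ F.card *
        (∫ x, Real.exp (l * q1 x) ∂(gaussianReal 0 1)) ^ (Fᶜ).card)) := by
  let X : (Fin m → ℝ) × (Fin n → ℝ) → ℝ := fun y => ∑ i, (if i ∈ F then q2 (y.2 i) else q1 (y.2 i)) - ∑ a, y.1 a ^ 2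
  let f : Fin m → ℝ → ℝ := fun _ x => Real.exp (l * (-x ^ 2))
  let g : Fin n → ℝ → ℝ := fun i x => if i ∈ F then Real.exp (l * q2 x) else Real.exp (l * q1 x)
  have e : ∀ y, Real.exp (l * X y) = (∏ a, f a (y.1 a)) * ∏ i, g i (y.2 i) := by
    intro y
    have hg : ∀ i, g i (y.2 i) = Real.exp (l * (if i ∈ F then q2 (y.2 i) else q1 (y.2 i))) := fun i => by
      simp only [g]; split_ifs <;> rfl
    simp_rw [hg, f, ← Real.exp_sum, ← Real.exp_add, ← Finset.mul_sum, X, Finset.sum_neg_distrib]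
    congr 1; ring
  have hf : ∀ a, Integrable (f a) (gaussianReal 0 1) := fun a => h3
  have hg : ∀ i, Integrable (g i) (gaussianReal 0 1) := fun i => by
    simp only [g]; split_ifs <;> assumption
  have If : Integrable (fun x : Fin m → ℝ => ∏ a, f a (x a)) (gstd m) := Integrable.fintype_prod hf
  have Ig : Integrable (fun x : Fin n → ℝ => ∏ a, g a (x a)) (gstd n) := Integrable.fintype_prod hg
  have hI : Integrable (fun y => Real.exp (l * X y)) ((gstd m).prod (gstd n)) := by
    simp_rw [e]; exact If.mul_prod Ig
  have hset : {y : (Fin m → ℝ) × (Fin n → ℝ) | ∑ a, y.1 a ^ 2 ≤ ∑ i, (if i ∈ F then q2 (y.2 i) else q1 (y.2 i)) + K}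
    = {y | -K ≤ X y} := by
    ext y; simp only [Set.mem_setOf_eq, X]; constructor <;> intro h <;> linarith
  rw [hset]
  refine (measure_ge_le_exp_mul_mgf (-K) hl hI).trans (le_of_eq ?_)
  rw [show -l * -K = l * K by ring]
  congr 1
  unfold mgf
  simp_rw [e]
  rw [integral_prod_mul (μ := gstd m) (ν := gstd n) (fun x => ∏ a, f a (x a)) (fun x => ∏ i, g i (x i))]
  unfold gstd
  rw [integral_fintype_prod_eq_prod, integral_fintype_prod_eq_prod]
  congr 1
  · simp [f]
  · rw [← Finset.prod_mul_prod_compl F]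
    congr 1
    · refine (Finset.prod_congr rfl fun i hi => ?_).trans (Finset.prod_const _)
      simp [g, hi]
    · refine (Finset.prod_congr rfl fun i hi => ?_).trans (Finset.prod_const _)
      have : i ∉ F := by simpa using hi
      simp [g, this]

lemma small_mgf (q : ℝ → ℝ) (hq : Continuous q) (a b : ℝ) (hab : ∀ x, |q x| ≤ a + b * x ^ 2) (ha : 0 ≤ a) (hb : 0 < b)
    (c : ℝ) (hc : ∫ x, q x ∂(gaussianReal 0 1) < c) :
    ∀ᶠ l in nhdsWithin (0 : ℝ) (Set.Ioi 0), Integrable (fun x => Real.exp (l * q x)) (gaussianReal 0 1) ∧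
      ∫ x, Real.exp (l * q x) ∂(gaussianReal 0 1) ≤ Real.exp (l * c) := by
  obtain ⟨C, hC, hint⟩ := IsGaussian.exists_integrable_exp_sq (gaussianReal 0 1)
  have hI : ∀ t : ℝ, |t| ≤ C / b → Integrable (fun x => Real.exp (t * q x)) (gaussianReal 0 1) := by
    intro t ht
    refine (hint.const_mul (Real.exp (|t| * a))).mono' (by fun_prop) (Filter.Eventually.of_forall fun x => ?_)
    rw [Real.norm_eq_abs, abs_of_pos (Real.exp_pos _), ← Real.exp_add, Real.exp_le_exp]
    have h1 : t * q x ≤ |t| * |q x| := by rw [← abs_mul]; exact le_abs_self _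
    have h2 := mul_le_mul_of_nonneg_left (hab x) (abs_nonneg t)
    have h3 : |t| * b ≤ C := (le_div_iff₀ hb).1 ht
    have h4 := mul_le_mul_of_nonneg_right h3 (sq_nonneg x)
    rw [Real.norm_eq_abs, sq_abs]
    nlinarith
  have hmem : (0 : ℝ) ∈ interior (integrableExpSet q (gaussianReal 0 1)) := by
    rw [mem_interior_iff_mem_nhds]
    have : Metric.ball (0 : ℝ) (C / b) ∈ nhds (0 : ℝ) := Metric.ball_mem_nhds _ (by positivity)
    filter_upwards [this] with t ht
    refine hI t ?_
    rw [mem_ball_zero_iff, Real.norm_eq_abs] at ht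
    exact ht.le
  have hd := hasDerivAt_mgf hmem
  simp only [zero_mul, Real.exp_zero, mul_one] at hd
  have hd2 : HasDerivAt (fun l : ℝ => Real.exp (l * c)) c 0 := by
    have := ((hasDerivAt_id (0 : ℝ)).mul_const c).exp
    simpa using this
  have hd3 := hd2.sub hd
  rw [hasDerivAt_iff_tendsto_slope] at hd3
  have h5 := (hd3.eventually (lt_mem_nhds (sub_pos.2 hc)))
  have h6 : ∀ᶠ l in nhdsWithin (0 : ℝ) (Set.Ioi 0), 0 < slope ((fun l : ℝ => Real.exp (l * c)) - mgf q (gaussianReal 0 1)) 0 l :=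
    h5.filter_mono (nhdsWithin_mono _ (fun x hx => ne_of_gt hx))
  have h7 : ∀ᶠ l in nhdsWithin (0 : ℝ) (Set.Ioi 0), l ∈ Metric.ball (0 : ℝ) (C / b) :=
    nhdsWithin_le_nhds (Metric.ball_mem_nhds _ (by positivity))
  filter_upwards [h6, h7, self_mem_nhdsWithin] with l h6 h7 h8
  rw [mem_ball_zero_iff, Real.norm_eq_abs] at h7
  refine ⟨hI l h7.le, ?_⟩
  have h8' : 0 < l := h8
  rw [slope_def_field] at h6
  simp only [Pi.sub_apply, zero_mul, Real.exp_zero, mgf_zero, sub_self, sub_zero] at h6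
  have := (div_pos_iff_of_pos_right h8').1 h6
  change mgf q (gaussianReal 0 1) l ≤ _
  linarith

lemma gauss_abs (f : ℝ → ℝ) : ∫ x, f |x| ∂(gaussianReal 0 1) =
    2 * (√(2 * Real.pi))⁻¹ * ∫ x in Set.Ioi (0 : ℝ), f x * Real.exp (-x ^ 2 / 2) := by
  rw [integral_gaussianReal_eq_integral_smul (by norm_num)]
  have e : ∀ x : ℝ, gaussianPDFReal 0 1 x • f |x| =
     (fun y : ℝ => (√(2 * Real.pi))⁻¹ * (f y * Real.exp (-y ^ 2 / 2))) |x| := by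
    intro x
    simp only [gaussianPDFReal, NNReal.coe_one, mul_one, sub_zero, smul_eq_mul, sq_abs]
    ring
  simp_rw [e]
  rw [integral_comp_abs (f := fun y : ℝ => (√(2 * Real.pi))⁻¹ * (f y * Real.exp (-y ^ 2 / 2))), integral_const_mul]
  ring

lemma tends_exp : Filter.Tendsto (fun x : ℝ => Real.exp (-x ^ 2 / 2)) Filter.atTop (nhds 0) := by
  have h := Real.tendsto_pow_mul_exp_neg_atTop_nhds_zero 0
  refine tendsto_of_tendsto_of_tendsto_of_le_of_le' tendsto_const_nhds h
    (Filter.Eventually.of_forall fun x => (Real.exp_pos _).le) ?_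
  filter_upwards [Filter.eventually_ge_atTop (2 : ℝ)] with x hx
  rw [pow_zero, one_mul, Real.exp_le_exp]; nlinarith

lemma tends_xexp : Filter.Tendsto (fun x : ℝ => x * Real.exp (-x ^ 2 / 2)) Filter.atTop (nhds 0) := by
  have h := Real.tendsto_pow_mul_exp_neg_atTop_nhds_zero 1
  refine tendsto_of_tendsto_of_tendsto_of_le_of_le' tendsto_const_nhds h ?_ ?_
  · filter_upwards [Filter.eventually_ge_atTop (2 : ℝ)] with x hx
    positivity
  filter_upwards [Filter.eventually_ge_atTop (2 : ℝ)] with x hx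
  rw [pow_one]
  have : Real.exp (-x ^ 2 / 2) ≤ Real.exp (-x) := by rw [Real.exp_le_exp]; nlinarith
  exact mul_le_mul_of_nonneg_left this (by linarith)

lemma deriv_exp_half (x : ℝ) : HasDerivAt (fun x : ℝ => Real.exp (-x ^ 2 / 2)) (-x * Real.exp (-x ^ 2 / 2)) x := by
  have h := (((hasDerivAt_id x).pow 2).neg.div_const 2).exp
  refine HasDerivAt.congr_deriv (f' := _) h ?_
  simp [mul_comm]
  ring

lemma sqrt_two_pi : 2 * (√(2 * Real.pi))⁻¹ = √(2 / Real.pi) := by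
  have hp := Real.pi_pos
  rw [Real.sqrt_mul (by norm_num), Real.sqrt_div (by norm_num)]
  have h1 : (0 : ℝ) < √2 := by positivity
  have h2 : (0 : ℝ) < √Real.pi := by positivity
  field_simp
  rw [Real.sq_sqrt (by norm_num)]

lemma E_abs : ∫ x, |x| ∂(gaussianReal 0 1) = √(2 / Real.pi) := by
  rw [gauss_abs (fun x => x)]
  have := integral_Ioi_of_hasDerivAt_of_nonneg' (a := (0 : ℝ)) (l := -0) (g := fun x : ℝ => -Real.exp (-x ^ 2 / 2))
    (g' := fun x => x * Real.exp (-x ^ 2 / 2))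
    (fun x _ => (deriv_exp_half x).neg.congr_deriv (by ring)) (fun x hx => mul_nonneg (le_of_lt hx) (Real.exp_pos _).le) tends_exp.neg
  rw [this, sqrt_two_pi]; simp

lemma Phi_erf (x : ℝ) : ∫ t in (0 : ℝ)..x, Real.exp (-t ^ 2 / 2) = √(Real.pi / 2) * erf (x / √2) := by
  have h2 : (0 : ℝ) < √2 := by positivity
  have h := intervalIntegral.integral_comp_div (a := 0) (b := x) (fun t => Real.exp (-t ^ 2)) h2.ne'
  have e : ∀ t : ℝ, Real.exp (-(t / √2) ^ 2) = Real.exp (-t ^ 2 / 2) := fun t => by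
    rw [div_pow, Real.sq_sqrt (by norm_num)]; congr 1; ring
  simp_rw [e] at h
  rw [h, erf, zero_div, smul_eq_mul, Real.sqrt_div' _ (by norm_num)]
  have hp : (0 : ℝ) < √Real.pi := by have := Real.pi_pos; positivity
  field_simp
  rw [Real.sq_sqrt (by norm_num)]
  ring

lemma Phi_tends : Filter.Tendsto (fun x : ℝ => ∫ t in (0 : ℝ)..x, Real.exp (-t ^ 2 / 2)) Filter.atTop (nhds (√(Real.pi / 2))) := by
  have e : ∀ t : ℝ, Real.exp (-t ^ 2 / 2) = Real.exp (-(1 / 2) * t ^ 2) := fun t => by congr 1; ring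
  simp_rw [e]
  have h := intervalIntegral_tendsto_integral_Ioi (μ := volume) (0 : ℝ)
    ((integrable_exp_neg_mul_sq (b := 1 / 2) (by norm_num)).integrableOn) Filter.tendsto_id
  rw [integral_gaussian_Ioi] at h
  have : √(Real.pi / (1 / 2)) / 2 = √(Real.pi / 2) := by
    rw [show Real.pi / (1 / 2) = 2 ^ 2 * (Real.pi / 2) by ring, Real.sqrt_mul (by norm_num), Real.sqrt_sq (by norm_num)]
    ring
  rw [this] at h
  exact h

lemma E_trunc (ν : ℝ) (hν : 0 ≤ ν) : ∫ x, max (|x| - ν) 0 ^ 2 ∂(gaussianReal 0 1) =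
    erfc (ν / √2) * (1 + ν ^ 2) - 2 * ν * Real.exp (-ν ^ 2 / 2) / √(2 * Real.pi) := by
  rw [gauss_abs (fun x => max (x - ν) 0 ^ 2)]
  have h1 : ∫ x in Set.Ioi (0 : ℝ), max (x - ν) 0 ^ 2 * Real.exp (-x ^ 2 / 2)
      = ∫ x in Set.Ioi ν, (x - ν) ^ 2 * Real.exp (-x ^ 2 / 2) := by
    rw [setIntegral_eq_of_subset_of_forall_diff_eq_zero (s := Set.Ioi ν) (t := Set.Ioi (0 : ℝ)) measurableSet_Ioi
      (Set.Ioi_subset_Ioi hν)]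
    · refine setIntegral_congr_fun measurableSet_Ioi fun x hx => ?_
      have hx' : ν < x := hx
      rw [max_eq_left (by linarith)]
    · rintro x ⟨_, hx⟩
      have hx' : x ≤ ν := not_lt.1 hx
      rw [max_eq_right (by linarith)]; simp
  rw [h1]
  have hc : Continuous fun t : ℝ => Real.exp (-t ^ 2 / 2) := by fun_prop
  have h2 := integral_Ioi_of_hasDerivAt_of_nonneg' (a := ν) (l := -(0 - 2 * ν * 0) + (1 + ν ^ 2) * √(Real.pi / 2))
    (g := fun x : ℝ => -(x * Real.exp (-x ^ 2 / 2) - 2 * ν * Real.exp (-x ^ 2 / 2)) + (1 + ν ^ 2) * ∫ t in (0 : ℝ)..x, Real.exp (-t ^ 2 / 2))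
    (g' := fun x => (x - ν) ^ 2 * Real.exp (-x ^ 2 / 2))
    (fun x _ => by
      have hd := deriv_exp_half x
      have := (((hasDerivAt_id x).mul hd).sub (hd.const_mul (2 * ν))).neg.add
        ((hc.integral_hasStrictDerivAt 0 x).hasDerivAt.const_mul (1 + ν ^ 2))
      refine this.congr_deriv ?_
      simp only [id_eq]; ring)
    (fun x _ => by positivity)
    ((tends_xexp.sub (tends_exp.const_mul _)).neg.add (Phi_tends.const_mul _))
  rw [h2, Phi_erf, erfc]
  have h3 : 2 * (√(2 * Real.pi))⁻¹ * √(Real.pi / 2) = 1 := by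
    rw [sqrt_two_pi, ← Real.sqrt_mul (by have := Real.pi_pos; positivity)]
    have : 2 / Real.pi * (Real.pi / 2) = 1 := by have := Real.pi_pos; field_simp
    rw [this, Real.sqrt_one]
  linear_combination ((1 + ν ^ 2) * (1 - erf (ν / √2))) * h3

lemma E_sq : ∫ x, x ^ 2 ∂(gaussianReal 0 1) = 1 := by
  have h := variance_fun_id_gaussianReal (μ := 0) (v := 1)
  rw [variance_of_integral_eq_zero (by fun_prop) (by simp)] at h
  simpa using h

lemma E_plus (ν : ℝ) : ∫ x, (|x| + ν) ^ 2 ∂(gaussianReal 0 1) = ν ^ 2 + 1 + 2 * √(2 / Real.pi) * ν := by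
  have hm := memLp_id_gaussianReal' (μ := 0) (v := 1) 2 (by simp)
  have i1 : Integrable (fun x : ℝ => |x|) (gaussianReal 0 1) := (hm.integrable (by norm_num)).abs
  have i2 : Integrable (fun x : ℝ => x ^ 2) (gaussianReal 0 1) := hm.integrable_sq
  have e : ∀ x : ℝ, (|x| + ν) ^ 2 = x ^ 2 + (2 * ν * |x| + ν ^ 2) := fun x => by rw [add_sq, sq_abs]; ring
  simp_rw [e]
  have i3 : Integrable (fun x : ℝ => 2 * ν * |x| + ν ^ 2) (gaussianReal 0 1) := (i1.const_mul _).add (integrable_const _)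
  rw [integral_add i2 i3, integral_add (i1.const_mul _) (integrable_const _),
    integral_const_mul, E_abs, E_sq]
  simp; ring

lemma c0_pos : 0 < (gaussianReal 0 1).real (Set.Iic (-2)) := by
  rw [measureReal_def, ENNReal.toReal_pos_iff]
  refine ⟨pos_iff_ne_zero.2 fun h => ?_, measure_lt_top _ _⟩
  have := gaussianReal_absolutelyContinuous' 0 (v := 1) (by norm_num) h
  simp at this

lemma bad_reduction {m n k : ℕ} (A : Fin m → Fin n → ℝ)
    (hA : ¬ ∀ x : Fin n → ℝ, (∀ i : Fin n, (i : ℕ) < n - k → x i = 0) → UniqueL1Min A x) :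
    ∃ w : Fin n → ℝ, (∑ i, w i * w i = 1 ∧ ∑ i ∈ Finset.univ.filter (fun i : Fin n => (i : ℕ) < n - k), |w i| ≤
      ∑ i ∈ (Finset.univ.filter (fun i : Fin n => (i : ℕ) < n - k))ᶜ, |w i|) ∧ ∀ a, ∑ i, w i * A a i = 0 := by
  set F := Finset.univ.filter (fun i : Fin n => (i : ℕ) < n - k) with hF
  simp only [UniqueL1Min, not_forall, not_lt] at hA
  obtain ⟨x, hx, z, hz, hne, hle⟩ := hA
  let v : Fin n → ℝ := fun i => z i - x i
  have hv : ∑ i ∈ F, |v i| ≤ ∑ i ∈ Fᶜ, |v i| := by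
    rw [← Finset.sum_add_sum_compl F, ← Finset.sum_add_sum_compl F (fun i => |x i|)] at hle
    have h1 : ∑ i ∈ F, |z i| = ∑ i ∈ F, |v i| := Finset.sum_congr rfl fun i hi => by
      simp only [v, hx i (by simpa [hF] using hi), sub_zero]
    have h2 : ∑ i ∈ F, |x i| = 0 := Finset.sum_eq_zero fun i hi => by
      rw [hx i (by simpa [hF] using hi), abs_zero]
    have h3 : ∑ i ∈ Fᶜ, |x i| ≤ ∑ i ∈ Fᶜ, |z i| + ∑ i ∈ Fᶜ, |v i| := by
      rw [← Finset.sum_add_distrib]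
      refine Finset.sum_le_sum fun i _ => ?_
      have := abs_sub (z i) (v i)
      simpa [v] using this
    linarith
  have hpos : 0 < ∑ i, v i ^ 2 := by
    obtain ⟨i, hi⟩ := Function.ne_iff.1 hne
    refine Finset.sum_pos' (fun i _ => sq_nonneg _) ⟨i, Finset.mem_univ _, ?_⟩
    have : v i ≠ 0 := sub_ne_zero.2 hi
    positivity
  set r := √(∑ i, v i ^ 2) with hr
  have hr0 : 0 < r := Real.sqrt_pos.2 hpos
  have hr2 : r ^ 2 = ∑ i, v i ^ 2 := Real.sq_sqrt hpos.le
  refine ⟨fun i => v i / r, ⟨?_, ?_⟩, ?_⟩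
  · have : ∀ i, v i / r * (v i / r) = v i ^ 2 / r ^ 2 := fun i => by ring
    simp_rw [this]
    rw [← Finset.sum_div, hr2, div_self hpos.ne']
  · simp_rw [abs_div, ← Finset.sum_div]
    gcongr
  · intro a
    have : ∀ i, v i / r * A a i = (A a i * z i - A a i * x i) / r := fun i => by simp only [v]; ring
    simp_rw [this]
    rw [← Finset.sum_div, Finset.sum_sub_distrib, hz a, sub_self, zero_div]

lemma main_prob (ν τ l c1 c2 c3 : ℝ) (hν : 0 ≤ ν) (hτ : 0 < τ) (hl : 0 < l)
    (h1 : Integrable (fun x => Real.exp (l * ((1 + τ) * (|x| + ν) ^ 2))) (gaussianReal 0 1))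
    (h1' : ∫ x, Real.exp (l * ((1 + τ) * (|x| + ν) ^ 2)) ∂(gaussianReal 0 1) ≤ Real.exp (l * c1))
    (h2 : Integrable (fun x => Real.exp (l * ((1 + τ) * max (|x| - ν) 0 ^ 2))) (gaussianReal 0 1))
    (h2' : ∫ x, Real.exp (l * ((1 + τ) * max (|x| - ν) 0 ^ 2)) ∂(gaussianReal 0 1) ≤ Real.exp (l * c2))
    (h3 : Integrable (fun x => Real.exp (l * (-x ^ 2))) (gaussianReal 0 1))
    (h3' : ∫ x, Real.exp (l * (-x ^ 2)) ∂(gaussianReal 0 1) ≤ Real.exp (l * c3))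
    (m n k : ℕ) (hk : k ≤ n) :
    (matrixGaussian m n).real {A | ¬ ∀ x : Fin n → ℝ, (∀ i : Fin n, (i : ℕ) < n - k → x i = 0) → UniqueL1Min A x}
      * (gaussianReal 0 1).real (Set.Iic (-2)) ≤
      Real.exp (l * ((1 + 1 / τ) + c3 * m + c2 * (n - k : ℕ) + c1 * k)) := by
  set F := Finset.univ.filter (fun i : Fin n => (i : ℕ) < n - k) with hF
  have hFc : F.card = n - k := by rw [hF, Fin.card_filter_val_lt]; omega
  have hFc' : (Fᶜ).card = k := by rw [Finset.card_compl, hFc, Fintype.card_fin]; omega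
  have hb := bad_prob (m := m) {w : Fin n → ℝ | ∑ i, w i * w i = 1 ∧ ∑ i ∈ F, |w i| ≤ ∑ i ∈ Fᶜ, |w i|} (fun w hw => hw.1)
    {y | ∑ a, y.1 a ^ 2 ≤ ∑ i, (1 + τ) * dW F ν y.2 i + (1 + 1 / τ)}
    (fun y w hw hy => det_event F ν τ hν hτ y w hw.1 hw.2 hy)
  have hb2 := ENNReal.toReal_mono (measure_ne_top _ _) hb
  rw [ENNReal.toReal_mul] at hb2
  have hsub : (matrixGaussian m n).real {A | ¬ ∀ x : Fin n → ℝ, (∀ i : Fin n, (i : ℕ) < n - k → x i = 0) → UniqueL1Min A x}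
    ≤ (matrixGaussian m n).real {A | ∃ w ∈ {w : Fin n → ℝ | ∑ i, w i * w i = 1 ∧ ∑ i ∈ F, |w i| ≤ ∑ i ∈ Fᶜ, |w i|}, ∀ a, ∑ i, w i * A a i = 0} := by
    refine measureReal_mono fun A hA => ?_
    exact bad_reduction A hA
  refine (mul_le_mul_of_nonneg_right hsub measureReal_nonneg).trans (hb2.trans ?_)
  have hset : {y : (Fin m → ℝ) × (Fin n → ℝ) | ∑ a, y.1 a ^ 2 ≤ ∑ i, (1 + τ) * dW F ν y.2 i + (1 + 1 / τ)}
    = {y | ∑ a, y.1 a ^ 2 ≤ ∑ i, (if i ∈ F then (fun x => (1 + τ) * max (|x| - ν) 0 ^ 2) (y.2 i) else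
      (fun x => (1 + τ) * (|x| + ν) ^ 2) (y.2 i)) + (1 + 1 / τ)} := by
    ext y
    have : ∀ i, (1 + τ) * dW F ν y.2 i = (if i ∈ F then (fun x => (1 + τ) * max (|x| - ν) 0 ^ 2) (y.2 i) else
      (fun x => (1 + τ) * (|x| + ν) ^ 2) (y.2 i)) := fun i => by
      simp only [dW]; split_ifs <;> rfl
    simp only [Set.mem_setOf_eq, this]
  rw [hset]
  refine (chernoff (m := m) F _ _ (1 + 1 / τ) l hl.le h1 h2 h3).trans ?_
  rw [hFc, hFc']
  have hp : ∀ q : ℝ → ℝ, 0 ≤ ∫ x, Real.exp (l * q x) ∂(gaussianReal 0 1) := fun q => integral_nonneg fun x => (Real.exp_pos _).le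
  calc _ ≤ Real.exp (l * (1 + 1 / τ)) * (Real.exp (l * c3) ^ m * (Real.exp (l * c2) ^ (n - k) * Real.exp (l * c1) ^ k)) := by
        have p1 := hp (fun x => (1 + τ) * (|x| + ν) ^ 2)
        have p2 := hp (fun x => (1 + τ) * max (|x| - ν) 0 ^ 2)
        have p3 := hp (fun x => -x ^ 2)
        gcongr
    _ = _ := by
        rw [← Real.exp_nat_mul, ← Real.exp_nat_mul, ← Real.exp_nat_mul, ← Real.exp_add, ← Real.exp_add, ← Real.exp_add]
        congr 1; ring

lemma final_aux (α β ν : ℝ) (hα0 : 0 < α) (hα1 : α < 1) (hβ0 : 0 < β) (hβ1 : β < 1) (hν : 0 ≤ ν)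
    (hD : β * (∫ x, (|x| + ν) ^ 2 ∂(gaussianReal 0 1)) + (1 - β) * ∫ x, max (|x| - ν) 0 ^ 2 ∂(gaussianReal 0 1) < α) :
    ∃ ε > (0 : ℝ), ∃ N : ℕ, ∀ n ≥ N,
      1 - ENNReal.ofReal (Real.exp (-ε * n)) ≤
        matrixGaussian (⌈α * n⌉₊) n
          {A | ∀ x : Fin n → ℝ,
            (∀ i : Fin n, (i : ℕ) < n - ⌈β * n⌉₊ → x i = 0) → UniqueL1Min A x} := by
  set E1 := ∫ x, (|x| + ν) ^ 2 ∂(gaussianReal 0 1) with hE1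
  set E2 := ∫ x, max (|x| - ν) 0 ^ 2 ∂(gaussianReal 0 1) with hE2
  have hE1p : 0 ≤ E1 := integral_nonneg fun x => sq_nonneg _
  have hE2p : 0 ≤ E2 := integral_nonneg fun x => sq_nonneg _
  set D := β * E1 + (1 - β) * E2 with hDdef
  have hDp : 0 ≤ D := by
    have : 0 ≤ 1 - β := by linarith
    positivity
  set η := α - D with hη
  have hη0 : 0 < η := by linarith
  set τ := η / (2 * (D + 2)) with hτdef
  have hτ : 0 < τ := by positivity
  have hτD : τ * (D + 2) = η / 2 := by rw [hτdef]; field_simp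
  have hτ1 : τ < 1 := by
    have := mul_nonneg hτ.le hDp
    linarith
  set c1 := (1 + τ) * E1 + τ with hc1
  set c2 := (1 + τ) * E2 + τ with hc2
  set c3 := -1 + τ with hc3
  have hc1p : 0 ≤ c1 := by positivity
  have hc2p : 0 ≤ c2 := by positivity
  have hc3n : c3 ≤ 0 := by linarith
  have e1 := small_mgf (fun x => (1 + τ) * (|x| + ν) ^ 2) (by fun_prop) ((1 + τ) * (2 * ν ^ 2)) ((1 + τ) * 2)
    (fun x => by
      rw [abs_of_nonneg (by positivity)]
      have : (|x| + ν) ^ 2 ≤ 2 * ν ^ 2 + 2 * x ^ 2 := by rw [← sq_abs x]; nlinarith [sq_nonneg (|x| - ν)]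
      nlinarith [mul_le_mul_of_nonneg_left this (by positivity : 0 ≤ 1 + τ)]) (by positivity) (by positivity) c1
    (by rw [integral_const_mul, ← hE1]; linarith)
  have e2 := small_mgf (fun x => (1 + τ) * max (|x| - ν) 0 ^ 2) (by fun_prop) ((1 + τ) * (2 * ν ^ 2)) ((1 + τ) * 2)
    (fun x => by
      rw [abs_of_nonneg (by positivity)]
      have h0 : max (|x| - ν) 0 ≤ |x| := max_le (by linarith) (abs_nonneg x)
      have h00 : 0 ≤ max (|x| - ν) 0 := le_max_right _ _
      have : max (|x| - ν) 0 ^ 2 ≤ 2 * ν ^ 2 + 2 * x ^ 2 := by rw [← sq_abs x]; nlinarith [sq_nonneg ν]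
      nlinarith [mul_le_mul_of_nonneg_left this (by positivity : 0 ≤ 1 + τ)]) (by positivity) (by positivity) c2
    (by rw [integral_const_mul, ← hE2]; linarith)
  have e3 := small_mgf (fun x => -x ^ 2) (by fun_prop) 0 1
    (fun x => by rw [abs_neg, abs_of_nonneg (sq_nonneg x)]; linarith) le_rfl one_pos c3
    (by rw [integral_neg, E_sq]; linarith)
  obtain ⟨l, ⟨h1, h1'⟩, ⟨h2, h2'⟩, ⟨h3, h3'⟩, hl⟩ :=
    (e1.and (e2.and (e3.and (self_mem_nhdsWithin (a := (0 : ℝ)) (s := Set.Ioi 0))))).exists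
  have hl0 : 0 < l := hl
  have hc0 := c0_pos
  set c0 := (gaussianReal 0 1).real (Set.Iic (-2)) with hc0def
  set M := Real.exp (l * ((1 + 1 / τ) + c1)) / c0 with hM
  have hM0 : 0 < M := by positivity
  have hε : 0 < l * η / 4 := by positivity
  refine ⟨l * η / 4, hε, ⌈Real.log M / (l * η / 4)⌉₊, fun n hn => ?_⟩
  have hn' : Real.log M ≤ (l * η / 4) * n := by
    have := (Nat.ceil_le.1 hn)
    rw [div_le_iff₀ hε] at this
    linarith
  have hMle : M ≤ Real.exp ((l * η / 4) * n) := by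
    rw [← Real.exp_log hM0]; exact Real.exp_le_exp.2 hn'
  have hk : ⌈β * n⌉₊ ≤ n := by
    rw [Nat.ceil_le]
    exact mul_le_of_le_one_left (Nat.cast_nonneg n) hβ1.le
  have hmain := main_prob ν τ l c1 c2 c3 hν hτ hl0 h1 h1' h2 h2' h3 h3' ⌈α * n⌉₊ n ⌈β * n⌉₊ hk
  set G := {A : Fin ⌈α * n⌉₊ → Fin n → ℝ | ∀ x : Fin n → ℝ,
            (∀ i : Fin n, (i : ℕ) < n - ⌈β * n⌉₊ → x i = 0) → UniqueL1Min A x} with hG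
  have hexp : (1 + 1 / τ) + c3 * ⌈α * n⌉₊ + c2 * (n - ⌈β * n⌉₊ : ℕ) + c1 * ⌈β * n⌉₊ ≤ ((1 + 1 / τ) + c1) - η / 2 * n := by
    have hn0 : (0 : ℝ) ≤ n := Nat.cast_nonneg n
    have a1 : α * n ≤ (⌈α * n⌉₊ : ℝ) := Nat.le_ceil _
    have a2 : (⌈β * n⌉₊ : ℝ) ≤ β * n + 1 := (Nat.ceil_lt_add_one (by positivity)).le
    have a3 : β * n ≤ (⌈β * n⌉₊ : ℝ) := Nat.le_ceil _
    rw [Nat.cast_sub hk]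
    have b1 := mul_le_mul_of_nonpos_left a1 hc3n
    have b2 := mul_le_mul_of_nonneg_left a2 hc1p
    have b3 : c2 * ((n : ℝ) - ⌈β * n⌉₊) ≤ c2 * (n - β * n) := mul_le_mul_of_nonneg_left (by linarith) hc2p
    have key : c3 * α + c2 * (1 - β) + c1 * β ≤ -(η / 2) := by
      have : c3 * α + c2 * (1 - β) + c1 * β = D - α + τ * (D + 1 + α) := by
        rw [hc1, hc2, hc3, hDdef]; ring
      rw [this]
      have h9 : τ * α ≤ τ * 1 := mul_le_mul_of_nonneg_left hα1.le hτ.le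
      linarith
    linarith [mul_le_mul_of_nonneg_right key hn0]
  have hbad : (matrixGaussian ⌈α * n⌉₊ n).real Gᶜ ≤ Real.exp (-(l * η / 4) * n) := by
    have h5 : (matrixGaussian ⌈α * n⌉₊ n).real Gᶜ * c0 ≤ Real.exp (l * (((1 + 1 / τ) + c1) - η / 2 * n)) :=
      hmain.trans (Real.exp_le_exp.2 (mul_le_mul_of_nonneg_left hexp hl0.le))
    rw [← le_div_iff₀ hc0] at h5
    refine h5.trans ?_
    have h6 : Real.exp (l * (((1 + 1 / τ) + c1) - η / 2 * n)) / c0 = M * Real.exp (-(l * η / 2 * n)) := by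
      have h7 : l * (((1 + 1 / τ) + c1) - η / 2 * n) = l * ((1 + 1 / τ) + c1) + -(l * η / 2 * n) := by ring
      rw [h7, Real.exp_add, hM]; ring
    rw [h6]
    refine (mul_le_mul_of_nonneg_right hMle (Real.exp_pos _).le).trans ?_
    rw [← Real.exp_add, Real.exp_le_exp]
    linarith
  have hbad' : matrixGaussian ⌈α * n⌉₊ n Gᶜ ≤ ENNReal.ofReal (Real.exp (-(l * η / 4) * n)) := by
    rw [← ofReal_measureReal (measure_ne_top _ _)]
    exact ENNReal.ofReal_le_ofReal hbad
  rw [tsub_le_iff_right]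
  calc (1 : ENNReal) = matrixGaussian ⌈α * n⌉₊ n (G ∪ Gᶜ) := by rw [Set.union_compl_self, measure_univ]
    _ ≤ matrixGaussian ⌈α * n⌉₊ n G + matrixGaussian ⌈α * n⌉₊ n Gᶜ := measure_union_le _ _
    _ ≤ _ := by gcongr

theorem sectional_threshold_lower_bound
    (α β : ℝ) (hα : α ∈ Set.Ioo (0 : ℝ) 1) (hβ : β ∈ Set.Ioo (0 : ℝ) 1)
    (hcond : sInf {v : ℝ | ∃ ν : ℝ, 0 ≤ ν ∧
        v = Real.sqrt (β * (ν ^ 2 + 1 + 2 * Real.sqrt (2 / Real.pi) * ν) +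
          (1 - β) * (erfc (ν / Real.sqrt 2) * (1 + ν ^ 2) -
            2 * ν * Real.exp (-ν ^ 2 / 2) / Real.sqrt (2 * Real.pi)))}
      < Real.sqrt α) :
    ∃ ε > (0 : ℝ), ∃ N : ℕ, ∀ n ≥ N,
      1 - ENNReal.ofReal (Real.exp (-ε * n)) ≤
        matrixGaussian (⌈α * n⌉₊) n
          {A | ∀ x : Fin n → ℝ,
            (∀ i : Fin n, (i : ℕ) < n - ⌈β * n⌉₊ → x i = 0) → UniqueL1Min A x} := by
  obtain ⟨hα0, hα1⟩ := hα
  obtain ⟨hβ0, hβ1⟩ := hβ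
  obtain ⟨_, ⟨ν, hν, rfl⟩, hlt⟩ := exists_lt_of_csInf_lt (by exact ⟨_, 0, le_rfl, rfl⟩) hcond
  have hD := (Real.sqrt_lt_sqrt_iff_of_pos hα0).1 hlt
  rw [← E_plus, ← E_trunc ν hν] at hD
  exact final_aux α β ν hα0 hα1 hβ0 hβ1 hν hD
end

section
/- Let α, β ∈ (0,1). For c > 0 set γ̂ = (2c − √(4c² + 16α))/8 and I_sph(c,α) = γ̂ − (α/(2c))·log(1 − c/(2γ̂)). For c > 0, γ > c/2 and ν₁, ν₂ ≥ 0, let h be a standard normal random variable, let t(h) = max( (|h| + ν₁)²/(4γ) − ν₂ , (max(|h| − ν₁, 0))²/(4γ) + ν₂ ), I(c,γ,ν₁,ν₂) = E[ exp(c·t(h)) ], and I_str(c,β) = inf_{γ > c/2, ν₁ ≥ 0, ν₂ ≥ 0} ( ν₂(2β − 1) + γ + (1/c)·log I(c,γ,ν₁,ν₂) ). Assume there exists c > 0 with −c/2 + I_str(c,β) + I_sph(c,α) < 0. Then there exists ε > 0 such that for all sufficiently large n, with m = ⌈αn⌉, k = ⌈βn⌉, and A an m×n random matrix with i.i.d.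 standard normal entries, the probability is at least 1 − e^{−εn} that every x ∈ ℝ^n with at most k nonzero entries is the unique solution of the optimization problem: minimize ‖z‖₁ subject to Az = Ax. -/
open MeasureTheory ProbabilityTheory

/-- The spherical exponent `I_sph(c,α) = γ̂ − (α/(2c))·log(1 − c/(2γ̂))` with
`γ̂ = (2c − √(4c² + 16α))/8`. -/
noncomputable def Isph (c α : ℝ) : ℝ :=
  (2 * c - Real.sqrt (4 * c ^ 2 + 16 * α)) / 8 -
    (α / (2 * c)) * Real.log
      (1 - c / (2 * ((2 * c - Real.sqrt (4 * c ^ 2 + 16 * α)) / 8)))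

/-- `I(c,γ,ν₁,ν₂) = E[exp(c·t(h))]` for a standard normal `h`, where
`t(h) = max((|h|+ν₁)²/(4γ) − ν₂, (max(|h|−ν₁,0))²/(4γ) + ν₂)`. -/
noncomputable def Iexp (c γ ν₁ ν₂ : ℝ) : ℝ :=
  ∫ x : ℝ, Real.exp (c * max ((|x| + ν₁) ^ 2 / (4 * γ) - ν₂)
      ((max (|x| - ν₁) 0) ^ 2 / (4 * γ) + ν₂)) ∂(gaussianReal 0 1)

/-- `I_str(c,β)`: infimum over `γ > c/2`, `ν₁ ≥ 0`, `ν₂ ≥ 0`. -/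
noncomputable def Istr (c β : ℝ) : ℝ :=
  sInf {v : ℝ | ∃ γ ν₁ ν₂ : ℝ, c / 2 < γ ∧ 0 ≤ ν₁ ∧ 0 ≤ ν₂ ∧
    v = ν₂ * (2 * β - 1) + γ + (1 / c) * Real.log (Iexp c γ ν₁ ν₂)}

lemma stein1 (F F' : ℝ → ℝ) (C : ℝ) (hF : ∀ t, HasDerivAt F (F' t) t)
    (hb : ∀ t, |F t| ≤ C) (hb' : ∀ t, |F' t| ≤ C) (hc : Continuous F') :
    ∫ t, t * F t ∂(gaussianReal 0 1) = ∫ t, F' t ∂(gaussianReal 0 1) := by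
  have h1 : (1 : NNReal) ≠ 0 := one_ne_zero
  have hFc : Continuous F := continuous_iff_continuousAt.2 fun t => (hF t).continuousAt
  rw [integral_gaussianReal_eq_integral_smul h1, integral_gaussianReal_eq_integral_smul h1]
  simp only [smul_eq_mul]
  set p := gaussianPDFReal 0 1 with hp
  have hpd : ∀ t, HasDerivAt (fun t => - p t) (t * p t) t := by
    intro t
    have : p = fun x => (Real.sqrt (2 * Real.pi * 1))⁻¹ * Real.exp (-(x - 0)^2 / (2 * 1)) := by
      rw [hp]; ext x; simp [gaussianPDFReal]
    rw [this]
    have h2 : HasDerivAt (fun x : ℝ => -(x - 0)^2 / (2 * 1)) (-t) t := by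
      have := (((hasDerivAt_id t).sub_const 0).pow 2).neg.div_const (2*1)
      refine this.congr_deriv ?_
      simp; ring
    have := (h2.exp.const_mul (Real.sqrt (2 * Real.pi * 1))⁻¹).neg
    refine this.congr_deriv ?_
    ring
  have hpi : Integrable p := integrable_gaussianPDFReal 0 1
  have hpx : Integrable (fun t => t * p t) := by
    have := (memLp_id_gaussianReal (μ := 0) (v := 1) 1).integrable (by simp)
    rw [gaussianReal_of_var_ne_zero 0 h1,
      integrable_withDensity_iff_integrable_smul' (measurable_gaussianPDF 0 1)
        (by simp [gaussianPDF_lt_top])] at this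
    refine this.congr (Filter.Eventually.of_forall fun t => ?_)
    simp [toReal_gaussianPDF, hp, mul_comm]
  have hpm : AEStronglyMeasurable p := hpi.aestronglyMeasurable
  have key := integral_mul_deriv_eq_deriv_mul_of_integrable (u := F) (v := fun t => - p t)
    (u' := F') (v' := fun t => t * p t) (fun t _ => hF t) (fun t _ => hpd t) ?_ ?_ ?_
  · calc _ = ∫ x, F x * (x * p x) := by congr 1; ext; ring
      _ = _ := key
      _ = _ := by rw [← integral_neg]; congr 1; ext; ring
  · exact hpx.bdd_mul (c := C) hFc.aestronglyMeasurable
      (Filter.Eventually.of_forall hb)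
  · exact hpi.neg.bdd_mul (c := C) hc.aestronglyMeasurable
      (Filter.Eventually.of_forall hb')
  · exact hpi.neg.bdd_mul (c := C) hFc.aestronglyMeasurable
      (Filter.Eventually.of_forall hb)

noncomputable abbrev stdG (ι : Type) [Fintype ι] : Measure (ι → ℝ) :=
  Measure.pi fun _ => gaussianReal 0 1

lemma resample {ι : Type} [Fintype ι] [DecidableEq ι] (i : ι) :
    MeasurePreserving (fun q : (ι → ℝ) × ℝ => Function.update q.1 i q.2)
      ((stdG ι).prod (gaussianReal 0 1)) (stdG ι) := by
  have hm : Measurable (fun q : (ι → ℝ) × ℝ => Function.update q.1 i q.2) := by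
    rw [measurable_pi_iff]
    intro j
    by_cases h : j = i
    · subst h; simpa using measurable_snd
    · simp only [Function.update_of_ne h]; fun_prop
  refine ⟨hm, ?_⟩
  symm
  refine Measure.pi_eq fun s hs => ?_
  rw [Measure.map_apply hm (MeasurableSet.univ_pi hs)]
  have : (fun q : (ι → ℝ) × ℝ => Function.update q.1 i q.2) ⁻¹' (Set.univ.pi s)
      = (Set.univ.pi (Function.update s i Set.univ)) ×ˢ (s i) := by
    ext q
    simp only [Set.mem_preimage, Set.mem_pi, Set.mem_univ, true_imp_iff, Set.mem_prod]
    constructor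
    · intro h
      refine ⟨fun j => ?_, by simpa using h i⟩
      by_cases hj : j = i
      · subst hj; simp
      · simpa [hj] using h j
    · rintro ⟨h, h'⟩ j
      by_cases hj : j = i
      · subst hj; simpa using h'
      · simpa [hj] using h j
  rw [this, Measure.prod_prod, Measure.pi_pi]
  rw [← Finset.mul_prod_erase Finset.univ _ (Finset.mem_univ i),
    ← Finset.mul_prod_erase Finset.univ (fun j => gaussianReal 0 1 (s j)) (Finset.mem_univ i)]
  simp only [Function.update_self, measure_univ, one_mul]
  rw [mul_comm]
  congr 1
  refine Finset.prod_congr rfl fun j hj => ?_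
  rw [Function.update_of_ne (Finset.ne_of_mem_erase hj)]

lemma integrable_coord {ι : Type} [Fintype ι] (i : ι) :
    Integrable (fun x : ι → ℝ => x i) (stdG ι) := by
  have := (memLp_id_gaussianReal (μ := 0) (v := 1) 1).integrable (by simp)
  exact (measurePreserving_eval (fun _ : ι => gaussianReal 0 1) i).integrable_comp_of_integrable this

lemma steinN {ι : Type} [Fintype ι] [DecidableEq ι] (i : ι) (K K' : (ι → ℝ) → ℝ) (C : ℝ)
    (hK : ∀ x t, HasDerivAt (fun t => K (Function.update x i t)) (K' (Function.update x i t)) t)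
    (hb : ∀ x, |K x| ≤ C) (hb' : ∀ x, |K' x| ≤ C) (hc : Continuous K) (hc' : Continuous K') :
    ∫ x, x i * K x ∂(stdG ι) = ∫ x, K' x ∂(stdG ι) := by
  have hr := resample i
  have i1 : Integrable (fun x : ι → ℝ => x i * K x) (stdG ι) :=
    (integrable_coord i).mul_bdd (c := C) hc.aestronglyMeasurable
      (Filter.Eventually.of_forall hb)
  have i2 : Integrable K' (stdG ι) :=
    Integrable.of_bound hc'.aestronglyMeasurable C (Filter.Eventually.of_forall hb')
  have e : ∀ H : (ι → ℝ) → ℝ, Integrable H (stdG ι) → ∫ x, H x ∂(stdG ι) =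
      ∫ x, ∫ t, H (Function.update x i t) ∂(gaussianReal 0 1) ∂(stdG ι) := by
    intro H hH
    have h2 : Integrable (fun q : (ι → ℝ) × ℝ => H (Function.update q.1 i q.2))
      ((stdG ι).prod (gaussianReal 0 1)) := hr.integrable_comp_of_integrable hH
    rw [← integral_prod _ h2]
    conv_lhs => rw [← hr.map_eq]
    rw [integral_map hr.measurable.aemeasurable (by rw [hr.map_eq]; exact hH.aestronglyMeasurable)]
  rw [e _ i1, e _ i2]
  congr 1
  ext x
  simp only [Function.update_self]
  exact stein1 (fun t => K (Function.update x i t)) (fun t => K' (Function.update x i t)) C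
    (hK x) (fun _ => hb _) (fun _ => hb' _) (hc'.comp (by fun_prop))


lemma interp_deriv {ι J : Type} [Fintype ι] [DecidableEq ι] [Fintype J]
    (f : (J → ℝ) → ℝ) (D : J → (J → ℝ) → ℝ) (DD : J → J → (J → ℝ) → ℝ) (C : ℝ)
    (hf : ∀ z, HasFDerivAt f (∑ j, D j z • (ContinuousLinearMap.proj j : (J → ℝ) →L[ℝ] ℝ)) z)
    (hD : ∀ j z, HasFDerivAt (D j)
      (∑ k, DD j k z • (ContinuousLinearMap.proj k : (J → ℝ) →L[ℝ] ℝ)) z)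
    (hfb : ∀ z, |f z| ≤ C) (hDb : ∀ j z, |D j z| ≤ C) (hDDb : ∀ j k z, |DD j k z| ≤ C)
    (hDDc : ∀ j k, Continuous (DD j k))
    (P Q : J → ι → ℝ) (cross : ∀ j k, ∑ i, P j i * Q k i = 0) (φ : ℝ) :
    HasDerivAt (fun φ => ∫ G, f (fun j => ∑ i, (Real.sin φ * P j i + Real.cos φ * Q j i) * G i) ∂(stdG ι))
      (Real.sin φ * Real.cos φ * ∑ j, ∑ k, (∑ i, (P j i * P k i - Q j i * Q k i)) *
        ∫ G, DD j k (fun j => ∑ i, (Real.sin φ * P j i + Real.cos φ * Q j i) * G i) ∂(stdG ι)) φ := by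
  have hfc : Continuous f := continuous_iff_continuousAt.2 fun t => (hf t).continuousAt
  have hDc : ∀ j, Continuous (D j) :=
    fun j => continuous_iff_continuousAt.2 fun t => (hD j t).continuousAt
  set Z : ℝ → (ι → ℝ) → (J → ℝ) :=
    fun φ G j => ∑ i, (Real.sin φ * P j i + Real.cos φ * Q j i) * G i with hZ
  have hZc : ∀ φ, Continuous (Z φ) := fun φ => by rw [hZ]; fun_prop
  have h0C : 0 ≤ C := (abs_nonneg _).trans (hfb 0)
  have hZd : ∀ φ G, HasDerivAt (fun φ => Z φ G)
      (fun j => ∑ i, (Real.cos φ * P j i - Real.sin φ * Q j i) * G i) φ := by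
    intro φ G
    rw [hasDerivAt_pi]
    intro j
    refine HasDerivAt.fun_sum fun i _ => ?_
    refine HasDerivAt.mul_const ?_ _
    have := ((Real.hasDerivAt_sin φ).mul_const (P j i)).add ((Real.hasDerivAt_cos φ).mul_const (Q j i))
    refine this.congr_deriv ?_
    ring
  set bound : (ι → ℝ) → ℝ := fun G => ∑ j, C * ∑ i, (|P j i| + |Q j i|) * |G i| with hbound
  have h1 := hasDerivAt_integral_of_dominated_loc_of_deriv_le (μ := stdG ι) (bound := bound)
    (F := fun φ G => f (Z φ G)) (x₀ := φ) (s := Set.univ) Filter.univ_mem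
    (F' := fun φ G => ∑ j, D j (Z φ G) * ∑ i, (Real.cos φ * P j i - Real.sin φ * Q j i) * G i)
    (Filter.Eventually.of_forall fun φ => (hfc.comp (hZc φ)).aestronglyMeasurable)
    (Integrable.of_bound (hfc.comp (hZc φ)).aestronglyMeasurable C
      (Filter.Eventually.of_forall fun _ => hfb _))
    (by
      apply Continuous.aestronglyMeasurable
      refine continuous_finsetSum _ fun j _ => ?_
      refine ((hDc j).comp (hZc φ)).mul ?_
      fun_prop)
    (Filter.Eventually.of_forall fun G φ _ => by
      rw [Real.norm_eq_abs]
      refine (Finset.abs_sum_le_sum_abs _ _).trans (Finset.sum_le_sum fun j _ => ?_)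
      rw [abs_mul]
      refine mul_le_mul (hDb _ _) ?_ (abs_nonneg _) h0C
      refine (Finset.abs_sum_le_sum_abs _ _).trans (Finset.sum_le_sum fun i _ => ?_)
      rw [abs_mul]
      refine mul_le_mul_of_nonneg_right ?_ (abs_nonneg _)
      refine (abs_sub _ _).trans ?_
      rw [abs_mul, abs_mul]
      have := Real.abs_cos_le_one φ
      have := Real.abs_sin_le_one φ
      have := abs_nonneg (P j i)
      have := abs_nonneg (Q j i)
      nlinarith)
    (by
      rw [hbound]
      refine integrable_finsetSum _ fun j _ => ?_
      refine Integrable.const_mul ?_ _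
      refine integrable_finsetSum _ fun i _ => ?_
      exact (integrable_coord i).abs.const_mul _)
    (Filter.Eventually.of_forall fun G φ _ => by
      have := (hf (Z φ G)).comp_hasDerivAt φ (hZd φ G)
      refine this.congr_deriv ?_
      simp)
  refine h1.2.congr_deriv ?_
  have hst : ∀ i j, ∫ G, G i * D j (Z φ G) ∂(stdG ι) =
      ∑ k, (Real.sin φ * P k i + Real.cos φ * Q k i) * ∫ G, DD j k (Z φ G) ∂(stdG ι) := by
    intro i j
    have hi : ∀ k, Integrable (fun G => DD j k (Z φ G)) (stdG ι) := fun k =>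
      Integrable.of_bound ((hDDc j k).comp (hZc φ)).aestronglyMeasurable C
        (Filter.Eventually.of_forall fun _ => hDDb _ _ _)
    set K' : (ι → ℝ) → ℝ := fun G => ∑ k, (Real.sin φ * P k i + Real.cos φ * Q k i) * DD j k (Z φ G)
    set C' := C + ∑ k, |Real.sin φ * P k i + Real.cos φ * Q k i| * C
    have hC' : 0 ≤ ∑ k, |Real.sin φ * P k i + Real.cos φ * Q k i| * C := by positivity
    rw [steinN i (fun G => D j (Z φ G)) K' C']
    · rw [integral_finsetSum]
      · simp_rw [integral_const_mul]
      · intro k _; exact (hi k).const_mul _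
    · intro x t
      have hz : HasDerivAt (fun t => Z φ (Function.update x i t))
          (fun k => Real.sin φ * P k i + Real.cos φ * Q k i) t := by
        rw [hasDerivAt_pi]
        intro k
        have : ∀ i', HasDerivAt (fun t => (Real.sin φ * P k i' + Real.cos φ * Q k i') * Function.update x i t i')
            (if i' = i then (Real.sin φ * P k i' + Real.cos φ * Q k i') else 0) t := by
          intro i'
          by_cases h : i' = i
          · subst h
            simpa using (hasDerivAt_id t).const_mul (Real.sin φ * P k i' + Real.cos φ * Q k i')
          · simp only [Function.update_of_ne h, h, if_false]
            exact hasDerivAt_const _ _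
        refine (HasDerivAt.fun_sum fun i' _ => this i').congr_deriv ?_
        simp
      have := (hD j _).comp_hasDerivAt t hz
      refine this.congr_deriv ?_
      simp [K', mul_comm]
    · intro x; exact (hDb _ _).trans (by simp only [C']; linarith)
    · intro x
      have : |K' x| ≤ ∑ k, |Real.sin φ * P k i + Real.cos φ * Q k i| * C := by
        refine (Finset.abs_sum_le_sum_abs _ _).trans (Finset.sum_le_sum fun k _ => ?_)
        rw [abs_mul]
        exact mul_le_mul_of_nonneg_left (hDDb _ _ _) (abs_nonneg _)
      simp only [C']; linarith
    · exact (hDc j).comp (hZc φ)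
    · exact continuous_finsetSum _ fun k _ => continuous_const.mul ((hDDc j k).comp (hZc φ))
  have hint : ∀ i j, Integrable (fun G => G i * D j (Z φ G)) (stdG ι) := fun i j =>
    (integrable_coord i).mul_bdd (c := C) ((hDc j).comp (hZc φ)).aestronglyMeasurable
      (Filter.Eventually.of_forall fun _ => hDb _ _)
  have : ∀ G, ∑ j, D j (Z φ G) * ∑ i, (Real.cos φ * P j i - Real.sin φ * Q j i) * G i
     = ∑ j, ∑ i, (Real.cos φ * P j i - Real.sin φ * Q j i) * (G i * D j (Z φ G)) := by
    intro G
    refine Finset.sum_congr rfl fun j _ => ?_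
    rw [Finset.mul_sum]
    refine Finset.sum_congr rfl fun i _ => ?_
    ring
  simp only [this]
  rw [integral_finsetSum _ fun j _ => integrable_finsetSum _ fun i _ => (hint i j).const_mul _]
  rw [Finset.mul_sum]
  refine Finset.sum_congr rfl fun j _ => ?_
  rw [integral_finsetSum _ fun i _ => (hint i j).const_mul _]
  simp_rw [integral_const_mul, hst, Finset.mul_sum]
  rw [Finset.sum_comm]
  refine Finset.sum_congr rfl fun k _ => ?_
  have hx1 := cross j k
  have hx2 := cross k j
  set I := ∫ G, DD j k (Z φ G) ∂(stdG ι)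
  have : ∀ i, (Real.cos φ * P j i - Real.sin φ * Q j i) * ((Real.sin φ * P k i + Real.cos φ * Q k i) * I)
     = Real.sin φ * Real.cos φ * I * (P j i * P k i - Q j i * Q k i)
       + Real.cos φ ^ 2 * I * (P j i * Q k i) - Real.sin φ ^ 2 * I * (P k i * Q j i) := by
    intro i; ring
  simp_rw [this]
  rw [Finset.sum_sub_distrib, Finset.sum_add_distrib, ← Finset.mul_sum, ← Finset.mul_sum, ← Finset.mul_sum,
    hx1, hx2]
  ring

lemma interp_compare {ι J : Type} [Fintype ι] [DecidableEq ι] [Fintype J]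
    (f : (J → ℝ) → ℝ) (D : J → (J → ℝ) → ℝ) (DD : J → J → (J → ℝ) → ℝ) (C : ℝ)
    (hf : ∀ z, HasFDerivAt f (∑ j, D j z • (ContinuousLinearMap.proj j : (J → ℝ) →L[ℝ] ℝ)) z)
    (hD : ∀ j z, HasFDerivAt (D j)
      (∑ k, DD j k z • (ContinuousLinearMap.proj k : (J → ℝ) →L[ℝ] ℝ)) z)
    (hfb : ∀ z, |f z| ≤ C) (hDb : ∀ j z, |D j z| ≤ C) (hDDb : ∀ j k z, |DD j k z| ≤ C)
    (hDDc : ∀ j k, Continuous (DD j k))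
    (P Q : J → ι → ℝ) (cross : ∀ j k, ∑ i, P j i * Q k i = 0)
    (hpos : ∀ z, 0 ≤ ∑ j, ∑ k, (∑ i, (P j i * P k i - Q j i * Q k i)) * DD j k z) :
    ∫ G, f (fun j => ∑ i, Q j i * G i) ∂(stdG ι) ≤ ∫ G, f (fun j => ∑ i, P j i * G i) ∂(stdG ι) := by
  have hd := interp_deriv f D DD C hf hD hfb hDb hDDb hDDc P Q cross
  have hm := monotoneOn_of_deriv_nonneg (convex_Icc 0 (Real.pi / 2))
    (fun φ _ => (hd φ).continuousAt.continuousWithinAt)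
    (fun φ _ => (hd φ).differentiableAt.differentiableWithinAt)
    (by
      intro φ hφ
      rw [interior_Icc] at hφ
      rw [(hd φ).deriv]
      refine mul_nonneg (mul_nonneg ?_ ?_) ?_
      · exact Real.sin_nonneg_of_nonneg_of_le_pi hφ.1.le (by linarith [hφ.2, Real.pi_pos])
      · exact Real.cos_nonneg_of_neg_pi_div_two_le_of_le (by linarith [hφ.1, Real.pi_pos]) hφ.2.le
      · have hi : ∀ j k, Integrable (fun G : ι → ℝ => DD j k (fun j => ∑ i, (Real.sin φ * P j i + Real.cos φ * Q j i) * G i)) (stdG ι) := fun j k =>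
          Integrable.of_bound ((hDDc j k).comp (by fun_prop)).aestronglyMeasurable C
            (Filter.Eventually.of_forall fun _ => hDDb _ _ _)
        simp_rw [← integral_const_mul]
        simp_rw [← integral_finsetSum Finset.univ fun k _ => (hi _ k).const_mul _]
        rw [← integral_finsetSum Finset.univ fun j _ => integrable_finsetSum _ fun k _ => (hi j k).const_mul _]
        exact integral_nonneg fun G => hpos _)
  have := hm (Set.left_mem_Icc.2 (by positivity)) (Set.right_mem_Icc.2 (by positivity))
    (show (0:ℝ) ≤ Real.pi / 2 by positivity)
  simpa using this


lemma hasFDerivAt_slice {W κ : Type} [Fintype W] [Fintype κ] [DecidableEq W]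
    (τ : (κ → ℝ) → ℝ) (τ1 : κ → (κ → ℝ) → ℝ)
    (h1 : ∀ y, HasFDerivAt τ (∑ a, τ1 a y • (ContinuousLinearMap.proj a : (κ → ℝ) →L[ℝ] ℝ)) y)
    (w : W) (z : W × κ → ℝ) :
    HasFDerivAt (fun z : W × κ → ℝ => τ (fun a => z (w, a)))
      (∑ a, τ1 a (fun a => z (w, a)) • (ContinuousLinearMap.proj (w, a) : (W × κ → ℝ) →L[ℝ] ℝ)) z := by
  have hL : HasFDerivAt (fun z : W × κ → ℝ => (fun a => z (w, a)))
      (ContinuousLinearMap.pi fun a => (ContinuousLinearMap.proj (w, a) : (W × κ → ℝ) →L[ℝ] ℝ)) z :=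
    ContinuousLinearMap.hasFDerivAt (ContinuousLinearMap.pi fun a => (ContinuousLinearMap.proj (w, a) : (W × κ → ℝ) →L[ℝ] ℝ))
  have := (h1 _).comp z hL
  refine this.congr_fderiv ?_
  ext v
  simp

lemma prod_compare {ι W κ : Type} [Fintype ι] [DecidableEq ι] [Fintype W] [Fintype κ] [DecidableEq W]
    (τ : (κ → ℝ) → ℝ) (τ1 : κ → (κ → ℝ) → ℝ) (τ2 : κ → κ → (κ → ℝ) → ℝ) (C : ℝ)
    (h1 : ∀ y, HasFDerivAt τ (∑ a, τ1 a y • (ContinuousLinearMap.proj a : (κ → ℝ) →L[ℝ] ℝ)) y)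
    (h2 : ∀ a y, HasFDerivAt (τ1 a) (∑ b, τ2 a b y • (ContinuousLinearMap.proj b : (κ → ℝ) →L[ℝ] ℝ)) y)
    (hC : 1 ≤ C) (hb0 : ∀ y, 0 ≤ τ y) (hb : ∀ y, τ y ≤ 1) (hb1 : ∀ a y, |τ1 a y| ≤ C)
    (hb2 : ∀ a b y, |τ2 a b y| ≤ C) (hc2 : ∀ a b, Continuous (τ2 a b))
    (P Q : W × κ → ι → ℝ) (cross : ∀ j k, ∑ i, P j i * Q k i = 0)
    (hdiag : ∀ w a b, ∑ i, (P (w, a) i * P (w, b) i - Q (w, a) i * Q (w, b) i) = 0)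
    (hpos : ∀ w w' y y', w ≠ w' → 0 ≤ ∑ a, ∑ b, (∑ i, (P (w, a) i * P (w', b) i - Q (w, a) i * Q (w', b) i))
        * (τ1 a y * τ1 b y')) :
    ∫ G, ∏ w, τ (fun a => ∑ i, Q (w, a) i * G i) ∂(stdG ι) ≤
      ∫ G, ∏ w, τ (fun a => ∑ i, P (w, a) i * G i) ∂(stdG ι) := by
  have hτc : Continuous τ := continuous_iff_continuousAt.2 fun t => (h1 t).continuousAt
  have hτ1c : ∀ j, Continuous (τ1 j) :=
    fun j => continuous_iff_continuousAt.2 fun t => (h2 j t).continuousAt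
  have hpr0 : ∀ (s : Finset W) (z : W × κ → ℝ), 0 ≤ ∏ u ∈ s, τ (fun a => z (u, a)) :=
    fun s z => Finset.prod_nonneg fun _ _ => hb0 _
  have hpr1 : ∀ (s : Finset W) (z : W × κ → ℝ), ∏ u ∈ s, τ (fun a => z (u, a)) ≤ 1 :=
    fun s z => Finset.prod_le_one (fun _ _ => hb0 _) fun _ _ => hb _
  have hpra : ∀ (s : Finset W) (z : W × κ → ℝ), |∏ u ∈ s, τ (fun a => z (u, a))| ≤ 1 :=
    fun s z => by rw [abs_of_nonneg (hpr0 s z)]; exact hpr1 s z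
  have hprc : ∀ s : Finset W, Continuous fun z : W × κ → ℝ => ∏ u ∈ s, τ (fun a => z (u, a)) :=
    fun s => continuous_finsetProd _ fun u _ => hτc.comp (by fun_prop)
  have hprd : ∀ (s : Finset W) (z : W × κ → ℝ),
      HasFDerivAt (fun z : W × κ → ℝ => ∏ u ∈ s, τ (fun a => z (u, a)))
      (∑ w ∈ s, (∏ u ∈ s.erase w, τ (fun a => z (u, a))) •
        ∑ a, τ1 a (fun a => z (w, a)) • (ContinuousLinearMap.proj (w, a) : (W × κ → ℝ) →L[ℝ] ℝ)) z :=
    fun s z => HasFDerivAt.finsetProd fun w _ => hasFDerivAt_slice τ τ1 h1 w z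
  have key := interp_compare (ι := ι) (J := W × κ) (fun z => ∏ w, τ (fun a => z (w, a)))
    (fun j z => τ1 j.2 (fun a => z (j.1, a)) * ∏ u ∈ Finset.univ.erase j.1, τ (fun a => z (u, a)))
    (fun j k z => if k.1 = j.1 then
        τ2 j.2 k.2 (fun a => z (j.1, a)) * ∏ u ∈ Finset.univ.erase j.1, τ (fun a => z (u, a))
      else τ1 j.2 (fun a => z (j.1, a)) * τ1 k.2 (fun a => z (k.1, a)) *
        ∏ u ∈ (Finset.univ.erase j.1).erase k.1, τ (fun a => z (u, a))) (C * C)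
    ?_ ?_ ?_ ?_ ?_ ?_ P Q cross ?_
  · exact key
  · intro z
    refine (hprd Finset.univ z).congr_fderiv ?_
    ext v
    simp only [sum_apply, smul_apply, smul_eq_mul,
      ContinuousLinearMap.proj_apply, Fintype.sum_prod_type, Finset.mul_sum]
    refine Finset.sum_congr rfl fun w _ => Finset.sum_congr rfl fun a _ => ?_
    ring
  · rintro ⟨w, a⟩ z
    have := (hasFDerivAt_slice (τ1 a) (τ2 a) (h2 a) w z).mul (hprd (Finset.univ.erase w) z)
    refine this.congr_fderiv ?_
    ext v
    simp only [sum_apply, add_apply, smul_apply, smul_eq_mul,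
      ContinuousLinearMap.proj_apply, Fintype.sum_prod_type, Finset.mul_sum]
    rw [← Finset.add_sum_erase Finset.univ _ (Finset.mem_univ w), add_comm]
    congr 1
    · refine Finset.sum_congr rfl fun b _ => ?_
      simp; ring
    · refine Finset.sum_congr rfl fun w' hw' => Finset.sum_congr rfl fun b _ => ?_
      simp [Finset.ne_of_mem_erase hw']; ring
  · intro z; exact (hpra _ _).trans (by nlinarith)
  · intro j z
    rw [abs_mul]
    exact mul_le_mul (hb1 _ _) ((hpra _ _).trans hC) (abs_nonneg _) (by linarith)
  · intro j k z
    split_ifs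
    · rw [abs_mul]
      exact mul_le_mul (hb2 _ _ _) ((hpra _ _).trans hC) (abs_nonneg _) (by linarith)
    · rw [abs_mul, abs_mul]
      have := mul_le_mul (hb1 j.2 (fun a => z (j.1, a))) (hb1 k.2 (fun a => z (k.1, a))) (abs_nonneg _) (by linarith)
      calc _ ≤ C * C * 1 := mul_le_mul this (hpra _ _) (abs_nonneg _) (by nlinarith)
        _ = _ := mul_one _
  · intro j k
    split_ifs
    · exact ((hc2 _ _).comp (by fun_prop)).mul (hprc _)
    · exact (((hτ1c _).comp (by fun_prop)).mul ((hτ1c _).comp (by fun_prop))).mul (hprc _)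
  · intro z
    simp only [Fintype.sum_prod_type]
    refine Finset.sum_nonneg fun w _ => ?_
    rw [Finset.sum_comm]
    refine Finset.sum_nonneg fun w' _ => ?_
    by_cases h : w' = w
    · subst h
      simp [hdiag]
    · simp only [h, if_false]
      have := mul_nonneg (hpos w w' (fun a => z (w, a)) (fun a => z (w', a)) (Ne.symm h))
        (hpr0 ((Finset.univ.erase w).erase w') z)
      refine this.trans_eq ?_
      simp_rw [Finset.sum_mul]
      refine Finset.sum_congr rfl fun a _ => Finset.sum_congr rfl fun b _ =>
        Finset.sum_congr rfl fun i _ => ?_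
      ring


lemma exists_sigma (L : ℝ) : ∃ (s s1 s2 : ℝ → ℝ) (C : ℝ), 1 ≤ C ∧ (∀ x, HasDerivAt s (s1 x) x) ∧
    (∀ x, HasDerivAt s1 (s2 x) x) ∧ Continuous s2 ∧ (∀ x, |s1 x| ≤ C) ∧ (∀ x, |s2 x| ≤ C) ∧
    (∀ x, 0 ≤ s1 x) ∧ (∀ x, 0 ≤ s x) ∧ (∀ x, s x ≤ 1) ∧ (∀ x, x ≤ L → s x = 0) ∧
    (∀ x, L + 1 ≤ x → s x = 1) := by
  let s : ℝ → ℝ := fun x => Real.smoothTransition (x - L)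
  have hs : ContDiff ℝ 2 s := Real.smoothTransition.contDiff.comp (contDiff_id.sub contDiff_const)
  have hs1 : ContDiff ℝ 1 (deriv s) := by
    have h2 : ContDiff ℝ (1 + 1) s := hs
    exact (contDiff_succ_iff_deriv.1 h2).2.2
  have hs2 : Continuous (deriv (deriv s)) := hs1.continuous_deriv le_rfl
  have hd0 : ∀ x, HasDerivAt s (deriv s x) x := fun x =>
    ((hs.differentiable (by norm_num)) x).hasDerivAt
  have hd1 : ∀ x, HasDerivAt (deriv s) (deriv (deriv s) x) x := fun x =>
    ((hs1.differentiable (by norm_num)) x).hasDerivAt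
  have z0 : ∀ x, x < L → s =ᶠ[nhds x] fun _ => 0 := fun x hx => by
    filter_upwards [Iio_mem_nhds hx] with y hy
    exact Real.smoothTransition.zero_of_nonpos (by simp at hy; linarith)
  have z1 : ∀ x, L + 1 < x → s =ᶠ[nhds x] fun _ => 1 := fun x hx => by
    filter_upwards [Ioi_mem_nhds hx] with y hy
    exact Real.smoothTransition.one_of_one_le (by simp at hy; linarith)
  have c1 : ∀ x, x ∉ Set.Icc L (L + 1) → deriv s x = 0 := by
    intro x hx
    rw [Set.mem_Icc, not_and_or, not_le, not_le] at hx
    rcases hx with h | h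
    · rw [(z0 x h).deriv_eq]; simp
    · rw [(z1 x h).deriv_eq]; simp
  have c2 : ∀ x, x ∉ Set.Icc L (L + 1) → deriv (deriv s) x = 0 := by
    intro x hx
    have : deriv s =ᶠ[nhds x] fun _ => 0 := by
      filter_upwards [isClosed_Icc.isOpen_compl.mem_nhds hx] with y hy
      exact c1 y hy
    rw [this.deriv_eq]; simp
  obtain ⟨C1, hC1⟩ := (HasCompactSupport.intro isCompact_Icc c1).exists_bound_of_continuous hs1.continuous
  obtain ⟨C2, hC2⟩ := (HasCompactSupport.intro isCompact_Icc c2).exists_bound_of_continuous hs2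
  refine ⟨s, deriv s, deriv (deriv s), max 1 (max C1 C2), le_max_left _ _, hd0, hd1, hs2,
    fun x => (hC1 x).trans (by simp), fun x => (hC2 x).trans (by simp), fun x => ?_, fun x => Real.smoothTransition.nonneg _,
    fun x => Real.smoothTransition.le_one _, fun x hx => Real.smoothTransition.zero_of_nonpos (by linarith),
    fun x hx => Real.smoothTransition.one_of_one_le (by linarith)⟩
  apply Monotone.deriv_nonneg
  intro x y h
  exact Real.smoothTransition.monotone (by linarith)

noncomputable def NN {m : ℕ} (z : Option (Fin m) → ℝ) : ℝ := Real.sqrt (1 + ∑ a, z (some a) ^ 2)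

lemma NN_sq {m : ℕ} (z : Option (Fin m) → ℝ) : NN z ^ 2 = 1 + ∑ a, z (some a) ^ 2 :=
  Real.sq_sqrt (by positivity)

lemma NN_ge {m : ℕ} (z : Option (Fin m) → ℝ) : 1 ≤ NN z := by
  have : 0 ≤ ∑ a, z (some a) ^ 2 := by positivity
  exact Real.one_le_sqrt.2 (by linarith)

lemma NN_coord {m : ℕ} (z : Option (Fin m) → ℝ) (a : Fin m) : |z (some a)| ≤ NN z := by
  refine Real.abs_le_sqrt ?_
  have := Finset.single_le_sum (f := fun a => z (some a) ^ 2) (fun i _ => sq_nonneg _) (Finset.mem_univ a)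
  linarith

lemma NN_cont {m : ℕ} : Continuous (NN (m := m)) := by
  unfold NN; fun_prop

noncomputable def M1 {m : ℕ} (a : Option (Fin m)) (z : Option (Fin m) → ℝ) : ℝ :=
  match a with
  | none => 1
  | some a => z (some a) / NN z

noncomputable def M2 {m : ℕ} (a b : Option (Fin m)) (z : Option (Fin m) → ℝ) : ℝ :=
  match a, b with
  | none, _ => 0
  | some _, none => 0
  | some a, some b => (if a = b then 1 else 0) / NN z - z (some a) * z (some b) / NN z ^ 3

lemma M1_bd {m : ℕ} (a : Option (Fin m)) (z : Option (Fin m) → ℝ) : |M1 a z| ≤ 1 := by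
  rcases a with _ | a
  · simp [M1]
  · have := NN_ge z
    simp only [M1]
    rw [abs_div, abs_of_pos (by linarith : 0 < NN z), div_le_one (by linarith)]
    exact NN_coord z a

lemma M2_bd {m : ℕ} (a b : Option (Fin m)) (z : Option (Fin m) → ℝ) : |M2 a b z| ≤ 2 := by
  rcases a with _ | a
  · simp [M2]
  rcases b with _ | b
  · simp [M2]
  have h1 := NN_ge z
  have ha := M1_bd (some a) z
  have hb := M1_bd (some b) z
  have hi : |1 / NN z| ≤ 1 := by
    rw [abs_of_nonneg (by positivity)]
    exact (div_le_one (by linarith)).2 h1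
  have e : M2 (some a) (some b) z = (if a = b then 1 else 0) * (1 / NN z)
    - M1 (some a) z * M1 (some b) z * (1 / NN z) := by
    simp only [M2, M1]
    field_simp
  rw [e]
  refine (abs_sub _ _).trans ?_
  rw [abs_mul, abs_mul, abs_mul]
  have : |(if a = b then (1:ℝ) else 0)| ≤ 1 := by split_ifs <;> simp
  have h3 := mul_le_mul this hi (abs_nonneg _) zero_le_one
  have h4 := mul_le_mul (mul_le_mul ha hb (abs_nonneg _) zero_le_one) hi (abs_nonneg _) (by norm_num)
  linarith

lemma M1_cont {m : ℕ} (a : Option (Fin m)) : Continuous (M1 a) := by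
  rcases a with _ | a
  · exact continuous_const
  · exact (continuous_apply (some a)).div NN_cont fun z => by have := NN_ge z; positivity

lemma M2_cont {m : ℕ} (a b : Option (Fin m)) : Continuous (M2 a b) := by
  rcases a with _ | a
  · exact continuous_const
  rcases b with _ | b
  · exact continuous_const
  refine (continuous_const.div NN_cont fun z => ?_).sub
    (((continuous_apply (some a)).mul (continuous_apply (some b))).div (NN_cont.pow 3) fun z => ?_)
  · have := NN_ge z; positivity
  · have := NN_ge z; positivity

lemma NN_deriv {m : ℕ} (z : Option (Fin m) → ℝ) : HasFDerivAt NN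
    (∑ a : Fin m, (z (some a) / NN z) • (ContinuousLinearMap.proj (some a) : (Option (Fin m) → ℝ) →L[ℝ] ℝ)) z := by
  have h : HasFDerivAt (fun z : Option (Fin m) → ℝ => 1 + ∑ a : Fin m, z (some a) ^ 2)
     (∑ a : Fin m, (2 * z (some a)) • (ContinuousLinearMap.proj (some a) : (Option (Fin m) → ℝ) →L[ℝ] ℝ)) z := by
    refine HasFDerivAt.const_add _ (HasFDerivAt.fun_sum fun a _ => ?_)
    have := (hasFDerivAt_apply (𝕜 := ℝ) (some a) z).pow 2
    simpa using this
  have h1 := NN_ge z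
  have h0 := NN_sq z
  have := h.sqrt (by rw [← h0]; positivity)
  refine this.congr_fderiv ?_
  ext v
  have e : Real.sqrt (1 + ∑ a, z (some a) ^ 2) = NN z := rfl
  rw [e]
  simp only [sum_apply, smul_apply, smul_eq_mul, Finset.mul_sum]
  refine Finset.sum_congr rfl fun a _ => ?_
  field_simp

lemma M0_deriv {m : ℕ} (z : Option (Fin m) → ℝ) : HasFDerivAt (fun z => NN z + z none)
    (∑ a, M1 a z • (ContinuousLinearMap.proj a : (Option (Fin m) → ℝ) →L[ℝ] ℝ)) z := by
  refine ((NN_deriv z).add (hasFDerivAt_apply (𝕜 := ℝ) none z)).congr_fderiv ?_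
  rw [Fintype.sum_option, add_comm]
  simp [M1]

lemma M1_deriv {m : ℕ} (a : Option (Fin m)) (z : Option (Fin m) → ℝ) : HasFDerivAt (M1 a)
    (∑ b, M2 a b z • (ContinuousLinearMap.proj b : (Option (Fin m) → ℝ) →L[ℝ] ℝ)) z := by
  rcases a with _ | a
  · exact (hasFDerivAt_const (1:ℝ) z).congr_fderiv (by simp [M2])
  have h1 := NN_ge z
  have hn : NN z ≠ 0 := by positivity
  have hi := (hasDerivAt_inv hn).comp_hasFDerivAt z (NN_deriv z)
  have := (hasFDerivAt_apply (𝕜 := ℝ) (some a) z).mul hi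
  refine HasFDerivAt.congr_fderiv (f' := _) (this.congr_of_eventuallyEq ?_) ?_
  · refine Filter.Eventually.of_forall fun y => ?_
    simp [M1, div_eq_mul_inv]
  rw [Fintype.sum_option]
  ext v
  simp only [sum_apply, smul_apply, smul_eq_mul, add_apply, M2, Finset.mul_sum,
    ContinuousLinearMap.proj_apply, sub_mul, Finset.sum_sub_distrib, Function.comp]
  simp only [ite_div, ite_mul, zero_div, zero_mul, Finset.sum_ite_eq, Finset.mem_univ, if_true, zero_add]
  rw [add_comm, sub_eq_add_neg, ← Finset.sum_neg_distrib]
  congr 1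
  · field_simp
  · refine Finset.sum_congr rfl fun b _ => ?_
    field_simp


abbrev IX (m n : ℕ) : Type := (Fin m × Fin n) ⊕ (Unit ⊕ (Fin m ⊕ Fin n))

noncomputable def PP {m n : ℕ} {W : Type} (v : W → Fin n → ℝ) (j : W × Option (Fin m)) (i : IX m n) : ℝ :=
  match j, i with
  | (w, some a), Sum.inl (a', b) => if a = a' then v w b else 0
  | (_, none), Sum.inr (Sum.inl _) => 1
  | _, _ => 0

noncomputable def QQ {m n : ℕ} {W : Type} (v : W → Fin n → ℝ) (j : W × Option (Fin m)) (i : IX m n) : ℝ :=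
  match j, i with
  | (_, some a), Sum.inr (Sum.inr (Sum.inl a')) => if a = a' then 1 else 0
  | (w, none), Sum.inr (Sum.inr (Sum.inr b)) => v w b
  | _, _ => 0

lemma PPsum {m n : ℕ} {W : Type} (v : W → Fin n → ℝ) (w : W) (a : Fin m) (F : IX m n → ℝ) :
    ∑ i, PP v (w, some a) i * F i = ∑ b, v w b * F (Sum.inl (a, b)) := by
  simp [PP, Fintype.sum_sum_type, Fintype.sum_prod_type]

lemma PPsum' {m n : ℕ} {W : Type} (v : W → Fin n → ℝ) (w : W) (F : IX m n → ℝ) :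
    ∑ i, PP v (w, none) i * F i = F (Sum.inr (Sum.inl ())) := by
  simp [PP, Fintype.sum_sum_type]

lemma QQsum {m n : ℕ} {W : Type} (v : W → Fin n → ℝ) (w : W) (a : Fin m) (F : IX m n → ℝ) :
    ∑ i, QQ v (w, some a) i * F i = F (Sum.inr (Sum.inr (Sum.inl a))) := by
  simp [QQ, Fintype.sum_sum_type]

lemma QQsum' {m n : ℕ} {W : Type} (v : W → Fin n → ℝ) (w : W) (F : IX m n → ℝ) :
    ∑ i, QQ v (w, none) i * F i = ∑ b, v w b * F (Sum.inr (Sum.inr (Sum.inr b))) := by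
  simp [QQ, Fintype.sum_sum_type]

lemma covR {m n : ℕ} {W : Type} (v : W → Fin n → ℝ) (w w' : W) (a b : Option (Fin m)) :
    ∑ i, (PP v (w, a) i * PP v (w', b) i - QQ v (w, a) i * QQ v (w', b) i)
      = if a = b then (if a = none then 1 else -1) * (1 - ∑ b, v w b * v w' b) else 0 := by
  rw [Finset.sum_sub_distrib]
  rcases a with _ | a <;> rcases b with _ | b
  · rw [PPsum', QQsum']; simp [PP, QQ]
  · rw [PPsum', QQsum']; simp [PP, QQ]
  · rw [PPsum, QQsum]; simp [PP, QQ]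
  · rw [PPsum, QQsum]
    by_cases h : a = b
    · subst h; simp [PP, QQ]
    · simp [PP, QQ, h, Ne.symm h]

lemma gordon_pi {m n : ℕ} {W : Type} [Fintype W] [DecidableEq W] (v : W → Fin n → ℝ)
    (hv : ∀ w, ∑ b, v w b ^ 2 = 1) (s s1 s2 : ℝ → ℝ) (C : ℝ) (hC : 1 ≤ C)
    (h1 : ∀ x, HasDerivAt s (s1 x) x) (h2 : ∀ x, HasDerivAt s1 (s2 x) x) (hc2 : Continuous s2)
    (hb1 : ∀ x, |s1 x| ≤ C) (hb2 : ∀ x, |s2 x| ≤ C) (hp1 : ∀ x, 0 ≤ s1 x) (hp0 : ∀ x, 0 ≤ s x)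
    (hle : ∀ x, s x ≤ 1) :
    ∫ G : IX m n → ℝ, ∏ w, s (Real.sqrt (1 + ∑ a, G (Sum.inr (Sum.inr (Sum.inl a))) ^ 2)
        + ∑ b, v w b * G (Sum.inr (Sum.inr (Sum.inr b)))) ∂(stdG (IX m n)) ≤
    ∫ G : IX m n → ℝ, ∏ w, s (Real.sqrt (1 + ∑ a, (∑ b, v w b * G (Sum.inl (a, b))) ^ 2)
        + G (Sum.inr (Sum.inl ()))) ∂(stdG (IX m n)) := by
  have key := prod_compare (ι := IX m n) (W := W) (κ := Option (Fin m))
    (fun z => s (NN z + z none)) (fun a z => s1 (NN z + z none) * M1 a z)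
    (fun a b z => s2 (NN z + z none) * M1 b z * M1 a z + s1 (NN z + z none) * M2 a b z) (3 * C)
    ?_ ?_ (by linarith) (fun _ => hp0 _) (fun _ => hle _) ?_ ?_ ?_ (PP v) (QQ v) ?_ ?_ ?_
  · simpa only [NN, PPsum, PPsum', QQsum, QQsum'] using key
  · intro y
    refine ((h1 _).comp_hasFDerivAt y (M0_deriv y)).congr_fderiv ?_
    simp [Finset.smul_sum, smul_smul]
  · intro a y
    refine (((h2 _).comp_hasFDerivAt y (M0_deriv y)).mul (M1_deriv a y)).congr_fderiv ?_
    ext u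
    simp only [sum_apply, smul_apply, smul_eq_mul, add_apply, Finset.mul_sum, add_mul,
      Finset.sum_add_distrib, Function.comp]
    rw [add_comm]
    congr 1
    · refine Finset.sum_congr rfl fun b _ => ?_
      ring
    · refine Finset.sum_congr rfl fun b _ => ?_
      ring
  · intro a y
    rw [abs_mul]
    have := mul_le_mul (hb1 (NN y + y none)) (M1_bd a y) (abs_nonneg _) (by linarith)
    linarith
  · intro a b y
    refine (abs_add_le _ _).trans ?_
    rw [abs_mul, abs_mul, abs_mul]
    have e1 := mul_le_mul (mul_le_mul (hb2 (NN y + y none)) (M1_bd b y) (abs_nonneg _) (by linarith))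
      (M1_bd a y) (abs_nonneg _) (by linarith)
    have e2 := mul_le_mul (hb1 (NN y + y none)) (M2_bd a b y) (abs_nonneg _) (by linarith)
    linarith
  · intro a b
    have c0 : Continuous fun z : Option (Fin m) → ℝ => NN z + z none := NN_cont.add (by fun_prop)
    have c1 : Continuous s1 := continuous_iff_continuousAt.2 fun t => (h2 t).continuousAt
    exact (((hc2.comp c0).mul (M1_cont b)).mul (M1_cont a)).add ((c1.comp c0).mul (M2_cont a b))
  · rintro ⟨w, a⟩ ⟨w', b⟩
    rcases a with _ | a
    · rw [PPsum']; rcases b with _ | b <;> simp [QQ]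
    · rw [PPsum]; rcases b with _ | b <;> simp [QQ]
  · intro w a b
    rw [covR]
    simp [← pow_two, hv]
  · intro w w' y y' _
    simp_rw [covR]
    simp only [ite_mul, zero_mul, Finset.sum_ite_eq, Finset.mem_univ, if_true]
    rw [Fintype.sum_option]
    simp only [M1, if_true, reduceCtorEq, if_false]
    set x1 := s1 (NN y + y none)
    set x2 := s1 (NN y' + y' none)
    have hx1 : 0 ≤ x1 := hp1 _
    have hx2 : 0 ≤ x2 := hp1 _
    have hip : 0 ≤ 1 - ∑ b, v w b * v w' b := by
      have : 0 ≤ ∑ b, (v w b - v w' b) ^ 2 := by positivity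
      have e : ∑ b, (v w b - v w' b) ^ 2 = ∑ b, v w b ^ 2 + ∑ b, v w' b ^ 2 - 2 * ∑ b, v w b * v w' b := by
        rw [Finset.mul_sum, ← Finset.sum_add_distrib, ← Finset.sum_sub_distrib]
        refine Finset.sum_congr rfl fun b _ => ?_
        ring
      rw [e, hv, hv] at this
      linarith
    have n1 := NN_ge y
    have n2 := NN_ge y'
    have hcs : 0 ≤ 1 - ∑ a : Fin m, (y (some a) / NN y) * (y' (some a) / NN y') := by
      have q : ∀ z : Option (Fin m) → ℝ, ∑ a : Fin m, (z (some a) / NN z) ^ 2 ≤ 1 := by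
        intro z
        have := NN_ge z
        simp_rw [div_pow, ← Finset.sum_div]
        rw [div_le_one (by positivity), NN_sq]
        linarith
      have : ∑ a : Fin m, (y (some a) / NN y) * (y' (some a) / NN y') ≤
          ∑ a : Fin m, ((y (some a) / NN y) ^ 2 + (y' (some a) / NN y') ^ 2) / 2 :=
        Finset.sum_le_sum fun a _ => by nlinarith [sq_nonneg (y (some a) / NN y - y' (some a) / NN y')]
      rw [← Finset.sum_div, Finset.sum_add_distrib] at this
      linarith [q y, q y']
    have := mul_nonneg (mul_nonneg (mul_nonneg hx1 hx2) hip) hcs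
    refine this.trans_eq ?_
    rw [mul_sub, Finset.mul_sum, sub_eq_add_neg, ← Finset.sum_neg_distrib]
    congr 1
    · ring
    · refine Finset.sum_congr rfl fun a _ => ?_
      ring


abbrev OM (m n : ℕ) : Type := (Fin m → Fin n → ℝ) × (ℝ × ((Fin m → ℝ) × (Fin n → ℝ)))

noncomputable def muO (m n : ℕ) : Measure (OM m n) :=
  (matrixGaussian m n).prod ((gaussianReal 0 1).prod ((stdG (Fin m)).prod (stdG (Fin n))))

instance (m n : ℕ) : IsProbabilityMeasure (matrixGaussian m n) := by
  unfold matrixGaussian; infer_instance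

instance (m n : ℕ) : IsProbabilityMeasure (muO m n) := by
  unfold muO; infer_instance

def TT {m n : ℕ} (ω : OM m n) (i : IX m n) : ℝ :=
  match i with
  | Sum.inl (a, b) => ω.1 a b
  | Sum.inr (Sum.inl _) => ω.2.1
  | Sum.inr (Sum.inr (Sum.inl a)) => ω.2.2.1 a
  | Sum.inr (Sum.inr (Sum.inr b)) => ω.2.2.2 b

lemma TT_mp (m n : ℕ) : MeasurePreserving (TT (m := m) (n := n)) (muO m n) (stdG (IX m n)) := by
  have hm : Measurable (TT (m := m) (n := n)) := by
    rw [measurable_pi_iff]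
    rintro (⟨a, b⟩ | _ | a | b) <;> simp only [TT] <;> fun_prop
  refine ⟨hm, ?_⟩
  symm
  refine Measure.pi_eq fun s hs => ?_
  rw [Measure.map_apply hm (MeasurableSet.univ_pi hs)]
  have : TT (m := m) (n := n) ⁻¹' (Set.univ.pi s) =
     (Set.univ.pi fun a => Set.univ.pi fun b => s (Sum.inl (a, b))) ×ˢ
      ((s (Sum.inr (Sum.inl ()))) ×ˢ ((Set.univ.pi fun a => s (Sum.inr (Sum.inr (Sum.inl a)))) ×ˢ
        (Set.univ.pi fun b => s (Sum.inr (Sum.inr (Sum.inr b)))))) := by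
    ext ω
    simp only [Set.mem_preimage, Set.mem_pi, TT, Set.mem_prod, Sum.forall, Prod.forall, Set.mem_univ, true_imp_iff]
    exact Iff.and Iff.rfl (Iff.and ⟨fun h => h (), fun h _ => h⟩ Iff.rfl)
  rw [this, muO, Measure.prod_prod, Measure.prod_prod, Measure.prod_prod, matrixGaussian, Measure.pi_pi]
  simp_rw [Measure.pi_pi]
  simp [Fintype.prod_sum_type, Fintype.prod_prod_type]

lemma gordon_prob {m n : ℕ} {W : Type} [Fintype W] [DecidableEq W] (v : W → Fin n → ℝ)
    (hv : ∀ w, ∑ b, v w b ^ 2 = 1) (a : ℝ) :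
    (matrixGaussian m n).real {A | ∃ w, ∑ i, (∑ b, v w b * A i b) ^ 2 < 1} *
      (gaussianReal 0 1).real (Set.Iic (-a)) ≤
    ((stdG (Fin m)).prod (stdG (Fin n))).real
      {q | ∃ w, Real.sqrt (∑ i, q.1 i ^ 2) + ∑ b, v w b * q.2 b ≤ 3 - a} := by
  obtain ⟨s, s1, s2, C, hC, h1, h2, hc2, hb1, hb2, hp1, hp0, hle, hs0, hs1⟩ := exists_sigma (2 - a)
  have key := gordon_pi (m := m) v hv s s1 s2 C hC h1 h2 hc2 hb1 hb2 hp1 hp0 hle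
  have hsc : Continuous s := continuous_iff_continuousAt.2 fun t => (h1 t).continuousAt
  have mp := TT_mp m n
  have tr : ∀ H : (IX m n → ℝ) → ℝ, Continuous H → ∫ G, H G ∂(stdG (IX m n)) = ∫ ω, H (TT ω) ∂(muO m n) := by
    intro H hH
    rw [← mp.map_eq, integral_map mp.measurable.aemeasurable hH.aestronglyMeasurable]
  rw [tr _ (by fun_prop), tr _ (by fun_prop)] at key
  set E : Set (Fin m → Fin n → ℝ) := {A | ∃ w, ∑ i, (∑ b, v w b * A i b) ^ 2 < 1}
  set F : Set ((Fin m → ℝ) × (Fin n → ℝ)) :=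
    {q | ∃ w, Real.sqrt (∑ i, q.1 i ^ 2) + ∑ b, v w b * q.2 b ≤ 3 - a}
  have hE : MeasurableSet E := by
    have : E = ⋃ w, {A | ∑ i, (∑ b, v w b * A i b) ^ 2 < 1} := by ext; simp [E]
    rw [this]
    exact MeasurableSet.iUnion fun w => measurableSet_lt (by fun_prop) (by fun_prop)
  have hF : MeasurableSet F := by
    have : F = ⋃ w, {q | Real.sqrt (∑ i, q.1 i ^ 2) + ∑ b, v w b * q.2 b ≤ 3 - a} := by ext; simp [F]
    rw [this]
    exact MeasurableSet.iUnion fun w => measurableSet_le (by fun_prop) (by fun_prop)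
  set E' : Set (OM m n) := E ×ˢ (Set.Iic (-a) ×ˢ Set.univ)
  set F' : Set (OM m n) := Set.univ ×ˢ (Set.univ ×ˢ F)
  have hE' : MeasurableSet E' := hE.prod (measurableSet_Iic.prod MeasurableSet.univ)
  have hF' : MeasurableSet F' := MeasurableSet.univ.prod (MeasurableSet.univ.prod hF)
  have eE : (muO m n).real E' = (matrixGaussian m n).real E * (gaussianReal 0 1).real (Set.Iic (-a)) := by
    simp [E', muO, measureReal_prod_prod]
  have eF : (muO m n).real F' = ((stdG (Fin m)).prod (stdG (Fin n))).real F := by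
    simp [F', muO, measureReal_prod_prod]
  rw [← eE, ← eF]
  have iE : ∫ ω, (1 - E'.indicator 1 ω) ∂(muO m n) = 1 - (muO m n).real E' := by
    have hi : Integrable (E'.indicator (1 : OM m n → ℝ)) (muO m n) := (integrable_const (1:ℝ)).indicator hE'
    rw [integral_sub (integrable_const _) hi, integral_indicator_one hE']
    simp
  have iF : ∫ ω, (1 - F'.indicator 1 ω) ∂(muO m n) = 1 - (muO m n).real F' := by
    have hi : Integrable (F'.indicator (1 : OM m n → ℝ)) (muO m n) := (integrable_const (1:ℝ)).indicator hF'
    rw [integral_sub (integrable_const _) hi, integral_indicator_one hF']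
    simp
  have hI : ∀ (s' : W → OM m n → ℝ), (∀ w, Continuous (s' w)) →
      Integrable (fun ω => ∏ w, s (s' w ω)) (muO m n) := by
    intro s' hs'
    refine Integrable.of_bound (C := 1) ?_ (Filter.Eventually.of_forall fun ω => ?_)
    · exact (continuous_finsetProd _ fun w _ => hsc.comp (hs' w)).aestronglyMeasurable
    · rw [Real.norm_eq_abs, abs_of_nonneg (Finset.prod_nonneg fun _ _ => hp0 _)]
      exact Finset.prod_le_one (fun _ _ => hp0 _) fun _ _ => hle _
  simp only [TT] at key
  have uE : ∫ ω : OM m n, ∏ w, s (Real.sqrt (1 + ∑ i, (∑ b, v w b * ω.1 i b) ^ 2) + ω.2.1) ∂(muO m n)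
      ≤ ∫ ω, (1 - E'.indicator 1 ω) ∂(muO m n) := by
    refine integral_mono (hI _ fun w => by fun_prop)
      ((integrable_const _).sub ((integrable_const (1:ℝ)).indicator hE')) fun ω => ?_
    by_cases h : ω ∈ E'
    · obtain ⟨w, hw⟩ := h.1
      have h2 : ω.2.1 ≤ -a := h.2.1
      have h3 : Real.sqrt (1 + ∑ i, (∑ b, v w b * ω.1 i b) ^ 2) ≤ 2 := by
        rw [Real.sqrt_le_left (by norm_num)]; linarith
      have : ∏ w, s (Real.sqrt (1 + ∑ i, (∑ b, v w b * ω.1 i b) ^ 2) + ω.2.1) = 0 :=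
        Finset.prod_eq_zero (Finset.mem_univ w) (hs0 _ (by linarith))
      simp [this, h]
    · simp only [h, not_false_eq_true, Set.indicator_of_notMem, sub_zero]
      exact Finset.prod_le_one (fun _ _ => hp0 _) fun _ _ => hle _
  have uF : ∫ ω, (1 - F'.indicator 1 ω) ∂(muO m n) ≤
      ∫ ω : OM m n, ∏ w, s (Real.sqrt (1 + ∑ i, ω.2.2.1 i ^ 2) + ∑ b, v w b * ω.2.2.2 b) ∂(muO m n) := by
    refine integral_mono ((integrable_const _).sub ((integrable_const (1:ℝ)).indicator hF'))
      (hI _ fun w => by fun_prop) fun ω => ?_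
    by_cases h : ω ∈ F'
    · simp only [h, Set.indicator_of_mem, Pi.one_apply, sub_self]
      exact Finset.prod_nonneg fun _ _ => hp0 _
    · have h' : ω.2.2 ∉ F := fun hh => h ⟨trivial, trivial, hh⟩
      have : ∏ w, s (Real.sqrt (1 + ∑ i, ω.2.2.1 i ^ 2) + ∑ b, v w b * ω.2.2.2 b) = 1 := by
        refine Finset.prod_eq_one fun w _ => hs1 _ ?_
        have h3 : 3 - a < Real.sqrt (∑ i, ω.2.2.1 i ^ 2) + ∑ b, v w b * ω.2.2.2 b := by
          by_contra h4
          exact h' ⟨w, not_lt.1 h4⟩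
        have : Real.sqrt (∑ i, ω.2.2.1 i ^ 2) ≤ Real.sqrt (1 + ∑ i, ω.2.2.1 i ^ 2) :=
          Real.sqrt_le_sqrt (by linarith)
        linarith
      simp [this, h]
  linarith


noncomputable def tf (γ ν₁ ν₂ x : ℝ) : ℝ :=
  max ((|x| + ν₁) ^ 2 / (4 * γ) - ν₂) ((max (|x| - ν₁) 0) ^ 2 / (4 * γ) + ν₂)

lemma det_bound_s15 {n : ℕ} (γ ν₁ ν₂ : ℝ) (hγ : 0 < γ) (h1 : 0 ≤ ν₁) (h2 : 0 ≤ ν₂) (k : ℕ)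
    (v : Fin n → ℝ) (hv : ∑ b, v b ^ 2 = 1) (K : Finset (Fin n)) (hK : K.card ≤ k)
    (hS : ∑ i ∈ Kᶜ, |v i| ≤ ∑ i ∈ K, |v i|) (h : Fin n → ℝ) :
    Real.sqrt n * (-∑ b, v b * h b) ≤ n * γ + ν₂ * (2 * k - n) + ∑ i, tf γ ν₁ ν₂ (h i) := by
  set r := Real.sqrt n with hr
  have hr0 : 0 ≤ r := Real.sqrt_nonneg _
  have hrr : r ^ 2 = n := Real.sq_sqrt (Nat.cast_nonneg n)
  have q : ∀ p u : ℝ, p * u - γ * u ^ 2 ≤ p ^ 2 / (4 * γ) := by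
    intro p u
    rw [le_div_iff₀ (by positivity)]
    nlinarith [sq_nonneg (p - 2 * γ * u)]
  have A : ∀ i, -(r * (v i * h i)) ≤ |h i| * (r * |v i|) := by
    intro i
    refine (neg_le_abs _).trans_eq ?_
    rw [abs_mul, abs_mul, abs_of_nonneg hr0]; ring
  have B : ∀ i, (r * |v i|) ^ 2 = n * v i ^ 2 := by
    intro i; rw [mul_pow, hrr, sq_abs]
  have c1 : ∀ i ∈ K, -(r * (v i * h i)) ≤ tf γ ν₁ ν₂ (h i) + ν₂ - ν₁ * (r * |v i|) + γ * (n * v i ^ 2) := by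
    intro i _
    have := q (|h i| + ν₁) (r * |v i|)
    have h3 : (|h i| + ν₁) ^ 2 / (4 * γ) - ν₂ ≤ tf γ ν₁ ν₂ (h i) := le_max_left _ _
    rw [← B]
    linarith [A i]
  have c2 : ∀ i ∈ Kᶜ, -(r * (v i * h i)) ≤ tf γ ν₁ ν₂ (h i) - ν₂ + ν₁ * (r * |v i|) + γ * (n * v i ^ 2) := by
    intro i _
    have := q (max (|h i| - ν₁) 0) (r * |v i|)
    have h3 : (max (|h i| - ν₁) 0) ^ 2 / (4 * γ) + ν₂ ≤ tf γ ν₁ ν₂ (h i) := le_max_right _ _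
    have h4 : (|h i| - ν₁) * (r * |v i|) ≤ max (|h i| - ν₁) 0 * (r * |v i|) :=
      mul_le_mul_of_nonneg_right (le_max_left _ _) (by positivity)
    rw [← B]
    linarith [A i]
  have s1 := Finset.sum_le_sum c1
  have s2 := Finset.sum_le_sum c2
  have e0 := Finset.sum_add_sum_compl K (fun i => -(r * (v i * h i)))
  have e1 := Finset.sum_add_sum_compl K (fun i => tf γ ν₁ ν₂ (h i))
  have e2 := Finset.sum_add_sum_compl K (fun i => v i ^ 2)
  have cc : (Kᶜ.card : ℝ) = n - K.card := by
    have := Finset.card_add_card_compl K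
    rw [Fintype.card_fin] at this
    have : (K.card : ℝ) + Kᶜ.card = n := by exact_mod_cast this
    linarith
  simp only [Finset.sum_add_distrib, Finset.sum_sub_distrib, ← Finset.mul_sum, Finset.sum_const,
    nsmul_eq_mul, cc] at s1 s2
  rw [hv] at e2
  have e3 : ∑ i, -(r * (v i * h i)) = r * (-∑ b, v b * h b) := by
    rw [Finset.sum_neg_distrib, ← Finset.mul_sum]; ring
  rw [e3] at e0
  have hKr : (K.card : ℝ) ≤ k := by exact_mod_cast hK
  have p1 := mul_le_mul_of_nonneg_left hS (mul_nonneg h1 hr0)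
  have p2 := mul_le_mul_of_nonneg_left hKr h2
  have e4 : γ * (n * ∑ i ∈ K, v i ^ 2) + γ * (n * ∑ i ∈ Kᶜ, v i ^ 2) = n * γ := by
    rw [← mul_add, ← mul_add, e2]; ring
  nlinarith

lemma tf_nonneg (γ ν₁ ν₂ x : ℝ) (hγ : 0 < γ) (h2 : 0 ≤ ν₂) : 0 ≤ tf γ ν₁ ν₂ x :=
  le_trans (by positivity) (le_max_right _ _)

lemma tf_cont (γ ν₁ ν₂ : ℝ) : Continuous (tf γ ν₁ ν₂) := by
  unfold tf; fun_prop

lemma gauss_int_iff (f : ℝ → ℝ) : Integrable f (gaussianReal 0 1) ↔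
    Integrable (fun x => gaussianPDFReal 0 1 x * f x) := by
  rw [gaussianReal_of_var_ne_zero 0 one_ne_zero,
      integrable_withDensity_iff_integrable_smul' (measurable_gaussianPDF 0 1)
        (by simp [gaussianPDF_lt_top])]
  simp [toReal_gaussianPDF]

lemma pdf_eq (x : ℝ) : gaussianPDFReal 0 1 x = (Real.sqrt (2 * Real.pi))⁻¹ * Real.exp (-(x ^ 2 / 2)) := by
  simp [gaussianPDFReal, neg_div]

lemma integrable_exp_sq (κ : ℝ) (h : κ < 1 / 2) :
    Integrable (fun x : ℝ => Real.exp (κ * x ^ 2)) (gaussianReal 0 1) := by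
  rw [gauss_int_iff]
  have := (integrable_exp_neg_mul_sq (b := 1 / 2 - κ) (by linarith)).const_mul (Real.sqrt (2 * Real.pi))⁻¹
  refine this.congr (Filter.Eventually.of_forall fun x => ?_)
  simp only [pdf_eq]
  rw [mul_assoc, ← Real.exp_add]
  congr 2; ring

lemma integral_exp_sq (t : ℝ) (h : 0 ≤ t) :
    ∫ x : ℝ, Real.exp (-(t * x ^ 2)) ∂(gaussianReal 0 1) = Real.exp (-(Real.log (1 + 2 * t) / 2)) := by
  rw [integral_gaussianReal_eq_integral_smul one_ne_zero]
  have : ∀ x : ℝ, gaussianPDFReal 0 1 x • Real.exp (-(t * x ^ 2)) =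
      (Real.sqrt (2 * Real.pi))⁻¹ * Real.exp (-(1 / 2 + t) * x ^ 2) := by
    intro x
    rw [pdf_eq, smul_eq_mul, mul_assoc, ← Real.exp_add]
    congr 2; ring
  simp_rw [this]
  rw [integral_const_mul, integral_gaussian, ← Real.sqrt_inv, ← Real.sqrt_mul (by positivity)]
  have e : (2 * Real.pi)⁻¹ * (Real.pi / (1 / 2 + t)) = (1 + 2 * t)⁻¹ := by
    have := Real.pi_pos
    field_simp
    try ring
  have h1 : 0 < 1 + 2 * t := by linarith
  rw [e, Real.sqrt_eq_rpow, Real.rpow_def_of_pos (by positivity), Real.log_inv]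
  congr 1; ring

lemma integrable_tf (c γ ν₁ ν₂ : ℝ) (hc : 0 < c) (hγ : c / 2 < γ) (h1 : 0 ≤ ν₁) (h2 : 0 ≤ ν₂) :
    Integrable (fun x => Real.exp (c * tf γ ν₁ ν₂ x)) (gaussianReal 0 1) := by
  have hγ0 : 0 < γ := by linarith
  obtain ⟨η, hη0, hη⟩ : ∃ η : ℝ, 0 < η ∧ c / (4 * γ) * (1 + η) < 1 / 2 := by
    refine ⟨(2 * γ / c - 1) / 2, ?_, ?_⟩
    · have : 1 < 2 * γ / c := by rw [lt_div_iff₀ hc]; linarith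
      linarith
    · have e : c / (4 * γ) * (1 + (2 * γ / c - 1) / 2) = c / (8 * γ) + 1 / 4 := by
        field_simp; ring
      rw [e]
      have : c / (8 * γ) < 1 / 4 := by rw [div_lt_iff₀ (by positivity)]; linarith
      linarith
  have hi := (integrable_exp_sq _ hη).const_mul
    (Real.exp (c / (4 * γ) * ((1 + 1 / η) * ν₁ ^ 2) + c * ν₂))
  refine hi.mono' ((Real.continuous_exp.comp (continuous_const.mul (tf_cont _ _ _))).aestronglyMeasurable)
    (Filter.Eventually.of_forall fun x => ?_)
  rw [Real.norm_eq_abs, Real.abs_exp, ← Real.exp_add, Real.exp_le_exp]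
  have b1 : tf γ ν₁ ν₂ x ≤ (|x| + ν₁) ^ 2 / (4 * γ) + ν₂ := by
    refine max_le (by linarith) ?_
    have : max (|x| - ν₁) 0 ≤ |x| + ν₁ := max_le (by linarith) (by positivity)
    have : (max (|x| - ν₁) 0) ^ 2 ≤ (|x| + ν₁) ^ 2 := pow_le_pow_left₀ (le_max_right _ _) this 2
    have := div_le_div_of_nonneg_right this (by positivity : 0 ≤ 4 * γ)
    linarith
  have b2 : (|x| + ν₁) ^ 2 ≤ (1 + η) * x ^ 2 + (1 + 1 / η) * ν₁ ^ 2 := by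
    have : 2 * (|x| * ν₁) ≤ η * x ^ 2 + 1 / η * ν₁ ^ 2 := by
      have hq := sq_nonneg (η * |x| - ν₁)
      rw [← sq_abs x]
      have : η * (2 * (|x| * ν₁)) ≤ η * (η * |x| ^ 2 + 1 / η * ν₁ ^ 2) := by
        have : η * (η * |x| ^ 2 + 1 / η * ν₁ ^ 2) = η ^ 2 * |x| ^ 2 + ν₁ ^ 2 := by field_simp
        rw [this]; nlinarith
      exact le_of_mul_le_mul_left this hη0
    rw [add_sq, sq_abs]; linarith
  calc c * tf γ ν₁ ν₂ x ≤ c * ((|x| + ν₁) ^ 2 / (4 * γ) + ν₂) := mul_le_mul_of_nonneg_left b1 hc.le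
    _ = c / (4 * γ) * (|x| + ν₁) ^ 2 + c * ν₂ := by ring
    _ ≤ c / (4 * γ) * ((1 + η) * x ^ 2 + (1 + 1 / η) * ν₁ ^ 2) + c * ν₂ := by gcongr
    _ = _ := by ring

lemma Iexp_ge (c γ ν₁ ν₂ : ℝ) (hc : 0 < c) (hγ : c / 2 < γ) (h1 : 0 ≤ ν₁) (h2 : 0 ≤ ν₂) :
    1 ≤ Iexp c γ ν₁ ν₂ := by
  have h := integral_mono (μ := gaussianReal 0 1) (integrable_const (1:ℝ)) (integrable_tf c γ ν₁ ν₂ hc hγ h1 h2)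
    (fun x => Real.one_le_exp (mul_nonneg hc.le (tf_nonneg γ ν₁ ν₂ x (by linarith) h2)))
  simpa [Iexp, tf] using h

lemma gauss_tail (a : ℝ) (ha : 0 ≤ a) :
    (Real.sqrt (2 * Real.pi))⁻¹ * Real.exp (-((a + 1) ^ 2 / 2)) ≤ (gaussianReal 0 1).real (Set.Iic (-a)) := by
  have h0 : (gaussianReal 0 1).real (Set.Icc (-a - 1) (-a)) ≤ (gaussianReal 0 1).real (Set.Iic (-a)) :=
    measureReal_mono (fun x hx => hx.2)
  refine le_trans ?_ h0
  rw [Measure.real, gaussianReal_apply_eq_integral 0 one_ne_zero,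
    ENNReal.toReal_ofReal (integral_nonneg fun x => gaussianPDFReal_nonneg _ _ _)]
  have := setIntegral_mono_on (μ := volume) (s := Set.Icc (-a - 1) (-a))
    (f := fun _ => (Real.sqrt (2 * Real.pi))⁻¹ * Real.exp (-((a + 1) ^ 2 / 2)))
    (g := gaussianPDFReal 0 1) continuous_const.integrableOn_Icc
    (integrable_gaussianPDFReal 0 1).integrableOn measurableSet_Icc
    (fun x hx => by
      rw [pdf_eq]
      refine mul_le_mul_of_nonneg_left (Real.exp_le_exp.2 ?_) (by positivity)
      have : x ^ 2 ≤ (a + 1) ^ 2 := sq_le_sq' (by linarith [hx.1]) (by linarith [hx.2])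
      linarith)
  refine le_trans (le_of_eq ?_) this
  simp

lemma F_bound {m n : ℕ} {W : Type} (c γ ν₁ ν₂ : ℝ) (hc : 0 < c) (hγ : c / 2 < γ) (h1 : 0 ≤ ν₁)
    (h2 : 0 ≤ ν₂) (k : ℕ) (v : W → Fin n → ℝ) (hv : ∀ w, ∑ b, v w b ^ 2 = 1)
    (hS : ∀ w, ∃ K : Finset (Fin n), K.card ≤ k ∧ ∑ i ∈ Kᶜ, |v w i| ≤ ∑ i ∈ K, |v w i|) :
    ((stdG (Fin m)).prod (stdG (Fin n))).real
      {q | ∃ w, Real.sqrt (∑ i, q.1 i ^ 2) + ∑ b, v w b * q.2 b ≤ 3 - c * Real.sqrt n} ≤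
    Real.exp (c * Real.sqrt n * (3 - c * Real.sqrt n) + c * (n * γ + ν₂ * (2 * k - n))) *
      (∫ g, Real.exp (-(c * Real.sqrt n * Real.sqrt (∑ i, g i ^ 2))) ∂(stdG (Fin m))) *
      Iexp c γ ν₁ ν₂ ^ n := by
  set F := {q : (Fin m → ℝ) × (Fin n → ℝ) | ∃ w, Real.sqrt (∑ i, q.1 i ^ 2) + ∑ b, v w b * q.2 b ≤ 3 - c * Real.sqrt n}
  set a := c * Real.sqrt n with ha
  have ha0 : 0 ≤ a := by positivity
  set H : (Fin m → ℝ) × (Fin n → ℝ) → ℝ := fun q =>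
    Real.exp (-(a * Real.sqrt (∑ i, q.1 i ^ 2))) * ∏ i, Real.exp (c * tf γ ν₁ ν₂ (q.2 i)) with hH
  have hHint : Integrable H ((stdG (Fin m)).prod (stdG (Fin n))) := by
    refine Integrable.mul_prod (f := fun g : Fin m → ℝ => Real.exp (-(a * Real.sqrt (∑ i, g i ^ 2))))
      (g := fun h : Fin n → ℝ => ∏ i, Real.exp (c * tf γ ν₁ ν₂ (h i))) ?_ ?_
    · refine Integrable.of_bound (C := 1) (Continuous.aestronglyMeasurable (by fun_prop))
        (Filter.Eventually.of_forall fun g => ?_)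
      rw [Real.norm_eq_abs, Real.abs_exp, Real.exp_le_one_iff]
      have := mul_nonneg ha0 (Real.sqrt_nonneg (∑ i, g i ^ 2))
      linarith
    · exact Integrable.fintype_prod fun i => integrable_tf c γ ν₁ ν₂ hc hγ h1 h2
  have hHval : ∫ q, H q ∂((stdG (Fin m)).prod (stdG (Fin n))) =
      (∫ g, Real.exp (-(a * Real.sqrt (∑ i, g i ^ 2))) ∂(stdG (Fin m))) * Iexp c γ ν₁ ν₂ ^ n := by
    rw [hH, integral_prod_mul (fun g : Fin m → ℝ => Real.exp (-(a * Real.sqrt (∑ i, g i ^ 2))))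
      (fun h : Fin n → ℝ => ∏ i, Real.exp (c * tf γ ν₁ ν₂ (h i)))]
    congr 1
    rw [integral_fintype_prod_eq_pow (fun x => Real.exp (c * tf γ ν₁ ν₂ x)), Fintype.card_fin]
    rfl
  set B := Real.exp (a * (3 - a) + c * (n * γ + ν₂ * (2 * k - n)))
  have hF : MeasurableSet {q | 1 ≤ B * H q} :=
    measurableSet_le measurable_const (by
      apply Continuous.measurable
      refine continuous_const.mul ?_
      have := tf_cont γ ν₁ ν₂
      fun_prop)
  have sub : F ⊆ {q | 1 ≤ B * H q} := by
    rintro q ⟨w, hw⟩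
    obtain ⟨K, hK, hS'⟩ := hS w
    have d := det_bound_s15 γ ν₁ ν₂ (by linarith) h1 h2 k (v w) (hv w) K hK hS' q.2
    simp only [Set.mem_setOf_eq, hH, B]
    rw [← Real.exp_sum, ← Real.exp_add, ← Real.exp_add, ← Finset.mul_sum]
    apply Real.one_le_exp
    have d' := mul_le_mul_of_nonneg_left d hc.le
    have w' := mul_le_mul_of_nonneg_left hw ha0
    have e : c * (Real.sqrt n * (-∑ b, v w b * q.2 b)) = - (a * ∑ b, v w b * q.2 b) := by
      rw [ha]; ring
    rw [e] at d'
    rw [mul_add] at w' d'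
    linarith
  calc _ ≤ ((stdG (Fin m)).prod (stdG (Fin n))).real {q | 1 ≤ B * H q} := measureReal_mono sub
    _ = 1 * ((stdG (Fin m)).prod (stdG (Fin n))).real {q | 1 ≤ B * H q} := (one_mul _).symm
    _ ≤ ∫ q, B * H q ∂((stdG (Fin m)).prod (stdG (Fin n))) :=
        mul_meas_ge_le_integral_of_nonneg (Filter.Eventually.of_forall fun q => by
          simp only [hH, B]; positivity) (hHint.const_mul _) 1
    _ = _ := by rw [integral_const_mul, hHval]; ring


lemma sph_calc (c α τ : ℝ) (hc : 0 < c) (hα : 0 < α) (hτ : 0 < τ) :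
    -(c * τ) - (α / 2) * Real.log (1 + c / (2 * τ)) ≤ c * Isph c α := by
  obtain ⟨s, hs⟩ : ∃ s, s = (Real.sqrt (4 * c ^ 2 + 16 * α) - 2 * c) / 8 := ⟨_, rfl⟩
  have hsq : Real.sqrt (4 * c ^ 2 + 16 * α) ^ 2 = 4 * c ^ 2 + 16 * α := Real.sq_sqrt (by positivity)
  have hq : Real.sqrt (4 * c ^ 2 + 16 * α) = 8 * s + 2 * c := by rw [hs]; ring
  have hqp : 2 * c < Real.sqrt (4 * c ^ 2 + 16 * α) := Real.lt_sqrt_of_sq_lt (by nlinarith)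
  have hspos : 0 < s := by linarith
  rw [hq] at hsq
  have hα' : α = 2 * s * (2 * s + c) := by nlinarith
  have hI : c * Isph c α = -(c * s) - (α / 2) * Real.log (1 + c / (2 * s)) := by
    unfold Isph
    rw [hq]
    have h1 : (2 * c - (8 * s + 2 * c)) / 8 = -s := by ring
    rw [h1]
    have h2 : 1 - c / (2 * -s) = 1 + c / (2 * s) := by
      field_simp; ring
    rw [h2]
    field_simp
  rw [hI]
  have hA : 0 < 1 + c / (2 * s) := by positivity
  have hB : 0 < 1 + c / (2 * τ) := by positivity
  have hlog : Real.log (1 + c / (2 * s)) - Real.log (1 + c / (2 * τ)) ≤ 2 * c * (τ - s) / α := by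
    rw [← Real.log_div hA.ne' hB.ne']
    refine (Real.log_le_sub_one_of_pos (by positivity)).trans ?_
    have e : (1 + c / (2 * s)) / (1 + c / (2 * τ)) - 1 = c * (τ - s) / (s * (2 * τ + c)) := by
      field_simp; ring
    rw [e, hα', div_le_div_iff₀ (by positivity) (by positivity)]
    have : 0 ≤ 4 * c * s * (τ - s) ^ 2 := by positivity
    nlinarith
  have h3 := mul_le_mul_of_nonneg_left hlog (by positivity : 0 ≤ α / 2)
  have h4 : α / 2 * (2 * c * (τ - s) / α) = c * (τ - s) := by field_simp
  rw [h4] at h3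
  linarith

lemma integrable_exp_sum (m : ℕ) (t : ℝ) (ht : 0 ≤ t) :
    Integrable (fun g : Fin m → ℝ => Real.exp (-(t * ∑ i, g i ^ 2))) (stdG (Fin m)) := by
  refine Integrable.of_bound (Continuous.aestronglyMeasurable (by fun_prop)) 1 (Filter.Eventually.of_forall fun g => ?_)
  rw [Real.norm_eq_abs, Real.abs_exp, Real.exp_le_one_iff]
  have : 0 ≤ t * ∑ i, g i ^ 2 := by positivity
  linarith

lemma integral_exp_sum (m : ℕ) (t : ℝ) (ht : 0 ≤ t) :
    ∫ g, Real.exp (-(t * ∑ i, g i ^ 2)) ∂stdG (Fin m) = Real.exp (-(m * (Real.log (1 + 2 * t) / 2))) := by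
  have h := integral_fintype_prod_eq_pow (μ := gaussianReal 0 1) (ι := Fin m) (fun x : ℝ => Real.exp (-(t * x ^ 2)))
  rw [integral_exp_sq t ht, Fintype.card_fin, ← Real.exp_nat_mul] at h
  rw [show -(m * (Real.log (1 + 2 * t) / 2)) = m * -(Real.log (1 + 2 * t) / 2) by ring, ← h]
  refine integral_congr_ae (Filter.Eventually.of_forall fun g => ?_)
  simp only
  rw [← Real.exp_sum, Finset.mul_sum, Finset.sum_neg_distrib]

lemma sph_point (c δ R ρ : ℝ) (J : ℕ) (hc : 0 < c) (hδ : 0 < δ) (hR : 0 < R) (hρ : 0 ≤ ρ) :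
    Real.exp (-(c * R * ρ)) ≤
      Real.exp (R ^ 2 * c * δ) * ∑ j ∈ Finset.range J,
        Real.exp (-(R ^ 2 * (c * ((j + 1) * δ) / 2))) * Real.exp (-(c / (2 * ((j + 1) * δ)) * ρ ^ 2))
      + Real.exp (-(R ^ 2 * c * (J * δ))) := by
  by_cases h : J * δ ≤ ρ / R
  · have : Real.exp (-(c * R * ρ)) ≤ Real.exp (-(R ^ 2 * c * (J * δ))) := by
      apply Real.exp_le_exp.2
      rw [le_div_iff₀ hR] at h
      nlinarith [mul_le_mul_of_nonneg_left h (by positivity : 0 ≤ c * R)]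
    have h2 : 0 ≤ Real.exp (R ^ 2 * c * δ) * ∑ j ∈ Finset.range J,
        Real.exp (-(R ^ 2 * (c * ((j + 1) * δ) / 2))) * Real.exp (-(c / (2 * ((j + 1) * δ)) * ρ ^ 2)) := by positivity
    linarith
  · push Not at h
    set r := ρ / R with hr
    have hr0 : 0 ≤ r := by positivity
    have hρr : ρ = r * R := by rw [hr]; field_simp
    set j := ⌊r / δ⌋₊ with hj
    have hj1 : (j : ℝ) * δ ≤ r := by
      have := Nat.floor_le (by positivity : 0 ≤ r / δ)
      rwa [le_div_iff₀ hδ] at this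
    have hj2 : r < (j + 1) * δ := by
      have := Nat.lt_floor_add_one (r / δ)
      rwa [div_lt_iff₀ hδ] at this
    have hjJ : j ∈ Finset.range J := by
      rw [Finset.mem_range]
      have : (j : ℝ) * δ < J * δ := by linarith
      have := lt_of_mul_lt_mul_right this hδ.le
      exact_mod_cast this
    have h1 := Finset.single_le_sum (f := fun j : ℕ => 
        Real.exp (-(R ^ 2 * (c * ((j + 1) * δ) / 2))) * Real.exp (-(c / (2 * ((j + 1) * δ)) * ρ ^ 2)))
        (fun i _ => by positivity) hjJ
    have h2 := mul_le_mul_of_nonneg_left h1 (Real.exp_pos (R ^ 2 * c * δ)).le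
    refine le_trans ?_ (le_trans h2 (le_add_of_nonneg_right (Real.exp_pos _).le))
    rw [← Real.exp_add, ← Real.exp_add]
    apply Real.exp_le_exp.2
    set T := ((j : ℝ) + 1) * δ with hT
    have hTp : 0 < T := by positivity
    have h3 : c / (2 * T) * ρ ^ 2 ≤ c * T / 2 * R ^ 2 := by
      rw [hρr, div_mul_eq_mul_div, div_le_iff₀ (by positivity)]
      have : r ^ 2 ≤ T ^ 2 := by gcongr
      nlinarith [mul_le_mul_of_nonneg_left this (by positivity : 0 ≤ c * R ^ 2)]
    have h4 : T ≤ r + δ := by rw [hT]; linarith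
    have h5 : c * R * ρ = c * R ^ 2 * r := by rw [hρr]; ring
    rw [h5]
    have h6 := mul_le_mul_of_nonneg_left h4 (by positivity : 0 ≤ c * R ^ 2)
    linarith

lemma sph_bound (c α δ : ℝ) (hc : 0 < c) (hα : 0 < α) (hδ : 0 < δ) :
    ∃ J : ℕ, ∀ m n : ℕ, 0 < n → α * n ≤ m →
      ∫ g, Real.exp (-(c * Real.sqrt n * Real.sqrt (∑ i, g i ^ 2))) ∂stdG (Fin m) ≤
        (J * Real.exp (n * c * δ) + 1) * Real.exp (n * (c * Isph c α)) := by
  obtain ⟨J, hJ⟩ := exists_nat_ge (-Isph c α / δ)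
  rw [div_le_iff₀ hδ] at hJ
  refine ⟨J, fun m n hn hm => ?_⟩
  have hnp : (0:ℝ) < n := by exact_mod_cast hn
  have hR : 0 < Real.sqrt n := Real.sqrt_pos.2 hnp
  have hR2 : Real.sqrt n ^ 2 = n := Real.sq_sqrt hnp.le
  have hint : ∀ j : ℕ, Integrable (fun g : Fin m → ℝ =>
      Real.exp (-(n * (c * ((j + 1) * δ) / 2))) * Real.exp (-(c / (2 * ((j + 1) * δ)) * ∑ i, g i ^ 2))) (stdG (Fin m)) :=
    fun j => (integrable_exp_sum m _ (by positivity)).const_mul _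
  have h1 : ∫ g, Real.exp (-(c * Real.sqrt n * Real.sqrt (∑ i, g i ^ 2))) ∂stdG (Fin m) ≤
      ∫ g : Fin m → ℝ, (Real.exp (n * c * δ) * ∑ j ∈ Finset.range J,
        Real.exp (-(n * (c * ((j + 1) * δ) / 2))) * Real.exp (-(c / (2 * ((j + 1) * δ)) * ∑ i, g i ^ 2))
      + Real.exp (-(n * c * (J * δ)))) ∂stdG (Fin m) := by
    refine integral_mono_of_nonneg (Filter.Eventually.of_forall fun g => (Real.exp_pos _).le) ?_
      (Filter.Eventually.of_forall fun g => ?_)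
    · exact ((integrable_finsetSum _ fun j _ => hint j).const_mul _).add (integrable_const _)
    · have := sph_point c δ (Real.sqrt n) (Real.sqrt (∑ i, g i ^ 2)) J hc hδ hR (Real.sqrt_nonneg _)
      rw [hR2, Real.sq_sqrt (by positivity)] at this
      exact this
  refine h1.trans ?_
  rw [integral_add ((integrable_finsetSum _ fun j _ => hint j).const_mul _) (integrable_const _),
    integral_const_mul, integral_finsetSum _ fun j _ => hint j]
  simp only [integral_const_mul, integral_const, probReal_univ, one_smul]
  have h2 : ∀ j ∈ Finset.range J, Real.exp (-(n * (c * ((j + 1) * δ) / 2))) *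
      ∫ g : Fin m → ℝ, Real.exp (-(c / (2 * ((j + 1) * δ)) * ∑ i, g i ^ 2)) ∂stdG (Fin m) ≤
      Real.exp (n * (c * Isph c α)) := by
    intro j _
    rw [integral_exp_sum m _ (by positivity), ← Real.exp_add]
    apply Real.exp_le_exp.2
    have h3 := sph_calc c α (((j : ℝ) + 1) * δ / 2) hc hα (by positivity)
    have h4 := mul_le_mul_of_nonneg_left h3 hnp.le
    have e : 1 + 2 * (c / (2 * (((j : ℝ) + 1) * δ))) = 1 + c / (2 * (((j : ℝ) + 1) * δ / 2)) := by
      field_simp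
    rw [e]
    have hl : 0 ≤ Real.log (1 + c / (2 * (((j : ℝ) + 1) * δ / 2))) := Real.log_nonneg (by
      have : 0 ≤ c / (2 * (((j : ℝ) + 1) * δ / 2)) := by positivity
      linarith)
    nlinarith [mul_le_mul_of_nonneg_right hm hl]
  have h5 := Finset.sum_le_sum h2
  rw [Finset.sum_const, Finset.card_range, nsmul_eq_mul] at h5
  have h6 := mul_le_mul_of_nonneg_left h5 (Real.exp_pos (n * c * δ)).le
  have h7 : Real.exp (-(n * c * (J * δ))) ≤ Real.exp (n * (c * Isph c α)) := by
    apply Real.exp_le_exp.2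
    nlinarith [mul_le_mul_of_nonneg_left hJ (by positivity : 0 ≤ n * c)]
  linarith


def SS (n k : ℕ) : Set (Fin n → ℝ) :=
  {v | ∑ b, v b ^ 2 = 1 ∧ ∃ K : Finset (Fin n), K.card ≤ k ∧ ∑ i ∈ Kᶜ, |v i| ≤ ∑ i ∈ K, |v i|}

def UU (m : ℕ) {n : ℕ} (v : Fin n → ℝ) : Set (Fin m → Fin n → ℝ) :=
  {A | ∑ i, (∑ b, v b * A i b) ^ 2 < 1}

lemma UU_open (m : ℕ) {n : ℕ} (v : Fin n → ℝ) : IsOpen (UU m v) :=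
  isOpen_lt (by fun_prop) continuous_const

lemma union_bound {m n : ℕ} (S : Set (Fin n → ℝ)) (B : ℝ)
    (h : ∀ W : Finset S, (matrixGaussian m n).real (⋃ w ∈ W, UU m (w : Fin n → ℝ)) ≤ B) :
    matrixGaussian m n (⋃ w : S, UU m (w : Fin n → ℝ)) ≤ ENNReal.ofReal B := by
  have ho : IsOpen (⋃ w : S, UU m (w : Fin n → ℝ)) := isOpen_iUnion fun w => UU_open m _
  have hreg : (matrixGaussian m n).Regular := inferInstance
  rw [ho.measure_eq_iSup_isCompact]
  refine iSup₂_le fun K hK => iSup_le fun hKc => ?_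
  obtain ⟨W, hW⟩ := hKc.elim_finite_subcover (fun w : S => UU m (w : Fin n → ℝ)) (fun w => UU_open m _) hK
  refine (measure_mono hW).trans ?_
  rw [← ofReal_measureReal (measure_ne_top _ _)]
  exact ENNReal.ofReal_le_ofReal (h W)

lemma fin_bound (c γ ν₁ ν₂ G : ℝ) (hc : 0 < c) (hγ : c / 2 < γ) (h1 : 0 ≤ ν₁) (h2 : 0 ≤ ν₂)
    (m n k : ℕ)
    (hG : ∫ g, Real.exp (-(c * Real.sqrt n * Real.sqrt (∑ i, g i ^ 2))) ∂stdG (Fin m) ≤ G)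
    (W : Finset (SS n k)) :
    (matrixGaussian m n).real (⋃ w ∈ W, UU m (w : Fin n → ℝ)) ≤
      Real.sqrt (2 * Real.pi) * Real.exp ((c * Real.sqrt n + 1) ^ 2 / 2) *
      (Real.exp (c * Real.sqrt n * (3 - c * Real.sqrt n) + c * (n * γ + ν₂ * (2 * k - n))) * G *
        Iexp c γ ν₁ ν₂ ^ n) := by
  classical
  have hg := gordon_prob (m := m) (n := n) (W := W) (fun w => ((w : SS n k) : Fin n → ℝ))
    (fun w => (w : SS n k).2.1) (c * Real.sqrt n)
  have hF := F_bound (m := m) (n := n) (W := W) c γ ν₁ ν₂ hc hγ h1 h2 k (fun w => ((w : SS n k) : Fin n → ℝ))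
    (fun w => (w : SS n k).2.1) (fun w => (w : SS n k).2.2)
  have ht := gauss_tail (c * Real.sqrt n) (by positivity)
  have hI : 0 ≤ Iexp c γ ν₁ ν₂ := zero_le_one.trans (Iexp_ge c γ ν₁ ν₂ hc hγ h1 h2)
  have hset : (⋃ w ∈ W, UU m (w : Fin n → ℝ)) =
      {A | ∃ w : W, ∑ i, (∑ b, ((w : SS n k) : Fin n → ℝ) b * A i b) ^ 2 < 1} := by
    ext A
    simp [UU]
  rw [hset]
  set X := (matrixGaussian m n).real {A | ∃ w : W, ∑ i, (∑ b, ((w : SS n k) : Fin n → ℝ) b * A i b) ^ 2 < 1}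
  have hX : 0 ≤ X := measureReal_nonneg
  have h3 := (mul_le_mul_of_nonneg_left ht hX).trans (hg.trans hF)
  have h4 : Real.exp (c * Real.sqrt n * (3 - c * Real.sqrt n) + c * (n * γ + ν₂ * (2 * k - n))) *
      (∫ g, Real.exp (-(c * Real.sqrt n * Real.sqrt (∑ i, g i ^ 2))) ∂stdG (Fin m)) * Iexp c γ ν₁ ν₂ ^ n ≤
      Real.exp (c * Real.sqrt n * (3 - c * Real.sqrt n) + c * (n * γ + ν₂ * (2 * k - n))) * G *
        Iexp c γ ν₁ ν₂ ^ n := by gcongr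
  have h5 := h3.trans h4
  have h6 := mul_le_mul_of_nonneg_left h5
    (by positivity : 0 ≤ Real.sqrt (2 * Real.pi) * Real.exp ((c * Real.sqrt n + 1) ^ 2 / 2))
  refine le_trans (le_of_eq ?_) h6
  rw [Real.exp_neg]
  have : Real.sqrt (2 * Real.pi) ≠ 0 := by positivity
  field_simp

lemma good_of_not {m n k : ℕ} (A : Fin m → Fin n → ℝ) (hA : A ∉ ⋃ w : SS n k, UU m (w : Fin n → ℝ))
    (x : Fin n → ℝ) (hx : ∃ K : Finset (Fin n), K.card ≤ k ∧ ∀ i ∉ K, x i = 0) : UniqueL1Min A x := by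
  obtain ⟨K, hK, hx⟩ := hx
  intro z hz hne
  by_contra hcon
  push Not at hcon
  apply hA
  have hpos : 0 < ∑ i, (z i - x i) ^ 2 := by
    obtain ⟨i, hi⟩ := Function.ne_iff.1 hne
    refine Finset.sum_pos' (fun i _ => sq_nonneg _) ⟨i, Finset.mem_univ _, ?_⟩
    have : z i - x i ≠ 0 := sub_ne_zero.2 hi
    positivity
  set r := Real.sqrt (∑ i, (z i - x i) ^ 2) with hr
  have hrp : 0 < r := Real.sqrt_pos.2 hpos
  have hr2 : r ^ 2 = ∑ i, (z i - x i) ^ 2 := Real.sq_sqrt hpos.le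
  have hcone : ∑ i ∈ Kᶜ, |z i - x i| ≤ ∑ i ∈ K, |z i - x i| := by
    rw [← Finset.sum_add_sum_compl K, ← Finset.sum_add_sum_compl K (fun i => |x i|)] at hcon
    have e1 : ∑ i ∈ Kᶜ, |x i| = 0 := Finset.sum_eq_zero fun i hi => by
      rw [hx i (Finset.mem_compl.1 hi), abs_zero]
    have e2 : ∑ i ∈ Kᶜ, |z i - x i| = ∑ i ∈ Kᶜ, |z i| := Finset.sum_congr rfl fun i hi => by
      rw [hx i (Finset.mem_compl.1 hi), sub_zero]
    have e3 : ∑ i ∈ K, |x i| ≤ ∑ i ∈ K, |z i - x i| + ∑ i ∈ K, |z i| := by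
      rw [← Finset.sum_add_distrib]
      refine Finset.sum_le_sum fun i _ => ?_
      have := abs_sub_abs_le_abs_sub (x i) (z i)
      rw [abs_sub_comm] at this
      linarith
    linarith
  refine Set.mem_iUnion.2 ⟨⟨fun i => (z i - x i) / r, ?_, K, hK, ?_⟩, ?_⟩
  · simp only [div_pow]
    rw [← Finset.sum_div, ← hr2]
    field_simp
  · simp only [abs_div]
    rw [← Finset.sum_div, ← Finset.sum_div]
    gcongr
  · change ∑ i, (∑ b, (z b - x b) / r * A i b) ^ 2 < 1
    have : ∀ i, ∑ b, (z b - x b) / r * A i b = 0 := by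
      intro i
      have e : ∀ b, (z b - x b) / r * A i b = (A i b * z b - A i b * x b) / r := fun b => by ring
      simp only [e]
      rw [← Finset.sum_div, Finset.sum_sub_distrib, hz i, sub_self, zero_div]
    simp [this]

theorem strong_threshold_lifted_lower_bound
    (α β : ℝ) (hα : α ∈ Set.Ioo (0 : ℝ) 1) (hβ : β ∈ Set.Ioo (0 : ℝ) 1)
    (hcond : ∃ c : ℝ, 0 < c ∧ -c / 2 + Istr c β + Isph c α < 0) :
    ∃ ε > (0 : ℝ), ∃ N : ℕ, ∀ n ≥ N,
      1 - ENNReal.ofReal (Real.exp (-ε * n)) ≤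
        matrixGaussian (⌈α * n⌉₊) n
          {A | ∀ x : Fin n → ℝ,
            (∃ K : Finset (Fin n), K.card ≤ ⌈β * n⌉₊ ∧ ∀ i ∉ K, x i = 0) →
              UniqueL1Min A x} := by
  obtain ⟨c, hc, hlt⟩ := hcond
  have hlt' : Istr c β < c / 2 - Isph c α := by linarith
  obtain ⟨v, ⟨γ, ν₁, ν₂, hγ, h1, h2, hv⟩, hvlt⟩ := exists_lt_of_csInf_lt
    (⟨_, c, 0, 0, by linarith, le_rfl, le_rfl, rfl⟩ : Set.Nonempty {v : ℝ | ∃ γ ν₁ ν₂ : ℝ, c / 2 < γ ∧ 0 ≤ ν₁ ∧ 0 ≤ ν₂ ∧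
    v = ν₂ * (2 * β - 1) + γ + (1 / c) * Real.log (Iexp c γ ν₁ ν₂)}) hlt'
  obtain ⟨η, hη⟩ : ∃ η, η = c / 2 - v - Isph c α := ⟨_, rfl⟩
  have hηp : 0 < η := by linarith
  obtain ⟨J, hJ⟩ := sph_bound c α (η / 4) hc hα.1 (by positivity)
  have hI1 := Iexp_ge c γ ν₁ ν₂ hc hγ h1 h2
  have hcv : c * v = c * (ν₂ * (2 * β - 1) + γ) + Real.log (Iexp c γ ν₁ ν₂) := by
    rw [hv]; field_simp
  set I := Iexp c γ ν₁ ν₂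
  have hIp : 0 < I := by linarith
  obtain ⟨C, hC⟩ : ∃ C, C = Real.log (Real.sqrt (2 * Real.pi) * (J + 1)) + 1 / 2 + 2 * c * ν₂ := ⟨_, rfl⟩
  refine ⟨c * η / 4, by positivity, ⌈(16 / η) ^ 2⌉₊ + ⌈4 * |C| / (c * η)⌉₊ + 1, fun n hn => ?_⟩
  have hn0 : 0 < n := by omega
  have hnp : (0:ℝ) < n := by exact_mod_cast hn0
  have hnA : (16 / η) ^ 2 ≤ n := (Nat.le_ceil _).trans (by exact_mod_cast (by omega))
  have hnB : 4 * |C| / (c * η) ≤ n := (Nat.le_ceil _).trans (by exact_mod_cast (by omega))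
  have hB := fun W => fin_bound c γ ν₁ ν₂ _ hc hγ h1 h2 ⌈α * n⌉₊ n ⌈β * n⌉₊
    (hJ ⌈α * n⌉₊ n hn0 (Nat.le_ceil _)) W
  have hU := union_bound _ _ hB
  have hfin : Real.sqrt (2 * Real.pi) * Real.exp ((c * Real.sqrt n + 1) ^ 2 / 2) *
      (Real.exp (c * Real.sqrt n * (3 - c * Real.sqrt n) + c * (n * γ + ν₂ * (2 * ⌈β * n⌉₊ - n))) *
        ((J * Real.exp (n * c * (η / 4)) + 1) * Real.exp (n * (c * Isph c α))) * I ^ n) ≤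
      Real.exp (-(c * η / 4) * n) := by
    have hk : (⌈β * n⌉₊ : ℝ) ≤ β * n + 1 := (Nat.ceil_lt_add_one (by have := hβ.1; positivity)).le
    have hIn : I ^ n = Real.exp (n * Real.log I) := by
      rw [Real.exp_nat_mul, Real.exp_log hIp]
    have hJ1 : (J * Real.exp (n * c * (η / 4)) + 1) ≤ (J + 1) * Real.exp (n * c * (η / 4)) := by
      have : 1 ≤ Real.exp (n * c * (η / 4)) := Real.one_le_exp (by positivity)
      linarith
    have hpp : 0 < Real.sqrt (2 * Real.pi) * (J + 1) := by positivity
    obtain ⟨s, hs⟩ : ∃ s, s = Real.sqrt n := ⟨_, rfl⟩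
    have hs0 : 0 ≤ s := hs ▸ Real.sqrt_nonneg _
    have hs2 : s ^ 2 = n := by rw [hs]; exact Real.sq_sqrt hnp.le
    rw [hIn, ← hs]
    calc _ ≤ Real.sqrt (2 * Real.pi) * Real.exp ((c * s + 1) ^ 2 / 2) *
      (Real.exp (c * s * (3 - c * s) + c * (n * γ + ν₂ * (2 * ⌈β * n⌉₊ - n))) *
        (((J + 1) * Real.exp (n * c * (η / 4))) * Real.exp (n * (c * Isph c α))) * Real.exp (n * Real.log I)) := by
          gcongr
      _ = Real.exp (Real.log (Real.sqrt (2 * Real.pi) * (J + 1)) + ((c * s + 1) ^ 2 / 2 +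
        (c * s * (3 - c * s) + c * (n * γ + ν₂ * (2 * ⌈β * n⌉₊ - n))) + n * c * (η / 4) + n * (c * Isph c α) + n * Real.log I)) := by
          simp only [Real.exp_add]
          rw [Real.exp_log hpp]
          ring
      _ ≤ _ := by
          apply Real.exp_le_exp.2
          have e1 : n * Real.log I = n * (c * v) - n * (c * (ν₂ * (2 * β - 1) + γ)) := by rw [hcv]; ring
          have e2 : n * (c * Isph c α) = n * c * (c / 2 - v - η) := by rw [hη]; ring
          rw [e1, e2]
          have e3 : c * ν₂ * ⌈β * n⌉₊ ≤ c * ν₂ * (β * n + 1) := by gcongr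
          have e4 : C ≤ c * η / 4 * n := by
            rw [div_le_iff₀ (by positivity)] at hnB
            linarith [le_abs_self C]
          have e5 : 16 / η ≤ s := by
            rw [← hs2] at hnA
            exact le_of_sq_le_sq hnA hs0
          have e6 : 4 * c * s ≤ c * η / 4 * n := by
            rw [div_le_iff₀ hηp] at e5
            rw [← hs2]
            nlinarith [mul_le_mul_of_nonneg_left e5 (by positivity : 0 ≤ c * s)]
          have e7 : (c * s + 1) ^ 2 / 2 + c * s * (3 - c * s) = -(c ^ 2 * n / 2) + 4 * c * s + 1 / 2 := by
            rw [← hs2]; ring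
          linarith
  have hU2 := hU.trans (ENNReal.ofReal_le_ofReal hfin)
  have ho : IsOpen (⋃ w : SS n ⌈β * n⌉₊, UU ⌈α * n⌉₊ (w : Fin n → ℝ)) := isOpen_iUnion fun w => UU_open _ _
  calc _ ≤ 1 - matrixGaussian ⌈α * n⌉₊ n (⋃ w : SS n ⌈β * n⌉₊, UU ⌈α * n⌉₊ (w : Fin n → ℝ)) :=
        tsub_le_tsub_left hU2 _
    _ = matrixGaussian ⌈α * n⌉₊ n (⋃ w : SS n ⌈β * n⌉₊, UU ⌈α * n⌉₊ (w : Fin n → ℝ))ᶜ :=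
        (prob_compl_eq_one_sub ho.measurableSet).symm
    _ ≤ _ := measure_mono fun A hA x hx => good_of_not A hA x hx
end
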